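/- arXiv:2310.04138 — 3 statements merged into one kernel-verified Lean document; each statement's English description precedes it below -/
import Mathlib

section
/- For every α > 0 there exists n₀ such that for every n ≥ n₀ the following holds. Let G₁, …, G_n be graphs on the common vertex set V = {1,…,n}, each with minimum degree at least (1/2 + α)n. Then there is a Hamilton cycle C = e₁e₂…e_n (edges indexed cyclically) such that e_i is an edge of G_i for all i ∈ {1,…,n}. -/
namespace RHC

/-- `x` fits at position `i` of the cyclic arrangement `v`. -/
def Fits {V : Type*} (n : ℕ) (N : ℕ → V → Finset V) (v : ℕ → V) (x : V) (i : ℕ) : Prop :=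
  (∀ j < n, (j + 1) % n = i → x ∈ N j (v j)) ∧ x ∈ N i (v ((i + 1) % n))

lemma absorb_finish {V : Type*} (n : ℕ) (N : ℕ → V → Finset V)
    (hsym : ∀ c a b, a ∈ N c b → b ∈ N c a) (v : ℕ → V)
    (hv : ∀ i < n, ∀ j < n, v i = v j → i = j) (P Q : Finset ℕ)
    (hP : ∀ p ∈ P, p < n) (hQ : ∀ q ∈ Q, q < n) (hPQ : ∀ p ∈ P, p ∉ Q)
    (hind : ∀ i < n, (i ∈ P ∨ i ∈ Q) → ¬ ((i + 1) % n ∈ P ∨ (i + 1) % n ∈ Q))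
    (hgood : ∀ i < n, i ∉ Q → (i + 1) % n ∉ Q → v ((i + 1) % n) ∈ N i (v i))
    (t : ℕ → Finset ℕ)
    (habs : ∀ q ∈ Q, Q.card ≤ (t q).card)
    (ht : ∀ q ∈ Q, ∀ p ∈ t q, p ∈ P ∧ Fits n N v (v p) q ∧ Fits n N v (v q) p) :
    ∃ v' : ℕ → V, (∀ i < n, ∀ j < n, v' i = v' j → i = j) ∧
      ∀ i < n, v' ((i + 1) % n) ∈ N i (v' i) := by
  classical
  obtain ⟨f, hfi, hf⟩ := (Finset.all_card_le_biUnion_card_iff_exists_injective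
    (fun q : Q => t q)).1 (by
      intro s
      rcases s.eq_empty_or_nonempty with rfl | ⟨q, hq⟩
      · simp
      · calc s.card ≤ Q.card := by
              simpa using Finset.card_le_univ s
          _ ≤ (t q).card := habs q q.2
          _ ≤ _ := Finset.card_le_card (fun x hx => Finset.mem_biUnion.2 ⟨q, hq, hx⟩))
  let s : ℕ → ℕ := fun i => if h : i ∈ Q then f ⟨i, h⟩ else
    if h : ∃ q : Q, f q = i then (h.choose : ℕ) else i
  have hsQ : ∀ q (h : q ∈ Q), s q = f ⟨q, h⟩ := fun q h => by simp [s, h]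
  have hfP : ∀ q : Q, f q ∈ P := fun q => (ht q q.2 _ (hf q)).1
  have hsf : ∀ q : Q, s (f q) = q := by
    intro q
    have h1 : f q ∉ Q := hPQ _ (hfP q)
    have h2 : ∃ q' : Q, f q' = f q := ⟨q, rfl⟩
    have h3 : s (f q) = h2.choose := by simp only [s, dif_neg h1, dif_pos h2]
    rw [h3, hfi h2.choose_spec]
  have hs0 : ∀ i, i ∉ Q → (∀ q, f q ≠ i) → s i = i := by
    intro i h1 h2
    have : ¬ ∃ q : Q, f q = i := by push Not; exact h2
    simp only [s, dif_neg h1, dif_neg this]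
  have hss : ∀ i, s (s i) = i := by
    intro i
    by_cases h : i ∈ Q
    · rw [hsQ i h, hsf]
    · by_cases h2 : ∃ q : Q, f q = i
      · obtain ⟨q, rfl⟩ := h2
        rw [hsf, hsQ q q.2]
      · push Not at h2
        rw [hs0 i h h2, hs0 i h h2]
  have hslt : ∀ i < n, s i < n := by
    intro i hi
    by_cases h : i ∈ Q
    · rw [hsQ i h]; exact hP _ (hfP _)
    · by_cases h2 : ∃ q : Q, f q = i
      · obtain ⟨q, rfl⟩ := h2
        rw [hsf]; exact hQ _ q.2
      · push Not at h2
        rw [hs0 i h h2]; exact hi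
  have hsPQ : ∀ i, ¬ (i ∈ P ∨ i ∈ Q) → s i = i := by
    intro i hi
    push Not at hi
    exact hs0 i hi.2 (fun q hq => hi.1 (hq ▸ hfP q))
  have hsfit : ∀ i, (i ∈ P ∨ i ∈ Q) → (i ∉ Q ∧ s i = i) ∨ Fits n N v (v (s i)) i := by
    intro i hi
    by_cases h : i ∈ Q
    · right
      rw [hsQ i h]
      exact (ht i h _ (hf ⟨i, h⟩)).2.1
    · by_cases h2 : ∃ q : Q, f q = i
      · obtain ⟨q, rfl⟩ := h2
        right
        rw [hsf]
        exact (ht q q.2 _ (hf q)).2.2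
      · push Not at h2
        exact Or.inl ⟨h, hs0 i h h2⟩
  refine ⟨fun i => v (s i), ?_, ?_⟩
  · intro i hi j hj h
    have := hv _ (hslt i hi) _ (hslt j hj) h
    rw [← hss i, this, hss]
  · intro i hi
    show v (s ((i + 1) % n)) ∈ N i (v (s i))
    by_cases h : i ∈ P ∨ i ∈ Q
    · have h' := hind i hi h
      rw [hsPQ _ h']
      push Not at h'
      rcases hsfit i h with ⟨h1, h2⟩ | h1
      · rw [h2]; exact hgood i hi h1 h'.2
      · exact hsym _ _ _ h1.2
    · rw [hsPQ _ h]
      push Not at h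
      by_cases h' : (i + 1) % n ∈ P ∨ (i + 1) % n ∈ Q
      · rcases hsfit _ h' with ⟨h1, h2⟩ | h1
        · rw [h2]; exact hgood i hi h.2 h1
        · exact h1.1 i hi rfl
      · rw [hsPQ _ h']
        push Not at h'
        exact hgood i hi h.2 h'.2

/-- Families of simple walks in which every vertex is used once at every time. -/
lemma walks {W : Type*} [Fintype W] [DecidableEq W] (N : ℕ → W → Finset W)
    (hsym : ∀ c a b, a ∈ N c b → b ∈ N c a) (K : ℕ)
    (hdeg : ∀ i w, Fintype.card W + 2 * K ≤ 2 * (N i w).card) :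
    ∀ k ≤ K, ∃ a : ℕ → W → W, (∀ i < k, Function.Injective (a i)) ∧
      (∀ i j, i < j → j < k → ∀ u, a i u ≠ a j u) ∧
      ∀ i, i + 1 < k → ∀ u, a (i + 1) u ∈ N i (a i u) := by
  intro k
  induction k with
  | zero => intro _; exact ⟨fun _ => id, by simp, by simp, by simp⟩
  | succ k ih =>
    intro hk
    obtain ⟨a, ha1, ha2, ha3⟩ := ih (by omega)
    rcases Nat.eq_zero_or_pos k with rfl | hk0
    · exact ⟨fun _ => id, fun _ _ => Function.injective_id, by omega, by omega⟩
    let t : W → Finset W := fun u => N (k-1) (a (k-1) u) \ (Finset.range k).image (fun j => a j u)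
    obtain ⟨g, hg, hgt⟩ := (Finset.all_card_le_biUnion_card_iff_exists_injective t).1 (by
      intro s
      rcases s.eq_empty_or_nonempty with rfl | ⟨u, hu⟩
      · simp
      have htc : ∀ u, Fintype.card W ≤ 2 * (t u).card := by
        intro u
        have h1 := Finset.le_card_sdiff ((Finset.range k).image (fun j => a j u)) (N (k-1) (a (k-1) u))
        have h2 : ((Finset.range k).image (fun j => a j u)).card ≤ k := by
          simpa using Finset.card_image_le (s := Finset.range k) (f := fun j => a j u)
        have h3 := hdeg (k-1) (a (k-1) u)
        show _ ≤ 2 * (N (k-1) (a (k-1) u) \ (Finset.range k).image (fun j => a j u)).card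
        omega
      by_cases hs : 2 * s.card ≤ Fintype.card W
      · have h1 : (t u).card ≤ (s.biUnion t).card :=
          Finset.card_le_card (fun x hx => Finset.mem_biUnion.2 ⟨u, hu, hx⟩)
        have := htc u
        omega
      · push Not at hs
        have hall : s.biUnion t = Finset.univ := by
          rw [Finset.eq_univ_iff_forall]
          intro y
          by_contra hy
          simp only [Finset.mem_biUnion, not_exists, not_and] at hy
          have ha : Function.Bijective (a (k-1)) :=
            Finite.injective_iff_bijective.1 (ha1 (k-1) (by omega))
          let e := Equiv.ofBijective _ ha
          let B : Finset W := (N (k-1) y).image e.symm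
          have hB : B.card = (N (k-1) y).card := Finset.card_image_of_injective _ e.symm.injective
          let C : Finset W := (Finset.range k).biUnion (fun j => Finset.univ.filter (fun u => a j u = y))
          have hC : C.card ≤ k := by
            calc C.card ≤ (Finset.range k).card * 1 := by
                  apply Finset.card_biUnion_le_card_mul
                  intro j hj
                  rw [Finset.card_le_one]
                  intro p hp q hq
                  simp only [Finset.mem_filter, Finset.mem_univ, true_and] at hp hq
                  exact ha1 j (Finset.mem_range.1 hj) (hp.trans hq.symm)
              _ = k := by simp
          have hBC : Disjoint (B \ C) s := by
            rw [Finset.disjoint_left]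
            intro u hu hus
            apply hy u hus
            rw [Finset.mem_sdiff] at hu
            obtain ⟨hu1, hu2⟩ := hu
            simp only [B, Finset.mem_image] at hu1
            obtain ⟨z, hz, rfl⟩ := hu1
            have hz' : a (k-1) (e.symm z) = z := e.apply_symm_apply z
            simp only [t, Finset.mem_sdiff]
            refine ⟨?_, ?_⟩
            · rw [hz']; exact hsym _ _ _ hz
            · intro h
              apply hu2
              simp only [Finset.mem_image, Finset.mem_range] at h
              obtain ⟨j, hj, hj2⟩ := h
              simp only [C, Finset.mem_biUnion, Finset.mem_range, Finset.mem_filter, Finset.mem_univ, true_and]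
              exact ⟨j, hj, hj2⟩
          have h4 := Finset.card_union_of_disjoint hBC
          have h5 := Finset.card_le_univ ((B \ C) ∪ s)
          have h6 := Finset.le_card_sdiff C B
          have h7 := hdeg (k-1) y
          omega
        rw [hall]
        exact Finset.card_le_univ s)
    have hgt1 : ∀ u, g u ∈ N (k-1) (a (k-1) u) := fun u => (Finset.mem_sdiff.1 (hgt u)).1
    have hgt2 : ∀ u, ∀ j < k, a j u ≠ g u := by
      intro u j hj h
      apply (Finset.mem_sdiff.1 (hgt u)).2
      exact Finset.mem_image.2 ⟨j, Finset.mem_range.2 hj, h⟩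
    refine ⟨fun i => if i < k then a i else g, ?_, ?_, ?_⟩
    · intro i hi
      by_cases h : i < k
      · simpa [h] using ha1 i h
      · simpa [h] using hg
    · intro i j hij hj u
      have h : i < k := by omega
      by_cases h' : j < k
      · simpa [h, h'] using ha2 i j hij h' u
      · simpa [h, h'] using hgt2 u i h
    · intro i hi u
      have h : i < k := by omega
      by_cases h' : i + 1 < k
      · simpa [h, h'] using ha3 i h' u
      · have : i = k - 1 := by omega
        simp only [h, h', if_true, if_false]
        rw [this]
        exact hgt1 u

lemma path_avg {W : Type*} [Fintype W] [DecidableEq W] [Nonempty W] (N : ℕ → W → Finset W)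
    (hsym : ∀ c a b, a ∈ N c b → b ∈ N c a) (K : ℕ)
    (hdeg : ∀ i w, Fintype.card W + 2 * K ≤ 2 * (N i w).card) (f : W → ℝ) :
    ∃ p : ℕ → W, (∀ i < K, ∀ j < K, p i = p j → i = j) ∧
      (∀ i, i + 1 < K → p (i + 1) ∈ N i (p i)) ∧
      (Fintype.card W : ℝ) * ∑ i ∈ Finset.range K, f (p i) ≤ K * ∑ w, f w := by
  obtain ⟨a, h1, h2, h3⟩ := walks N hsym K hdeg K le_rfl
  have hsum : ∑ u : W, ∑ i ∈ Finset.range K, f (a i u) = K * ∑ w, f w := by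
    rw [Finset.sum_comm]
    rw [Finset.sum_congr rfl (g := fun _ => ∑ w, f w)]
    · simp
    · intro i hi
      have hb : Function.Bijective (a i) :=
        Finite.injective_iff_bijective.1 (h1 i (Finset.mem_range.1 hi))
      exact hb.sum_comp f
  have hex : ∃ u ∈ (Finset.univ : Finset W), (Fintype.card W : ℝ) * ∑ i ∈ Finset.range K, f (a i u) ≤ K * ∑ w, f w := by
    apply Finset.exists_le_of_sum_le Finset.univ_nonempty
    rw [← Finset.mul_sum, hsum]
    simp
  obtain ⟨u, -, hu⟩ := hex
  refine ⟨fun i => a i u, ?_, fun i hi => h3 i hi u, hu⟩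
  intro i hi j hj h
  rcases lt_trichotomy i j with hij | hij | hij
  · exact absurd h (h2 i j hij hj u)
  · exact hij
  · exact absurd h.symm (h2 j i hij hi u)

end RHC
namespace RHC

noncomputable def Phi {V ι : Type*} [DecidableEq V] [Fintype ι] (lam : ℝ) (S : ι → Finset V)
    (R : Finset V) : ℝ :=
  ∑ x, Real.exp (-(lam * ((S x ∩ R).card / R.card)))

lemma pot_step {V ι : Type*} [DecidableEq V] [Fintype ι] (N : ℕ → V → Finset V)
    (hsym : ∀ c a b, a ∈ N c b → b ∈ N c a) (S : ι → Finset V) (R : Finset V) (K : ℕ)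
    (hK : K < R.card) (hdeg : ∀ i, ∀ w ∈ R, R.card + 2 * K ≤ 2 * (N i w ∩ R).card)
    (lam : ℝ) (hl0 : 0 ≤ lam) (hl : lam * K ≤ R.card - K) :
    ∃ p : ℕ → V, (∀ i < K, ∀ j < K, p i = p j → i = j) ∧ (∀ i, p i ∈ R) ∧
      (∀ i, i + 1 < K → p (i + 1) ∈ N i (p i)) ∧
      Phi lam S (R \ (Finset.range K).image p) ≤
        Phi lam S R * (1 + (lam * K / (R.card - K)) ^ 2) := by
  have hRne : R.Nonempty := Finset.card_pos.1 (by omega)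
  have : Nonempty R := hRne.to_subtype
  set r : ℝ := (R.card : ℝ) with hr
  have hKr : (K : ℝ) < r := by rw [hr]; exact_mod_cast hK
  have hrpos : 0 < r := lt_of_le_of_lt (Nat.cast_nonneg K) hKr
  have hrK : 0 < r - K := by linarith
  let w : ι → ℝ := fun x => Real.exp (-(lam * ((S x ∩ R).card / r)))
  have hw : ∀ x, 0 < w x := fun x => Real.exp_pos _
  let f : R → ℝ := fun u => ∑ x, if (u : V) ∈ S x then w x else 0
  obtain ⟨p', hp1, hp2, hp3⟩ := path_avg (W := R)
    (fun i u => (N i u).subtype (· ∈ R)) (by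
      intro c a b h
      simp only [Finset.mem_subtype] at h ⊢
      exact hsym _ _ _ h) K (by
      intro i u
      have h := hdeg i u u.2
      rw [Finset.card_subtype, Finset.filter_mem_eq_inter]
      simpa using h) f
  let p : ℕ → V := fun i => p' i
  have hpinj : ∀ i < K, ∀ j < K, p i = p j → i = j :=
    fun i hi j hj h => hp1 i hi j hj (Subtype.ext h)
  have hpR : ∀ i, p i ∈ R := fun i => (p' i).2
  refine ⟨p, hpinj, hpR, fun i hi => by simpa using hp2 i hi, ?_⟩
  set I := (Finset.range K).image p with hI
  have hIR : I ⊆ R := by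
    intro x hx
    obtain ⟨i, -, rfl⟩ := Finset.mem_image.1 hx
    exact hpR i
  have hIcard : I.card = K := by
    rw [hI, Finset.card_image_of_injOn, Finset.card_range]
    intro i hi j hj h
    exact hpinj i (by simpa using hi) j (by simpa using hj) h
  have hR'card : ((R \ I).card : ℝ) = r - K := by
    have := Finset.card_sdiff_add_card_eq_card hIR
    rw [hIcard] at this
    have h2 : ((R \ I).card : ℝ) + K = r := by rw [hr]; exact_mod_cast this
    linarith
  -- the two sums
  have hsum1 : ∑ i ∈ Finset.range K, f (p' i) = ∑ x, w x * ((S x ∩ I).card : ℝ) := by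
    simp only [f]
    rw [Finset.sum_comm]
    apply Finset.sum_congr rfl
    intro x _
    have h1 : ((S x ∩ I).card : ℝ) = ∑ i ∈ Finset.range K, if p i ∈ S x then (1 : ℝ) else 0 := by
      rw [Finset.inter_comm, ← Finset.filter_mem_eq_inter, Finset.card_filter, hI,
        Finset.sum_image]
      · push_cast; rfl
      · intro i hi j hj h
        exact hpinj i (by simpa using hi) j (by simpa using hj) h
    rw [h1, Finset.mul_sum]
    apply Finset.sum_congr rfl
    intro i _
    simp [p]
  have hsum2 : ∑ u, f u = ∑ x, w x * ((S x ∩ R).card : ℝ) := by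
    simp only [f]
    rw [Finset.sum_comm]
    apply Finset.sum_congr rfl
    intro x _
    have h1 : ((S x ∩ R).card : ℝ) = ∑ u : R, if (u : V) ∈ S x then (1 : ℝ) else 0 := by
      rw [Finset.inter_comm, ← Finset.filter_mem_eq_inter, Finset.card_filter]
      push_cast
      rw [← Finset.sum_coe_sort R]
    rw [h1, Finset.mul_sum]
    apply Finset.sum_congr rfl
    intro i _
    simp
  rw [hsum1, hsum2] at hp3
  have hcR : (Fintype.card R : ℝ) = r := by simp [hr]
  rw [hcR] at hp3
  let δ : ι → ℝ := fun x => (K * ((S x ∩ R).card / r) - (S x ∩ I).card) / (r - K)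
  have hδsum : 0 ≤ ∑ x, w x * δ x := by
    have : ∑ x, w x * δ x = (K * ∑ x, w x * ((S x ∩ R).card : ℝ) - r * ∑ x, w x * ((S x ∩ I).card : ℝ)) / (r * (r - K)) := by
      rw [Finset.mul_sum, Finset.mul_sum, ← Finset.sum_sub_distrib, Finset.sum_div]
      apply Finset.sum_congr rfl
      intro x _
      simp only [δ]
      field_simp
    rw [this]
    apply div_nonneg (by linarith) (by positivity)
  have hδabs : ∀ x, |δ x| ≤ K / (r - K) := by
    intro x
    simp only [δ]
    rw [abs_div, abs_of_pos hrK]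
    apply div_le_div_of_nonneg_right _ hrK.le
    have h1 : ((S x ∩ R).card : ℝ) / r ≤ 1 := by
      rw [div_le_one hrpos, hr]
      exact_mod_cast Finset.card_le_card Finset.inter_subset_right
    have h2 : ((S x ∩ I).card : ℝ) ≤ K := by
      rw [← hIcard]
      exact_mod_cast Finset.card_le_card Finset.inter_subset_right
    have h3 : 0 ≤ ((S x ∩ R).card : ℝ) / r := by positivity
    have h4 : (0 : ℝ) ≤ (S x ∩ I).card := by positivity
    have hK0 : (0 : ℝ) ≤ K := by positivity
    rw [abs_le]
    constructor <;> nlinarith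
  have hterm : ∀ x, Real.exp (-(lam * ((S x ∩ (R \ I)).card / (R \ I).card))) ≤
      w x * (1 + (lam * K / (r - K)) ^ 2) - lam * (w x * δ x) := by
    intro x
    have hc : ((S x ∩ (R \ I)).card : ℝ) = (S x ∩ R).card - (S x ∩ I).card := by
      have h1 : S x ∩ (R \ I) = (S x ∩ R) \ (S x ∩ I) := by
        ext y; simp only [Finset.mem_inter, Finset.mem_sdiff]; tauto
      have h2 : S x ∩ I ⊆ S x ∩ R := Finset.inter_subset_inter_left hIR
      have h3 := Finset.card_sdiff_add_card_eq_card h2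
      rw [← h1] at h3
      have h4 : ((S x ∩ (R \ I)).card : ℝ) + (S x ∩ I).card = (S x ∩ R).card := by exact_mod_cast h3
      linarith
    have he : -(lam * (((S x ∩ (R \ I)).card : ℝ) / (R \ I).card)) =
        -(lam * ((S x ∩ R).card / r)) + (-(lam * δ x)) := by
      rw [hc, hR'card]
      simp only [δ]
      field_simp
      ring
    rw [he, Real.exp_add]
    show w x * _ ≤ _
    have hab : |lam * δ x| ≤ lam * K / (r - K) := by
      rw [abs_mul, abs_of_nonneg hl0, mul_div_assoc]
      exact mul_le_mul_of_nonneg_left (hδabs x) hl0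
    have hle1 : lam * K / (r - K) ≤ 1 := by rw [div_le_one hrK]; exact hl
    have h5 : |(-(lam * δ x))| ≤ 1 := by rw [abs_neg]; linarith
    have h6 := (abs_le.1 (Real.abs_exp_sub_one_sub_id_le h5)).2
    have h7 : (-(lam * δ x)) ^ 2 ≤ (lam * K / (r - K)) ^ 2 := by
      rw [neg_sq, ← sq_abs]
      exact pow_le_pow_left₀ (abs_nonneg _) hab 2
    have h8 : Real.exp (-(lam * δ x)) ≤ 1 + (lam * K / (r - K)) ^ 2 - lam * δ x := by linarith
    calc w x * Real.exp (-(lam * δ x)) ≤ w x * (1 + (lam * K / (r - K)) ^ 2 - lam * δ x) :=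
          mul_le_mul_of_nonneg_left h8 (hw x).le
      _ = _ := by ring
  calc Phi lam S (R \ I) ≤ ∑ x, (w x * (1 + (lam * K / (r - K)) ^ 2) - lam * (w x * δ x)) :=
        Finset.sum_le_sum (fun x _ => hterm x)
    _ = (∑ x, w x) * (1 + (lam * K / (r - K)) ^ 2) - lam * ∑ x, w x * δ x := by
        rw [Finset.sum_sub_distrib, Finset.sum_mul, Finset.mul_sum]
    _ ≤ (∑ x, w x) * (1 + (lam * K / (r - K)) ^ 2) := by
        have := mul_nonneg hl0 hδsum
        linarith
    _ = _ := rfl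

end RHC
namespace RHC

lemma card_compl_image {V : Type*} [Fintype V] [DecidableEq V] (f : ℕ → V) (L : ℕ)
    (hf : ∀ i < L, ∀ j < L, f i = f j → i = j) :
    (Finset.univ \ (Finset.range L).image f).card + L = Fintype.card V := by
  have h := Finset.card_sdiff_add_card_eq_card (Finset.subset_univ ((Finset.range L).image f))
  rw [Finset.card_image_of_injOn, Finset.card_range, Finset.card_univ] at h
  · exact h
  · intro i hi j hj hij
    exact hf i (by simpa using hi) j (by simpa using hj) hij

lemma phase2 {V ι : Type*} [Fintype V] [DecidableEq V] [Fintype ι] (N : ℕ → V → Finset V)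
    (hsym : ∀ c a b, a ∈ N c b → b ∈ N c a) (S : ι → Finset V)
    (hcov : ∀ c v, ∃ x, S x = N c v) (L0 K T e : ℕ) (he : 1 ≤ e)
    (hsize : L0 + T * K + e ≤ Fintype.card V) (f0 : ℕ → V)
    (hf0 : ∀ i < L0, ∀ j < L0, f0 i = f0 j → i = j)
    (lam ρ : ℝ) (hlam : 0 < lam) (hlamK : lam * K ≤ e) (hρ : 1 / 2 ≤ ρ)
    (hρe : (e : ℝ) + 2 * K ≤ 2 * ρ * e)
    (hstart : Phi lam S (Finset.univ \ (Finset.range L0).image f0) * (1 + (lam * K / e) ^ 2) ^ T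
      < Real.exp (-(lam * ρ))) :
    ∃ f : ℕ → V, (∀ i < L0, f i = f0 i) ∧
      (∀ i < L0 + T * K, ∀ j < L0 + T * K, f i = f j → i = j) ∧
      ∀ i, L0 ≤ i → i + 1 < L0 + T * K → ¬ K ∣ (i + 1 - L0) → f (i + 1) ∈ N i (f i) := by
  set Φ0 := Phi lam S (Finset.univ \ (Finset.range L0).image f0) with hΦ0
  have hΦ0n : 0 ≤ Φ0 := Finset.sum_nonneg (fun x _ => (Real.exp_pos _).le)
  have hepos : (0 : ℝ) < e := by exact_mod_cast he
  have main : ∀ t ≤ T, ∃ f : ℕ → V, (∀ i < L0, f i = f0 i) ∧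
      (∀ i < L0 + t * K, ∀ j < L0 + t * K, f i = f j → i = j) ∧
      (∀ i, L0 ≤ i → i + 1 < L0 + t * K → ¬ K ∣ (i + 1 - L0) → f (i + 1) ∈ N i (f i)) ∧
      Phi lam S (Finset.univ \ (Finset.range (L0 + t * K)).image f) ≤
        Φ0 * (1 + (lam * K / e) ^ 2) ^ t := by
    intro t
    induction t with
    | zero =>
      intro _
      refine ⟨f0, fun _ _ => rfl, by simpa using hf0, by intro i h1 h2; omega, by simp [hΦ0]⟩
    | succ t ih =>
      intro ht
      obtain ⟨f, hf1, hf2, hf3, hf4⟩ := ih (by omega)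
      set L := L0 + t * K with hL
      have hL' : L0 + (t + 1) * K = L + K := by rw [hL]; ring
      have hLT : L + K ≤ L0 + T * K := by
        rw [← hL']
        have := Nat.mul_le_mul_right K ht
        omega
      set R := Finset.univ \ (Finset.range L).image f with hR
      have hRc : R.card + L = Fintype.card V := card_compl_image f L hf2
      have hRe : e + K ≤ R.card := by omega
      have hRe' : (e : ℝ) + K ≤ R.card := by exact_mod_cast hRe
      have hRpos : (0 : ℝ) < R.card := by
        have : (0 : ℝ) ≤ K := by positivity
        linarith
      have hη : (1 : ℝ) ≤ 1 + (lam * K / e) ^ 2 := by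
        have := sq_nonneg (lam * K / e); linarith
      have hlt : Phi lam S R < Real.exp (-(lam * ρ)) := by
        refine lt_of_le_of_lt (hf4.trans ?_) hstart
        exact mul_le_mul_of_nonneg_left (pow_le_pow_right₀ hη (by omega)) hΦ0n
      have hdeg : ∀ i, ∀ w ∈ R, R.card + 2 * K ≤ 2 * (N (L + i) w ∩ R).card := by
        intro i w _
        obtain ⟨x, hx⟩ := hcov (L + i) w
        rw [← hx]
        have h1 : Real.exp (-(lam * ((S x ∩ R).card / R.card))) ≤ Phi lam S R :=
          Finset.single_le_sum (f := fun x => Real.exp (-(lam * ((S x ∩ R).card / (R.card : ℝ)))))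
            (fun x _ => (Real.exp_pos _).le) (Finset.mem_univ x)
        have h2 := Real.exp_lt_exp.1 (lt_of_le_of_lt h1 hlt)
        have h3 : ρ < (S x ∩ R).card / R.card := by
          have : lam * ρ < lam * ((S x ∩ R).card / R.card) := by linarith
          exact lt_of_mul_lt_mul_left this hlam.le
        rw [lt_div_iff₀ hRpos] at h3
        have h4 : (R.card : ℝ) + 2 * K ≤ 2 * (S x ∩ R).card := by
          have : (2 * ρ - 1) * e ≤ (2 * ρ - 1) * R.card := by
            apply mul_le_mul_of_nonneg_left _ (by linarith)
            have : (0 : ℝ) ≤ K := by positivity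
            linarith
          linarith
        exact_mod_cast h4
      obtain ⟨p, hp1, hp2, hp3, hp4⟩ := pot_step (fun i => N (L + i))
        (fun c a b h => hsym _ _ _ h) S R K (by omega) hdeg lam hlam.le (by linarith)
      have hpR : ∀ i, ∀ j < L, f j ≠ p i := by
        intro i j hj h
        have := hp2 i
        rw [hR, Finset.mem_sdiff] at this
        exact this.2 (Finset.mem_image.2 ⟨j, Finset.mem_range.2 hj, h⟩)
      let f' : ℕ → V := fun i => if i < L then f i else p (i - L)
      have hf'1 : ∀ i < L, f' i = f i := fun i hi => by simp [f', hi]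
      have hf'2 : ∀ i, f' (L + i) = p i := fun i => by simp [f']
      refine ⟨f', ?_, ?_, ?_, ?_⟩
      · intro i hi
        rw [hf'1 i (by omega), hf1 i hi]
      · rw [hL']
        intro i hi j hj hij
        rcases lt_or_ge i L with h1 | h1 <;> rcases lt_or_ge j L with h2 | h2
        · rw [hf'1 i h1, hf'1 j h2] at hij
          exact hf2 i h1 j h2 hij
        · obtain ⟨j, rfl⟩ := Nat.exists_eq_add_of_le h2
          rw [hf'1 i h1, hf'2] at hij
          exact absurd hij (hpR _ _ h1)
        · obtain ⟨i, rfl⟩ := Nat.exists_eq_add_of_le h1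
          rw [hf'1 j h2, hf'2] at hij
          exact absurd hij.symm (hpR _ _ h2)
        · obtain ⟨i, rfl⟩ := Nat.exists_eq_add_of_le h1
          obtain ⟨j, rfl⟩ := Nat.exists_eq_add_of_le h2
          rw [hf'2, hf'2] at hij
          rw [hp1 i (by omega) j (by omega) hij]
      · rw [hL']
        intro i hi1 hi2 hi3
        rcases lt_or_ge (i + 1) L with h1 | h1
        · rw [hf'1 _ h1, hf'1 i (by omega)]
          exact hf3 i hi1 h1 hi3
        · rcases Nat.eq_or_lt_of_le h1 with h2 | h2
          · exfalso
            apply hi3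
            rw [← h2, hL]
            simp
          · obtain ⟨i, rfl⟩ := Nat.exists_eq_add_of_le (show L ≤ i by omega)
            have h5 := hp3 i (by omega)
            rw [← hf'2, ← hf'2] at h5
            exact h5
      · have hset : Finset.univ \ (Finset.range (L0 + (t + 1) * K)).image f' =
            R \ (Finset.range K).image p := by
          rw [hL', hR]
          ext y
          simp only [Finset.mem_sdiff, Finset.mem_univ, true_and, Finset.mem_image,
            Finset.mem_range, not_exists, not_and]
          constructor
          · intro h
            exact ⟨fun i hi => hf'1 i hi ▸ h i (by omega), fun i hi => hf'2 i ▸ h (L + i) (by omega)⟩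
          · rintro ⟨h1, h2⟩ i hi
            rcases lt_or_ge i L with h3 | h3
            · rw [hf'1 i h3]; exact h1 i h3
            · obtain ⟨i, rfl⟩ := Nat.exists_eq_add_of_le h3
              rw [hf'2]; exact h2 i (by omega)
        rw [hset]
        refine hp4.trans ?_
        rw [pow_succ _ t, ← mul_assoc]
        apply mul_le_mul hf4 _ (by positivity) (by positivity)
        have : lam * K / (R.card - K) ≤ lam * K / e :=
          div_le_div_of_nonneg_left (by positivity) hepos (by linarith)
        have h0 : 0 ≤ lam * K / (R.card - K) := div_nonneg (by positivity) (by linarith)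
        have := pow_le_pow_left₀ h0 this 2
        linarith
  obtain ⟨f, h1, h2, h3, -⟩ := main T le_rfl
  exact ⟨f, h1, h2, h3⟩

end RHC
namespace RHC

lemma triple_exists {V κ : Type*} [Fintype V] [DecidableEq V] [Fintype κ] [Nonempty κ]
    (N : ℕ → V → Finset V)
    (hsym : ∀ c a b, a ∈ N c b → b ∈ N c a) (D E : ℕ)
    (hD : ∀ c a b, D ≤ (N c a ∩ N c b).card) (w : κ → V) (Y : κ → Finset V)
    (hY : ∀ T, D ≤ (Y T).card) (U : Finset V) (hE1 : 1 ≤ E) (hE : E + U.card + 2 ≤ D)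
    (c₁ c₂ : ℕ) (ω : κ → ℝ) (hω : ∀ T, 0 ≤ ω T) :
    ∃ y x z : V, y ∉ U ∧ x ∉ U ∧ z ∉ U ∧ x ≠ y ∧ z ≠ y ∧ z ≠ x ∧ x ∈ N c₁ y ∧ z ∈ N c₂ y ∧
      (E : ℝ) ^ 3 * ∑ T, ω T ≤ (Fintype.card V : ℝ) ^ 3 *
        ∑ T, ω T * (if y ∈ Y T ∧ w T ∈ N c₁ x ∧ w T ∈ N c₂ z then 1 else 0) := by
  classical
  let Tr : Finset (V × V × V) := Finset.univ.filter (fun s => s.1 ∉ U ∧ s.2.1 ∉ U ∧ s.2.2 ∉ U ∧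
    s.2.1 ≠ s.1 ∧ s.2.2 ≠ s.1 ∧ s.2.2 ≠ s.2.1 ∧ s.2.1 ∈ N c₁ s.1 ∧ s.2.2 ∈ N c₂ s.1)
  let gd : κ → V × V × V → Prop := fun T s => s.1 ∈ Y T ∧ w T ∈ N c₁ s.2.1 ∧ w T ∈ N c₂ s.2.2
  have hcount : ∀ T, E ^ 3 ≤ (Tr.filter (gd T)).card := by
    intro T
    let B : Finset (Σ _ : V, Σ _ : V, V) := (Y T \ U).sigma (fun y =>
      ((N c₁ y ∩ N c₁ (w T)) \ (insert y U)).sigma (fun x =>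
        (N c₂ y ∩ N c₂ (w T)) \ (insert x (insert y U))))
    have hB : E ^ 3 ≤ B.card := by
      rw [Finset.card_sigma]
      have h1 : ∀ y ∈ Y T \ U, E ^ 2 ≤ (((N c₁ y ∩ N c₁ (w T)) \ (insert y U)).sigma (fun x =>
        (N c₂ y ∩ N c₂ (w T)) \ (insert x (insert y U)))).card := by
        intro y _
        rw [Finset.card_sigma]
        have h2 : ∀ x ∈ (N c₁ y ∩ N c₁ (w T)) \ (insert y U),
            E ≤ ((N c₂ y ∩ N c₂ (w T)) \ (insert x (insert y U))).card := by
          intro x _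
          have h3 := Finset.le_card_sdiff (insert x (insert y U)) (N c₂ y ∩ N c₂ (w T))
          have h4 := Finset.card_insert_le x (insert y U)
          have h5 := Finset.card_insert_le y U
          have h6 := hD c₂ y (w T)
          omega
        have h7 := Finset.card_nsmul_le_sum _ _ _ h2
        refine le_trans ?_ h7
        rw [smul_eq_mul, sq]
        apply Nat.mul_le_mul_right
        have h3 := Finset.le_card_sdiff (insert y U) (N c₁ y ∩ N c₁ (w T))
        have h5 := Finset.card_insert_le y U
        have h6 := hD c₁ y (w T)
        omega
      have h7 := Finset.card_nsmul_le_sum _ _ _ h1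
      refine le_trans ?_ h7
      rw [smul_eq_mul, pow_succ, mul_comm]
      apply Nat.mul_le_mul_right
      have h3 := Finset.le_card_sdiff U (Y T)
      have h6 := hY T
      omega
    refine hB.trans (Finset.card_le_card_of_injOn (fun s => (s.1, s.2.1, s.2.2)) ?_ ?_)
    · rintro ⟨y, x, z⟩ hs
      simp only [B, Finset.coe_sigma, Set.mem_sigma_iff, Finset.mem_coe, Finset.mem_sdiff, Finset.mem_inter,
        Finset.mem_insert, not_or] at hs
      obtain ⟨⟨hy1, hy2⟩, ⟨⟨hx1, hx2⟩, hx3, hx4⟩, ⟨hz1, hz2⟩, hz3, hz4, hz5⟩ := hs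
      simp only [Tr, gd, Finset.coe_filter, Finset.mem_filter, Finset.mem_univ, true_and, Set.mem_ofPred_eq]
      exact ⟨⟨hy2, hx4, hz5, hx3, hz4, hz3, hx1, hz1⟩, hy1, hsym _ _ _ hx2, hsym _ _ _ hz2⟩
    · rintro ⟨y, x, z⟩ _ ⟨y', x', z'⟩ _ h
      simp only [Prod.mk.injEq] at h
      obtain ⟨rfl, rfl, rfl⟩ := h
      rfl
  have hne : Tr.Nonempty := by
    obtain ⟨T⟩ := ‹Nonempty κ›
    have h1 := hcount T
    have h2 : 1 ≤ E ^ 3 := Nat.one_le_pow _ _ hE1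
    have h3 : (Tr.filter (gd T)).Nonempty := Finset.card_pos.1 (by omega)
    exact h3.mono (Finset.filter_subset _ _)
  have hTr : (Tr.card : ℝ) ≤ (Fintype.card V : ℝ) ^ 3 := by
    have := Finset.card_le_univ Tr
    simp only [Fintype.card_prod] at this
    have h2 : (Tr.card : ℝ) ≤ (Fintype.card V : ℝ) * (Fintype.card V * Fintype.card V) := by
      exact_mod_cast this
    linarith [show (Fintype.card V : ℝ) * (Fintype.card V * Fintype.card V) = (Fintype.card V : ℝ) ^ 3 by ring]
  have hS : 0 ≤ ∑ T, ω T := Finset.sum_nonneg (fun T _ => hω T)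
  have hex : ∃ s ∈ Tr, (E : ℝ) ^ 3 * ∑ T, ω T ≤ (Fintype.card V : ℝ) ^ 3 *
        ∑ T, ω T * (if gd T s then 1 else 0) := by
    apply Finset.exists_le_of_sum_le hne
    rw [Finset.sum_const, nsmul_eq_mul, ← Finset.mul_sum, Finset.sum_comm]
    have h1 : (E : ℝ) ^ 3 * ∑ T, ω T ≤ ∑ T, ∑ s ∈ Tr, ω T * (if gd T s then (1 : ℝ) else 0) := by
      rw [Finset.mul_sum]
      apply Finset.sum_le_sum
      intro T _
      rw [← Finset.mul_sum, mul_comm]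
      apply mul_le_mul_of_nonneg_left _ (hω T)
      rw [Finset.sum_boole]
      exact_mod_cast hcount T
    exact mul_le_mul hTr h1 (by positivity) (by positivity)
  obtain ⟨⟨y, x, z⟩, hs, hle⟩ := hex
  simp only [Tr, Finset.mem_filter, Finset.mem_univ, true_and] at hs
  obtain ⟨h1, h2, h3, h4, h5, h6, h7, h8⟩ := hs
  exact ⟨y, x, z, h1, h2, h3, h4, h5, h6, h7, h8, by convert hle⟩

/-- The `j`-th triple of `f` absorbs `w` and releases a vertex of `Y`. -/
def Good {V : Type*} (N : ℕ → V → Finset V) (f : ℕ → V) (w : V) (Y : Finset V) (j : ℕ) : Prop :=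
  f (4 * j + 2) ∈ Y ∧ w ∈ N (4 * j + 1) (f (4 * j + 1)) ∧ w ∈ N (4 * j + 2) (f (4 * j + 3))

open Classical in
lemma phase1 {V κ : Type*} [Fintype V] [DecidableEq V] [Fintype κ] [Nonempty κ]
    (N : ℕ → V → Finset V)
    (hsym : ∀ c a b, a ∈ N c b → b ∈ N c a) (D E m : ℕ)
    (hD : ∀ c a c' b, D ≤ (N c a ∩ N c' b).card) (w : κ → V) (Y : κ → Finset V)
    (hY : ∀ T, D ≤ (Y T).card) (hE1 : 1 ≤ E) (hE : E + 4 * m + 2 ≤ D) :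
    ∀ j ≤ m, ∃ f : ℕ → V, (∀ i < 4 * j, ∀ i' < 4 * j, f i = f i' → i = i') ∧
      (∀ i, i + 1 < 4 * j → f (i + 1) ∈ N i (f i)) ∧
      ∑ T, (1 / 2 : ℝ) ^ ((Finset.range j).filter (Good N f (w T) (Y T))).card ≤
        Fintype.card κ * (1 - (E / Fintype.card V : ℝ) ^ 3 / 2) ^ j := by
  have hV : Nonempty V := by
    obtain ⟨T⟩ := ‹Nonempty κ›
    exact ⟨w T⟩
  have hVpos : (0 : ℝ) < Fintype.card V := by exact_mod_cast Fintype.card_pos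
  have hEV : (E : ℝ) ≤ Fintype.card V := by
    obtain ⟨T⟩ := ‹Nonempty κ›
    have h1 := hY T
    have h2 := Finset.card_le_univ (Y T)
    have : E ≤ Fintype.card V := by omega
    exact_mod_cast this
  set β : ℝ := (E / Fintype.card V : ℝ) ^ 3 with hβ
  have hβ1 : β ≤ 1 := pow_le_one₀ (by positivity) (by rw [div_le_one hVpos]; exact hEV)
  intro j
  induction j with
  | zero =>
    intro _
    obtain ⟨v⟩ := hV
    refine ⟨fun _ => v, by simp, by simp, by simp⟩
  | succ j ih =>
    intro hj
    obtain ⟨f, hf1, hf2, hf3⟩ := ih (by omega)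
    set ω : κ → ℝ := fun T => (1 / 2 : ℝ) ^ ((Finset.range j).filter (Good N f (w T) (Y T))).card with hω
    let U : Finset V := (Finset.range (4 * j)).image f
    have hU : U.card ≤ 4 * j := by
      simpa using Finset.card_image_le (s := Finset.range (4 * j)) (f := f)
    have hUf : ∀ i < 4 * j, ∀ y, y ∉ U → f i ≠ y := by
      intro i hi y hy h
      exact hy (Finset.mem_image.2 ⟨i, Finset.mem_range.2 hi, h⟩)
    obtain ⟨y, x, z, hy, hx, hz, hxy, hzy, hzx, hNx, hNz, hsum⟩ := triple_exists N hsym D E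
      (fun c a b => hD c a c b) w Y hY U hE1 (by omega) (4 * j + 1) (4 * j + 2) ω
      (fun T => by positivity)
    obtain ⟨u, hu⟩ : ((N (4 * j - 1) (f (4 * j - 1)) ∩ N (4 * j) x) \
        (insert x (insert y (insert z U)))).Nonempty := by
      apply Finset.card_pos.1
      have h3 := Finset.le_card_sdiff (insert x (insert y (insert z U)))
        (N (4 * j - 1) (f (4 * j - 1)) ∩ N (4 * j) x)
      have h4 := Finset.card_insert_le x (insert y (insert z U))
      have h5 := Finset.card_insert_le y (insert z U)
      have h6 := Finset.card_insert_le z U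
      have h7 := hD (4 * j - 1) (f (4 * j - 1)) (4 * j) x
      omega
    simp only [Finset.mem_sdiff, Finset.mem_inter, Finset.mem_insert, not_or] at hu
    obtain ⟨⟨hu1, hu2⟩, hux, huy, huz, huU⟩ := hu
    let f' : ℕ → V := fun i => if i < 4 * j then f i else if i = 4 * j then u else
      if i = 4 * j + 1 then x else if i = 4 * j + 2 then y else z
    have e : ∀ i < 4 * j, f' i = f i := fun i hi => by simp [f', hi]
    have e0 : f' (4 * j) = u := by simp [f']
    have e1 : f' (4 * j + 1) = x := by simp [f']
    have e2 : f' (4 * j + 2) = y := by simp [f']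
    have e3 : f' (4 * j + 3) = z := by simp [f']
    have hcase : ∀ i < 4 * (j + 1), i < 4 * j ∨ i = 4 * j ∨ i = 4 * j + 1 ∨ i = 4 * j + 2 ∨ i = 4 * j + 3 := by
      intro i hi; omega
    refine ⟨f', ?_, ?_, ?_⟩
    · intro i hi i' hi' h
      rcases hcase i hi with h1 | rfl | rfl | rfl | rfl <;>
      rcases hcase i' hi' with h2 | rfl | rfl | rfl | rfl <;>
      (try simp only [e0, e1, e2, e3] at h) <;> first
        | rfl
        | (rw [e _ h1, e _ h2] at h; exact hf1 _ h1 _ h2 h)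
        | (rw [e _ h1] at h; exfalso; first
            | exact hUf _ h1 _ huU h
            | exact hUf _ h1 _ hx h
            | exact hUf _ h1 _ hy h
            | exact hUf _ h1 _ hz h)
        | (rw [e _ h2] at h; exfalso; first
            | exact hUf _ h2 _ huU h.symm
            | exact hUf _ h2 _ hx h.symm
            | exact hUf _ h2 _ hy h.symm
            | exact hUf _ h2 _ hz h.symm)
        | exact absurd h ‹_›
        | exact absurd h.symm ‹_›
    · intro i hi
      have hc : i + 1 < 4 * j ∨ (i + 1 = 4 * j) ∨ i = 4 * j ∨ i = 4 * j + 1 ∨ i = 4 * j + 2 := by omega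
      rcases hc with h | h | rfl | rfl | rfl
      · rw [e _ h, e i (by omega)]; exact hf2 i h
      · rw [h, e0, e i (by omega)]
        have : i = 4 * j - 1 := by omega
        rw [this]; exact hu1
      · rw [e0, e1]; exact hsym _ _ _ hu2
      · rw [e1, e2]; exact hsym _ _ _ hNx
      · rw [e2, e3]; exact hNz
    · have hcnt : ∀ T, (1 / 2 : ℝ) ^ ((Finset.range (j + 1)).filter (Good N f' (w T) (Y T))).card =
          ω T - 1 / 2 * (ω T * (if y ∈ Y T ∧ w T ∈ N (4 * j + 1) x ∧ w T ∈ N (4 * j + 2) z then 1 else 0)) := by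
        intro T
        have h1 : (Finset.range j).filter (Good N f' (w T) (Y T)) =
            (Finset.range j).filter (Good N f (w T) (Y T)) := by
          apply Finset.filter_congr
          intro i hi
          have hi := Finset.mem_range.1 hi
          unfold Good
          rw [e _ (by omega), e _ (by omega), e _ (by omega)]
        have h2 : Good N f' (w T) (Y T) j ↔ (y ∈ Y T ∧ w T ∈ N (4 * j + 1) x ∧ w T ∈ N (4 * j + 2) z) := by
          unfold Good
          rw [e1, e2, e3]
        rw [Finset.range_add_one, Finset.filter_insert, h1]
        by_cases h3 : y ∈ Y T ∧ w T ∈ N (4 * j + 1) x ∧ w T ∈ N (4 * j + 2) z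
        · rw [if_pos (h2.2 h3), if_pos h3, Finset.card_insert_of_notMem (by simp), pow_succ]
          simp only [hω]
          ring
        · rw [if_neg (fun h => h3 (h2.1 h)), if_neg h3]
          simp [hω]
      rw [Finset.sum_congr rfl (fun T _ => hcnt T), Finset.sum_sub_distrib, ← Finset.mul_sum]
      set Z := ∑ T, ω T * (if y ∈ Y T ∧ w T ∈ N (4 * j + 1) x ∧ w T ∈ N (4 * j + 2) z then (1 : ℝ) else 0) with hZ
      have h4 : β * ∑ T, ω T ≤ Z := by
        rw [hβ, div_pow, div_mul_eq_mul_div, div_le_iff₀ (by positivity)]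
        linarith
      have h5 : ∑ T, ω T - 1 / 2 * Z ≤ (∑ T, ω T) * (1 - β / 2) := by linarith
      refine h5.trans ?_
      rw [pow_succ, ← mul_assoc]
      exact mul_le_mul_of_nonneg_right hf3 (by linarith)

end RHC
namespace RHC

lemma extend_inj {V : Type*} [Fintype V] [DecidableEq V] (L : ℕ) (f : ℕ → V)
    (hf : ∀ i < L, ∀ j < L, f i = f j → i = j) :
    ∃ g : ℕ → V, (∀ i < L, g i = f i) ∧
      ∀ i < Fintype.card V, ∀ j < Fintype.card V, g i = g j → i = j := by
  classical
  obtain ⟨g, hg⟩ := Finset.exists_equiv_extend_of_card_eq (α := Fin (Fintype.card V))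
    (t := (Finset.univ : Finset V)) (by simp)
    (s := Finset.univ.filter (fun i : Fin (Fintype.card V) => i.val < L)) (f := fun i => f i)
    (by simp) (by
      intro i hi j hj h
      simp at hi hj
      exact Fin.ext (hf i hi j hj h))
  refine ⟨fun i => if h : i < Fintype.card V then (g ⟨i, h⟩ : V) else f i, ?_, ?_⟩
  · intro i hi
    by_cases h : i < Fintype.card V
    · simp only [h, dif_pos]
      exact hg ⟨i, h⟩ (by simpa using hi)
    · simp [h]
  · intro i hi j hj h
    simp only [hi, hj, dif_pos] at h
    have := g.injective (Subtype.ext h)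
    simpa using this

lemma core {V : Type*} [Fintype V] [DecidableEq V] (n : ℕ) (hn : Fintype.card V = n)
    (N : ℕ → V → Finset V)
    (hsym : ∀ c a b, a ∈ N c b → b ∈ N c a) (hper : ∀ c, N (c % n) = N c)
    (D E m K T e k0 : ℕ) (hm : 1 ≤ m) (hK : 3 ≤ K) (hT : 1 ≤ T) (he : 1 ≤ e) (hE1 : 1 ≤ E)
    (hD : ∀ c a c' b, D ≤ (N c a ∩ N c' b).card) (hE : E + 4 * m + 2 ≤ D)
    (hcnt : (n : ℝ) ^ 5 * (1 - (E / n : ℝ) ^ 3 / 2) ^ m < (1 / 2) ^ k0)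
    (hsize : 4 * m + T * K + e ≤ n)
    (lam ρ ρ₀ : ℝ) (hlam : 0 < lam) (hlamK : lam * K ≤ e) (hρ : 1 / 2 ≤ ρ)
    (hρe : (e : ℝ) + 2 * K ≤ 2 * ρ * e) (hρ₀ : 0 ≤ ρ₀)
    (hdeg0 : ∀ c v, ρ₀ * n + 4 * m ≤ (N c v).card)
    (hstart : (n : ℝ) ^ 2 * Real.exp (-(lam * ρ₀)) * (1 + (lam * K / e) ^ 2) ^ T
      < Real.exp (-(lam * ρ)))
    (hgap : T + (n - (4 * m + T * K)) + 1 ≤ k0) :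
    ∃ v' : ℕ → V, (∀ i < n, ∀ j < n, v' i = v' j → i = j) ∧
      ∀ i < n, v' ((i + 1) % n) ∈ N i (v' i) := by
  classical
  have hnpos : 0 < n := by omega
  have hVne : Nonempty V := Fintype.card_pos_iff.1 (by omega)
  have : Nonempty (Fin n) := ⟨⟨0, hnpos⟩⟩
  -- absorbers
  obtain ⟨f0, hf01, hf02, hf03⟩ := phase1 (κ := V × (Fin n × V) × (Fin n × V)) N hsym D E m hD
    (fun T => T.1) (fun T => N T.2.1.1 T.2.1.2 ∩ N T.2.2.1 T.2.2.2) (fun T => hD _ _ _ _) hE1 hE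
    m le_rfl
  have hcount : ∀ (w : V) (c : ℕ) (a : V) (c' : ℕ) (b : V),
      k0 ≤ ((Finset.range m).filter (Good N f0 w (N c a ∩ N c' b))).card := by
    intro w c a c' b
    by_contra hlt
    push Not at hlt
    have h1 := Finset.single_le_sum (f := fun T : V × (Fin n × V) × (Fin n × V) =>
        (1 / 2 : ℝ) ^ ((Finset.range m).filter
          (Good N f0 T.1 (N T.2.1.1 T.2.1.2 ∩ N T.2.2.1 T.2.2.2))).card)
      (fun x _ => by positivity)
      (Finset.mem_univ (w, (⟨c % n, Nat.mod_lt _ hnpos⟩, a), (⟨c' % n, Nat.mod_lt _ hnpos⟩, b)))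
    simp only [hper] at h1
    have h2 := h1.trans hf03
    have h3 : (1 / 2 : ℝ) ^ k0 ≤ (1 / 2 : ℝ) ^ ((Finset.range m).filter (Good N f0 w (N c a ∩ N c' b))).card :=
      pow_le_pow_of_le_one (by norm_num) (by norm_num) hlt.le
    have h4 : (Fintype.card (V × (Fin n × V) × (Fin n × V)) : ℝ) = (n : ℝ) ^ 5 := by
      simp only [Fintype.card_prod, Fintype.card_fin, hn]
      push_cast; ring
    rw [h4, hn] at h2
    linarith
  -- long paths
  obtain ⟨f1, hf11, hf12, hf13⟩ := phase2 (ι := Fin n × V) N hsym (fun x => N x.1 x.2)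
    (fun c v => ⟨(⟨c % n, Nat.mod_lt _ hnpos⟩, v), by simp only [hper]⟩)
    (4 * m) K T e he (by omega) f0 hf01 lam ρ hlam hlamK hρ hρe (by
      refine lt_of_le_of_lt ?_ hstart
      apply mul_le_mul_of_nonneg_right _ (by positivity)
      unfold Phi
      have hRc := card_compl_image f0 (4 * m) hf01
      set R := Finset.univ \ (Finset.range (4 * m)).image f0 with hR
      have hb : ∀ x : Fin n × V, Real.exp (-(lam * ((N x.1 x.2 ∩ R).card / R.card))) ≤
          Real.exp (-(lam * ρ₀)) := by
        intro x
        apply Real.exp_le_exp.2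
        apply neg_le_neg
        apply mul_le_mul_of_nonneg_left _ hlam.le
        have hRpos : 0 < R.card := by omega
        rw [le_div_iff₀ (by exact_mod_cast hRpos)]
        have h1 := hdeg0 x.1 x.2
        have h2 : (N x.1 x.2).card ≤ (N x.1 x.2 ∩ R).card + 4 * m := by
          have h3 : N x.1 x.2 ⊆ (N x.1 x.2 ∩ R) ∪ (Finset.range (4 * m)).image f0 := by
            intro y hy
            simp only [hR, Finset.mem_union, Finset.mem_inter, Finset.mem_sdiff, Finset.mem_univ, true_and]
            tauto
          have h4 := Finset.card_le_card h3
          have h5 := Finset.card_union_le (N x.1 x.2 ∩ R) ((Finset.range (4 * m)).image f0)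
          have h6 : ((Finset.range (4 * m)).image f0).card ≤ 4 * m := by
            simpa using Finset.card_image_le (s := Finset.range (4 * m)) (f := f0)
          omega
        have h2' : ((N x.1 x.2).card : ℝ) ≤ (N x.1 x.2 ∩ R).card + 4 * m := by exact_mod_cast h2
        have h7 : (R.card : ℝ) ≤ n := by
          have : R.card ≤ n := by omega
          exact_mod_cast this
        have h8 := mul_le_mul_of_nonneg_left h7 hρ₀
        linarith
      calc _ ≤ ∑ x : Fin n × V, Real.exp (-(lam * ρ₀)) := Finset.sum_le_sum (fun x _ => hb x)
        _ = _ := by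
          simp only [Finset.sum_const, Finset.card_univ, Fintype.card_prod, Fintype.card_fin, hn,
            nsmul_eq_mul]
          push_cast; ring)
  obtain ⟨v, hv1, hv2⟩ := extend_inj _ f1 hf12
  rw [hn] at hv2
  set L := 4 * m + T * K with hL
  have hLK : 4 * m + K ≤ L := by
    have := Nat.mul_le_mul_right K hT
    omega
  have hv0 : ∀ i < 4 * m, v i = f0 i := fun i hi => by rw [hv1 i (by omega), hf11 i hi]
  let P : Finset ℕ := (Finset.range m).image (fun j => 4 * j + 2)
  let Q : Finset ℕ := (Finset.range T).image (fun t => 4 * m + t * K) ∪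
    (Finset.Ico (L - 1) n).filter (fun i => i % 2 = (n - 1) % 2)
  have memP : ∀ i, i ∈ P ↔ ∃ j < m, 4 * j + 2 = i := by
    intro i; simp [P]
  have memQ : ∀ i, i ∈ Q ↔ (∃ t < T, 4 * m + t * K = i) ∨ (L - 1 ≤ i ∧ i < n ∧ i % 2 = (n - 1) % 2) := by
    intro i; simp [Q, and_assoc]
  have htK : ∀ t < T, 4 * m + t * K + K ≤ L := by
    intro t ht
    have := Nat.mul_le_mul_right K (show t + 1 ≤ T from ht)
    rw [add_mul] at this
    omega
  have hPlt : ∀ p ∈ P, p + 1 < 4 * m := by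
    intro p hp
    obtain ⟨j, hj, rfl⟩ := (memP p).1 hp
    omega
  have hQge : ∀ q ∈ Q, 4 * m ≤ q ∧ q < n := by
    intro q hq
    rcases (memQ q).1 hq with ⟨t, ht, rfl⟩ | h
    · have := htK t ht; omega
    · omega
  have hmod : ∀ i < n, (i + 1 < n ∧ (i + 1) % n = i + 1) ∨ (i + 1 = n ∧ (i + 1) % n = 0) := by
    intro i hi
    rcases Nat.lt_or_ge (i + 1) n with h | h
    · exact Or.inl ⟨h, Nat.mod_eq_of_lt h⟩
    · have h : i + 1 = n := by omega
      exact Or.inr ⟨h, by rw [h, Nat.mod_self]⟩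
  refine absorb_finish n N hsym v hv2 P Q (fun p hp => by have := hPlt p hp; omega)
    (fun q hq => (hQge q hq).2) (fun p hp hq => by have := hPlt p hp; have := hQge p hq; omega)
    ?_ ?_ (fun q => P.filter (fun p => Fits n N v (v p) q ∧ Fits n N v (v q) p)) ?_ ?_
  · intro i hi h1 h2
    rcases hmod i hi with ⟨h3, h4⟩ | ⟨h3, h4⟩
    · rw [h4] at h2
      rcases h1 with h1 | h1 <;> rcases h2 with h2 | h2
      · obtain ⟨j, hj, hj2⟩ := (memP _).1 h1
        obtain ⟨j', hj', hj2'⟩ := (memP _).1 h2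
        omega
      · have := hPlt _ h1; have := hQge _ h2; omega
      · have := hPlt _ h2; have := hQge _ h1; omega
      · rcases (memQ _).1 h1 with ⟨t, ht, h5⟩ | h5 <;> rcases (memQ _).1 h2 with ⟨t', ht', h6⟩ | h6
        · have h7 : t' * K = t * K + 1 := by omega
          have h8 : K ∣ 1 := by
            have h9 : K ∣ t * K + 1 := ⟨t', by rw [← h7, mul_comm]⟩
            exact (Nat.dvd_add_right (Dvd.intro_left t rfl)).1 h9
          have := Nat.le_of_dvd one_pos h8
          omega
        · have := htK t ht; omega
        · have := htK t' ht'; omega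
        · omega
    · rw [h4] at h2
      rcases h2 with h2 | h2
      · obtain ⟨j, hj, hj2⟩ := (memP _).1 h2
        omega
      · have := hQge _ h2; omega
  · intro i hi h1 h2
    rw [memQ] at h1 h2
    push Not at h1 h2
    rcases hmod i hi with ⟨h3, h4⟩ | ⟨h3, h4⟩
    · rw [h4] at h2 ⊢
      have hiL : i + 1 < L := by
        by_contra hcon
        have h5 := h1.2 (by omega) hi
        have h6 := h2.2 (by omega) h3
        omega
      rcases Nat.lt_or_ge (i + 1) (4 * m) with h5 | h5
      · rw [hv0 _ h5, hv0 i (by omega)]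
        exact hf02 i h5
      · have h6 : ¬ K ∣ (i + 1 - 4 * m) := by
          rintro ⟨t, ht⟩
          have h7 : t < T := by
            by_contra hcon
            push Not at hcon
            have := Nat.mul_le_mul_left K hcon
            rw [mul_comm K T] at this
            omega
          exact h2.1 t h7 (by rw [mul_comm t K]; omega)
        have h7 : 4 * m ≤ i := by
          rcases Nat.eq_or_lt_of_le h5 with h8 | h8
          · exfalso; apply h6; rw [← h8]; simp
          · omega
        rw [hv1 _ hiL, hv1 i (by omega)]
        exact hf13 i h7 hiL h6
    · exfalso
      exact h1.2 (by omega) hi (by omega)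
  · intro q hq
    have hQc : Q.card ≤ k0 := by
      have h1 := Finset.card_union_le ((Finset.range T).image (fun t => 4 * m + t * K))
        ((Finset.Ico (L - 1) n).filter (fun i => i % 2 = (n - 1) % 2))
      have h2 : ((Finset.range T).image (fun t => 4 * m + t * K)).card ≤ T := by
        simpa using Finset.card_image_le (s := Finset.range T) (f := fun t => 4 * m + t * K)
      have h3 : ((Finset.Ico (L - 1) n).filter (fun i => i % 2 = (n - 1) % 2)).card ≤ n - (L - 1) := by
        simpa using Finset.card_filter_le (Finset.Ico (L - 1) n) (fun i => i % 2 = (n - 1) % 2)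
      have : Q.card ≤ _ := h1
      omega
    obtain ⟨hq1, hq2⟩ := hQge q hq
    refine hQc.trans ((hcount (v q) (q - 1) (v (q - 1)) q (v ((q + 1) % n))).trans ?_)
    refine Finset.card_le_card_of_injOn (fun j => 4 * j + 2) ?_ ?_
    · intro j hj
      simp only [Finset.coe_filter, Finset.mem_range, Set.mem_ofPred_eq] at hj
      obtain ⟨hjm, hg1, hg2, hg3⟩ := hj
      rw [Finset.mem_inter] at hg1
      simp only [Finset.coe_filter, Set.mem_ofPred_eq]
      refine ⟨(memP _).2 ⟨j, hjm, rfl⟩, ⟨?_, ?_⟩, ⟨?_, ?_⟩⟩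
      · intro i hi hiq
        rw [hv0 (4 * j + 2) (by omega)]
        rcases hmod i hi with ⟨h3, h4⟩ | ⟨h3, h4⟩
        · have : i = q - 1 := by omega
          rw [this]; exact hg1.1
        · omega
      · rw [hv0 (4 * j + 2) (by omega)]; exact hg1.2
      · intro i hi hiq
        rcases hmod i hi with ⟨h3, h4⟩ | ⟨h3, h4⟩
        · have : i = 4 * j + 1 := by omega
          rw [this, hv0 (4 * j + 1) (by omega)]; exact hg2
        · omega
      · have h5 : (4 * j + 2 + 1) % n = 4 * j + 3 := Nat.mod_eq_of_lt (by omega)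
        rw [h5, hv0 (4 * j + 3) (by omega)]; exact hg3
    · intro i _ j _ h
      simp only at h
      omega
  · intro q hq p hp
    exact Finset.mem_filter.1 hp

end RHC
namespace RHC

lemma exp_beats (c C : ℝ) (hc : 0 < c) (hC : 0 < C) (k : ℕ) :
    ∀ᶠ x : ℝ in Filter.atTop, x ^ k * C < Real.exp (c * x) := by
  have h1 : Filter.Tendsto (fun x : ℝ => c * x) Filter.atTop Filter.atTop :=
    Filter.tendsto_id.const_mul_atTop hc
  have h2 := (Real.tendsto_pow_mul_exp_neg_atTop_nhds_zero k).comp h1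
  have h3 : 0 < c ^ k / C := by positivity
  filter_upwards [h2.eventually_lt_const h3] with x hx
  simp only [Function.comp] at hx
  rw [Real.exp_neg, ← div_eq_mul_inv, div_lt_div_iff₀ (Real.exp_pos _) hC, mul_pow] at hx
  have : c ^ k * (x ^ k * C) < c ^ k * Real.exp (c * x) := by linarith
  exact lt_of_mul_lt_mul_left this (by positivity)

lemma nat_large (c C : ℝ) (hc : 0 < c) : ∀ᶠ n : ℕ in Filter.atTop, C ≤ c * n :=
  (tendsto_natCast_atTop_atTop.const_mul_atTop hc).eventually_ge_atTop C

set_option maxHeartbeats 2000000 in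
lemma main_aux (a : ℝ) (ha : 0 < a) (ha4 : a ≤ 1 / 4) :
    ∀ᶠ n : ℕ in Filter.atTop, ∀ N : ℕ → Fin n → Finset (Fin n),
    (∀ c a b, a ∈ N c b → b ∈ N c a) → (∀ c, N (c % n) = N c) →
    (∀ c v, (1 / 2 + a) * n ≤ (N c v).card) →
    ∃ v' : ℕ → Fin n, (∀ i < n, ∀ j < n, v' i = v' j → i = j) ∧
      ∀ i < n, v' ((i + 1) % n) ∈ N i (v' i) := by
  obtain ⟨γ, hγ⟩ : ∃ γ : ℝ, γ = a / 32 := ⟨_, rfl⟩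
  obtain ⟨β, hβ⟩ : ∃ β : ℝ, β = (a / 2) ^ 3 := ⟨_, rfl⟩
  obtain ⟨μ, hμ⟩ : ∃ μ : ℝ, μ = β * γ / 8 := ⟨_, rfl⟩
  have hγ0 : 0 < γ := by rw [hγ]; positivity
  have hβ0 : 0 < β := by rw [hβ]; positivity
  have hμ0 : 0 < μ := by rw [hμ]; positivity
  have hβ1 : β ≤ 1 := by rw [hβ]; exact pow_le_one₀ (by positivity) (by linarith)
  have hμ1 : μ ≤ 1 / 8 := by
    rw [hμ]
    have : γ ≤ 1 := by rw [hγ]; linarith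
    have := mul_le_one₀ hβ1 hγ0.le this
    linarith
  obtain ⟨K, hK⟩ : ∃ K : ℕ, K = ⌈4 / μ⌉₊ + 3 := ⟨_, rfl⟩
  have hK3 : 3 ≤ K := by omega
  have hKμ : 4 ≤ μ * K := by
    have h1 : 4 / μ ≤ K := by
      rw [hK]; push_cast
      have := Nat.le_ceil (4 / μ)
      linarith
    rw [div_le_iff₀ hμ0] at h1
    linarith
  have hKpos : (0 : ℝ) < K := by
    have : 0 < K := by omega
    exact_mod_cast this
  obtain ⟨ξ, hξ⟩ : ∃ ξ : ℝ, ξ = a * μ / (32 * Real.sqrt K) := ⟨_, rfl⟩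
  have hsK : 0 < Real.sqrt K := Real.sqrt_pos.2 hKpos
  have hξ0 : 0 < ξ := by rw [hξ]; positivity
  have hH1 : ∀ᶠ n : ℕ in Filter.atTop, (n : ℝ) ^ 5 * 1 < Real.exp (μ * n) :=
    tendsto_natCast_atTop_atTop.eventually (exp_beats μ 1 hμ0 one_pos 5)
  have hH2 : ∀ᶠ n : ℕ in Filter.atTop, (Real.sqrt n) ^ 4 * Real.exp 1 < Real.exp (ξ * Real.sqrt n) :=
    (Real.tendsto_sqrt_atTop.comp tendsto_natCast_atTop_atTop).eventually
      (exp_beats ξ (Real.exp 1) hξ0 (Real.exp_pos _) 4)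
  filter_upwards [hH1, hH2, nat_large γ 2 hγ0, nat_large a 8 ha, nat_large μ (2 * K + 8) hμ0,
    nat_large (a * μ) (16 * K) (by positivity)] with n h1 h2 h3 h4 h5 h6 N hsym hper hdeg
  have hn0 : (0 : ℝ) ≤ n := by positivity
  have hnK : (16 : ℝ) * K + 64 ≤ n := by
    have := mul_le_mul_of_nonneg_right hμ1 hn0
    linarith
  have hnpos : (0 : ℝ) < n := by linarith
  -- parameters
  obtain ⟨m, hm⟩ : ∃ m : ℕ, m = ⌊γ * n⌋₊ := ⟨_, rfl⟩
  obtain ⟨D, hD⟩ : ∃ D : ℕ, D = ⌊2 * a * n⌋₊ := ⟨_, rfl⟩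
  obtain ⟨E, hE⟩ : ∃ E : ℕ, E = ⌊a * n⌋₊ := ⟨_, rfl⟩
  obtain ⟨k0, hk0⟩ : ∃ k0 : ℕ, k0 = ⌊β * m / 4⌋₊ := ⟨_, rfl⟩
  obtain ⟨e, he⟩ : ∃ e : ℕ, e = ⌊μ * n / 4⌋₊ := ⟨_, rfl⟩
  obtain ⟨T, hT⟩ : ∃ T : ℕ, T = (n - 4 * m - e) / K := ⟨_, rfl⟩
  have hm1 : (m : ℝ) ≤ γ * n := by rw [hm]; exact Nat.floor_le (by positivity)
  have hm2 : γ * n < m + 1 := by rw [hm]; exact Nat.lt_floor_add_one _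
  have hD1 : (D : ℝ) ≤ 2 * a * n := by rw [hD]; exact Nat.floor_le (by positivity)
  have hD2 : 2 * a * n < D + 1 := by rw [hD]; exact Nat.lt_floor_add_one _
  have hE1 : (E : ℝ) ≤ a * n := by rw [hE]; exact Nat.floor_le (by positivity)
  have hE2 : a * n < E + 1 := by rw [hE]; exact Nat.lt_floor_add_one _
  have hk1 : (k0 : ℝ) ≤ β * m / 4 := by rw [hk0]; exact Nat.floor_le (by positivity)
  have hk2 : β * m / 4 < k0 + 1 := by rw [hk0]; exact Nat.lt_floor_add_one _
  have he1 : (e : ℝ) ≤ μ * n / 4 := by rw [he]; exact Nat.floor_le (by positivity)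
  have he2 : μ * n / 4 < e + 1 := by rw [he]; exact Nat.lt_floor_add_one _
  have hmhalf : γ * n / 2 ≤ m := by linarith
  have hβm : μ * n ≤ β * m / 4 := by
    have := mul_le_mul_of_nonneg_left hmhalf hβ0.le
    rw [hμ]; linarith
  have he8 : μ * n / 8 ≤ e := by linarith
  have hγn : γ * n = a * n / 32 := by rw [hγ]; ring
  have han : a * n ≤ n / 4 := by
    have := mul_le_mul_of_nonneg_right ha4 hn0
    linarith
  have hμn : μ * n ≤ n / 8 := by
    have := mul_le_mul_of_nonneg_right hμ1 hn0
    linarith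
  have hbig : 4 * m + e + K ≤ n := by
    have : (4 : ℝ) * m + e + K ≤ n := by linarith
    exact_mod_cast this
  have hTK : T * K ≤ n - 4 * m - e := by rw [hT]; exact Nat.div_mul_le_self _ _
  have hTK2 : n - 4 * m - e < T * K + K := by
    rw [hT]
    have := Nat.lt_div_mul_add (a := n - 4 * m - e) (b := K) (by omega)
    exact this
  have hT1 : 1 ≤ T := by
    rw [hT]
    exact (Nat.one_le_div_iff (by omega)).2 (by omega)
  have hTKn : (T : ℝ) * K ≤ n := by
    have : T * K ≤ n := by omega
    exact_mod_cast this
  have hTμ : (T : ℝ) ≤ μ * n / 4 := by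
    have hT0 : (0 : ℝ) ≤ T := by positivity
    have h7 := mul_le_mul_of_nonneg_left hTKn hμ0.le
    have h8 := mul_le_mul_of_nonneg_left hKμ hT0
    nlinarith
  have hepos : (0 : ℝ) < e := by linarith
  obtain ⟨lam, hlam⟩ : ∃ lam : ℝ, lam = μ / 8 * (Real.sqrt n / Real.sqrt K) := ⟨_, rfl⟩
  have hsn : 0 < Real.sqrt n := Real.sqrt_pos.2 hnpos
  have hsn2 : Real.sqrt n * Real.sqrt n = n := Real.mul_self_sqrt hn0
  have hsK2 : Real.sqrt K * Real.sqrt K = K := Real.mul_self_sqrt hKpos.le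
  have hlam0 : 0 < lam := by rw [hlam]; positivity
  have hlamK : lam * K = μ / 8 * (Real.sqrt n * Real.sqrt K) := by
    rw [hlam]
    nth_rewrite 2 [← hsK2]
    field_simp
  have hsKn : Real.sqrt K ≤ Real.sqrt n := Real.sqrt_le_sqrt (by linarith)
  have hlamKe : lam * K ≤ e := by
    refine le_trans ?_ he8
    rw [hlamK]
    have : Real.sqrt n * Real.sqrt K ≤ n := by
      calc _ ≤ Real.sqrt n * Real.sqrt n := mul_le_mul_of_nonneg_left hsKn hsn.le
        _ = n := hsn2
    have := mul_le_mul_of_nonneg_left this (show 0 ≤ μ / 8 by positivity)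
    linarith
  have hη : (lam * K / e) ^ 2 ≤ K / n := by
    have h7 : lam * K / e ≤ Real.sqrt K / Real.sqrt n := by
      rw [div_le_div_iff₀ hepos hsn, hlamK]
      have := mul_le_mul_of_nonneg_left he8 hsK.le
      calc μ / 8 * (Real.sqrt n * Real.sqrt K) * Real.sqrt n
          = Real.sqrt K * (μ * (Real.sqrt n * Real.sqrt n) / 8) := by ring
        _ = Real.sqrt K * (μ * n / 8) := by rw [hsn2]
        _ ≤ _ := this
    have h8 := pow_le_pow_left₀ (by positivity) h7 2
    rw [div_pow (Real.sqrt K), sq (Real.sqrt K), sq (Real.sqrt n), hsK2, hsn2] at h8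
    exact h8
  refine core n (by simp) N hsym hper D E m K T e k0 ?_ hK3 hT1 ?_ ?_ ?_ ?_ ?_ ?_ lam
    (1 / 2 + a / 2) (1 / 2 + 3 * a / 4) hlam0 hlamKe (by linarith) ?_ (by positivity) ?_ ?_ ?_
  · have : (1 : ℝ) ≤ m := by linarith
    exact_mod_cast this
  · have : (0 : ℝ) < e := hepos
    exact_mod_cast this
  · have : (1 : ℝ) ≤ E := by linarith
    exact_mod_cast this
  · intro c u c' b
    have h7 := hdeg c u
    have h8 := hdeg c' b
    have h9 := Finset.card_union_add_card_inter (N c u) (N c' b)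
    have h10 : (N c u ∪ N c' b).card ≤ n := by simpa using Finset.card_le_univ (N c u ∪ N c' b)
    have h11 : ((N c u).card : ℝ) + (N c' b).card ≤ n + (N c u ∩ N c' b).card := by
      exact_mod_cast (by omega : (N c u).card + (N c' b).card ≤ n + (N c u ∩ N c' b).card)
    have : (D : ℝ) ≤ (N c u ∩ N c' b).card := by linarith
    exact_mod_cast this
  · have : (E : ℝ) + 4 * m + 2 < D + 1 := by linarith
    have : E + 4 * m + 2 < D + 1 := by exact_mod_cast this
    omega
  · have hEn : a / 2 ≤ E / n := by
      rw [le_div_iff₀ hnpos]; linarith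
    have hEn1 : (E : ℝ) / n ≤ 1 := by
      rw [div_le_one hnpos]; linarith
    have h7 : β ≤ (E / n : ℝ) ^ 3 := by
      rw [hβ]; exact pow_le_pow_left₀ (by positivity) hEn 3
    have h8 : (E / n : ℝ) ^ 3 ≤ 1 := pow_le_one₀ (by positivity) hEn1
    have h9 : (1 - (E / n : ℝ) ^ 3 / 2) ^ m ≤ Real.exp (-(β * m / 2)) := by
      have h10 : 1 - (E / n : ℝ) ^ 3 / 2 ≤ Real.exp (-(β / 2)) := by
        have := Real.add_one_le_exp (-(β / 2))
        linarith
      calc _ ≤ Real.exp (-(β / 2)) ^ m := pow_le_pow_left₀ (by linarith) h10 m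
        _ = _ := by rw [← Real.exp_nat_mul]; congr 1; ring
    have h11 : Real.exp (-(β * m / 4)) ≤ (1 / 2 : ℝ) ^ k0 := by
      have h12 : Real.exp (-1) ≤ 1 / 2 := by
        rw [Real.exp_neg, inv_le_comm₀ (Real.exp_pos _) (by norm_num)]
        have := Real.add_one_le_exp 1
        norm_num at this ⊢
        linarith
      calc Real.exp (-(β * m / 4)) ≤ Real.exp (k0 * (-1)) := Real.exp_le_exp.2 (by linarith)
        _ = Real.exp (-1) ^ k0 := Real.exp_nat_mul _ _
        _ ≤ _ := pow_le_pow_left₀ (Real.exp_pos _).le h12 _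
    have h13 : (n : ℝ) ^ 5 < Real.exp (β * m / 4) := by
      have := Real.exp_le_exp.2 hβm
      linarith
    calc (n : ℝ) ^ 5 * (1 - (E / n : ℝ) ^ 3 / 2) ^ m ≤ (n : ℝ) ^ 5 * Real.exp (-(β * m / 2)) :=
          mul_le_mul_of_nonneg_left h9 (by positivity)
      _ < Real.exp (β * m / 4) * Real.exp (-(β * m / 2)) :=
          mul_lt_mul_of_pos_right h13 (Real.exp_pos _)
      _ = Real.exp (-(β * m / 4)) := by rw [← Real.exp_add]; congr 1; ring
      _ ≤ _ := h11
  · omega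
  · have := mul_le_mul_of_nonneg_left he8 ha.le
    linarith
  · intro c v
    have := hdeg c v
    linarith
  · have h7 : (1 + (lam * K / e) ^ 2) ^ T ≤ Real.exp 1 := by
      have h8 : 1 + (lam * K / e) ^ 2 ≤ Real.exp (K / n) := by
        have := Real.add_one_le_exp ((K : ℝ) / n)
        linarith
      calc _ ≤ Real.exp (K / n) ^ T := pow_le_pow_left₀ (by positivity) h8 T
        _ = Real.exp (T * (K / n)) := (Real.exp_nat_mul _ _).symm
        _ ≤ Real.exp 1 := by
          apply Real.exp_le_exp.2
          rw [← mul_div_assoc, div_le_one hnpos]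
          exact hTKn
    have h9 : lam * (a / 4) = ξ * Real.sqrt n := by
      rw [hlam, hξ]; field_simp; norm_num
    have h10 : Real.sqrt n ^ 4 = (n : ℝ) ^ 2 := by
      rw [show Real.sqrt n ^ 4 = (Real.sqrt n * Real.sqrt n) ^ 2 by ring, hsn2]
    rw [h10, ← h9] at h2
    calc (n : ℝ) ^ 2 * Real.exp (-(lam * (1 / 2 + 3 * a / 4))) * (1 + (lam * K / e) ^ 2) ^ T
        ≤ (n : ℝ) ^ 2 * Real.exp (-(lam * (1 / 2 + 3 * a / 4))) * Real.exp 1 :=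
          mul_le_mul_of_nonneg_left h7 (by positivity)
      _ = ((n : ℝ) ^ 2 * Real.exp 1) * Real.exp (-(lam * (1 / 2 + 3 * a / 4))) := by ring
      _ < Real.exp (lam * (a / 4)) * Real.exp (-(lam * (1 / 2 + 3 * a / 4))) :=
          mul_lt_mul_of_pos_right h2 (Real.exp_pos _)
      _ = _ := by rw [← Real.exp_add]; congr 1; ring
  · have h7 : n - (4 * m + T * K) ≤ e + K := by omega
    have h8 : (T : ℝ) + (e + K) + 1 < k0 + 1 := by linarith
    have : T + (e + K) + 1 < k0 + 1 := by exact_mod_cast h8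
    omega

end RHC

/-- Theorem 1.3 (main theorem): for every `α > 0` and `n` sufficiently large, any
ordered collection `G₁,…,G_n` of graphs on the common vertex set `{1,…,n}`, each with
minimum degree at least `(1/2+α)n`, contains a Hamilton cycle `e₁…e_n` with
`e_i ∈ G_i` for all `i`. A Hamilton cycle is encoded by a bijective ordering `σ` of
the vertices, the `i`-th edge joining `σ(i)` and `σ(i+1)` (indices cyclic). -/
theorem stmt_14 (α : ℝ) (hα : 0 < α) :
    ∃ n₀ : ℕ, ∀ n : ℕ, n₀ ≤ n →
    ∀ G : Fin n → SimpleGraph (Fin n),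
    (∀ (i : Fin n) (v : Fin n), (1/2 + α) * n ≤ ((G i).neighborSet v).ncard) →
    ∃ σ : Equiv.Perm (Fin n), ∀ i : Fin n,
      (G i).Adj (σ i) (σ ⟨(i.val + 1) % n, Nat.mod_lt _ i.pos⟩) := by
  classical
  obtain ⟨n₁, hn₁⟩ := Filter.eventually_atTop.1
    (RHC.main_aux (min α (1 / 4)) (by positivity) (min_le_right _ _))
  refine ⟨n₁ + 1, fun n hn G hG => ?_⟩
  have hnpos : 0 < n := by omega
  obtain ⟨v, hv1, hv2⟩ := hn₁ n (by omega)
    (fun c u => Finset.univ.filter (fun w => (G ⟨c % n, Nat.mod_lt _ hnpos⟩).Adj u w))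
    (by
      intro c a b h
      simp only [Finset.mem_filter, Finset.mem_univ, true_and] at h ⊢
      exact h.symm)
    (by
      intro c
      simp only [Nat.mod_mod])
    (by
      intro c u
      have h1 := hG ⟨c % n, Nat.mod_lt _ hnpos⟩ u
      have h2 : ((G ⟨c % n, Nat.mod_lt _ hnpos⟩).neighborSet u).ncard =
          (Finset.univ.filter (fun w => (G ⟨c % n, Nat.mod_lt _ hnpos⟩).Adj u w)).card := by
        rw [← Set.ncard_coe_finset]
        congr 1
        ext w
        simp
      rw [h2] at h1
      refine le_trans ?_ h1
      apply mul_le_mul_of_nonneg_right _ (by positivity)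
      have := min_le_left α (1 / 4)
      linarith)
  have hinj : Function.Injective (fun i : Fin n => v i) :=
    fun i j h => Fin.ext (hv1 i i.2 j j.2 h)
  refine ⟨Equiv.ofBijective _ (Finite.injective_iff_bijective.1 hinj), fun i => ?_⟩
  have h := hv2 i i.2
  simp only [Finset.mem_filter, Finset.mem_univ, true_and, Nat.mod_eq_of_lt i.2] at h
  exact h
end

section
/- For every α > 0 there exists n₀ such that for every n ≥ n₀ the following holds. Let m ∈ ℕ and let G₁, …, G_m be graphs on the common vertex set V = {1,…,n}, each with minimum degree at least (1/2 + α)n. Then for every map χ : {1,…,n} → {1,…,m} there is a Hamilton cycle C = e₁e₂…e_n such that e_i is an edge of G_{χ(i)} for all i ∈ {1,…,n}. -/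
open Finset

/-- Hall-type lemma -/
lemma hall_half {W : Type*} [Fintype W] [DecidableEq W] (B : W → Finset W)
    (h1 : ∀ s, Fintype.card W ≤ 2 * #(B s))
    (h2 : ∀ v, Fintype.card W ≤ 2 * #(univ.filter fun s => v ∈ B s)) :
    ∃ τ : Equiv.Perm W, ∀ s, τ s ∈ B s := by
  have key : ∀ S : Finset W, #S ≤ #(S.biUnion B) := by
    intro S
    rcases S.eq_empty_or_nonempty with rfl | ⟨s, hs⟩
    · simp
    by_cases hS : 2 * #S ≤ Fintype.card W
    · have : #(B s) ≤ #(S.biUnion B) := card_le_card (subset_biUnion_of_mem B hs)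
      have := h1 s
      omega
    · have : S.biUnion B = univ := by
        rw [eq_univ_iff_forall]
        intro v
        have hv := h2 v
        have hne : ¬ Disjoint S (univ.filter fun s => v ∈ B s) := by
          intro hd
          have := card_union_of_disjoint hd
          have h3 := card_le_univ (S ∪ univ.filter fun s => v ∈ B s)
          omega
        rw [not_disjoint_iff] at hne
        obtain ⟨a, ha, hb⟩ := hne
        exact mem_biUnion.2 ⟨a, ha, (mem_filter.1 hb).2⟩
      rw [this]
      exact card_le_univ S
  obtain ⟨f, hf, hfB⟩ := (all_card_le_biUnion_card_iff_exists_injective B).1 key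
  exact ⟨Equiv.ofBijective f (Finite.injective_iff_bijective.1 hf), hfB⟩

/-- Trajectories -/
lemma trajectories {W : Type*} [Fintype W] [DecidableEq W] (B : ℕ → W → Finset W)
    (hs : ∀ i u v, u ∈ B i v ↔ v ∈ B i u) (L : ℕ)
    (hd : ∀ i v, Fintype.card W + 2 * L ≤ 2 * #(B i v)) :
    ∀ l, l ≤ L → ∃ τ : ℕ → Equiv.Perm W,
      (∀ j, j < l → ∀ s, τ (j+1) s ∈ B j (τ j s)) ∧
      (∀ s, ∀ i ≤ l, ∀ j ≤ l, τ i s = τ j s → i = j) := by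
  intro l
  induction l with
  | zero => 
    intro _
    exact ⟨fun _ => 1, by simp, by intro s i hi j hj _; omega⟩
  | succ l ih =>
    intro hl
    obtain ⟨τ, h1, h2⟩ := ih (by omega)
    obtain ⟨ρ, hρ⟩ := hall_half (fun s => B l (τ l s) \ (range (l+1)).image fun i => τ i s)
      (by
        intro s
        have := hd l (τ l s)
        have h3 := le_card_sdiff ((range (l+1)).image fun i => τ i s) (B l (τ l s))
        have h4 : #((range (l+1)).image fun i => τ i s) ≤ l + 1 := by
          simpa using card_image_le (s := range (l+1)) (f := fun i => τ i s)
        omega)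
      (by
        intro v
        have h5 : (B l v).image (τ l).symm \ (range (l+1)).image (fun i => (τ i).symm v) ⊆
            (univ.filter fun s => v ∈ B l (τ l s) \ (range (l+1)).image fun i => τ i s) := by
          intro s
          simp only [mem_sdiff, mem_image, mem_filter, mem_univ, true_and, mem_range]
          rintro ⟨⟨a, ha, rfl⟩, hb⟩
          refine ⟨by simpa using (hs _ _ _).1 ha, ?_⟩
          rintro ⟨i, hi, hi'⟩
          exact hb ⟨i, hi, by rw [← hi']; simp⟩
        have h6 := card_le_card h5
        have h3 := le_card_sdiff ((range (l+1)).image (fun i => (τ i).symm v)) ((B l v).image (τ l).symm)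
        have h4 : #((range (l+1)).image (fun i => (τ i).symm v)) ≤ l + 1 := by
          simpa using card_image_le (s := range (l+1)) (f := (fun i => (τ i).symm v))
        have h7 : #((B l v).image (τ l).symm) = #(B l v) := card_image_of_injective _ (τ l).symm.injective
        have := hd l v
        omega)
    have hne : ∀ s, ∀ i ≤ l, τ i s ≠ ρ s := by
      intro s i hi h
      have := hρ s
      rw [mem_sdiff] at this
      exact this.2 (mem_image.2 ⟨i, by simpa using by omega, h⟩)
    refine ⟨fun i => if i ≤ l then τ i else ρ, ?_, ?_⟩
    · intro j hj s
      by_cases h : j < l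
      · simpa [show j ≤ l by omega, show j + 1 ≤ l by omega] using h1 j h s
      · obtain rfl : j = l := by omega
        simpa using (mem_sdiff.1 (hρ s)).1
    · intro s i hi j hj
      by_cases hi' : i ≤ l <;> by_cases hj' : j ≤ l <;> simp only [hi', hj', if_true, if_false]
      · exact h2 s i hi' j hj'
      · intro h; exact absurd h (hne s i hi')
      · intro h; exact absurd h.symm (hne s j hj')
      · intro _; omega

/-- Absorption -/
lemma absorb {P V : Type*} [Fintype P] [DecidableEq P] [DecidableEq V] (s : Equiv.Perm P)
    (hs : ∀ p, s p ≠ p)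
    (Nb : P → V → Finset V) (hsym : ∀ i u v, u ∈ Nb i v ↔ v ∈ Nb i u) :
    ∀ (k : ℕ) (U T : Finset P) (σ : P ≃ V), #U = k → 
    (∀ p, p ∉ U → s p ∉ U → σ (s p) ∈ Nb p (σ p)) →
    (∀ t ∈ T, t ∉ U ∧ s t ∉ U ∧ s.symm t ∉ U ∧ s t ∉ T ∧ s.symm t ∉ T) →
    (∀ (u : P) (w a b : V), k ≤ #(T.filter fun t => σ t ∈ Nb (s.symm u) a ∧ σ t ∈ Nb u b ∧
       σ (s.symm t) ∈ Nb (s.symm t) w ∧ σ (s t) ∈ Nb t w)) →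
    ∃ σ : P ≃ V, ∀ p, σ (s p) ∈ Nb p (σ p) := by
  intro k
  induction k with
  | zero =>
    intro U T σ hU h1 _ _
    rw [card_eq_zero] at hU
    subst hU
    exact ⟨σ, fun p => h1 p (by simp) (by simp)⟩
  | succ k ih =>
    intro U T σ hU h1 h2 h3
    obtain ⟨u, hu⟩ : U.Nonempty := by rw [← card_pos]; omega
    have h4 := h3 u (σ u) (σ (s.symm u)) (σ (s u))
    obtain ⟨t, ht⟩ : (T.filter fun t => σ t ∈ Nb (s.symm u) (σ (s.symm u)) ∧ σ t ∈ Nb u (σ (s u)) ∧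
       σ (s.symm t) ∈ Nb (s.symm t) (σ u) ∧ σ (s t) ∈ Nb t (σ u)).Nonempty := by
      rw [← card_pos]; omega
    rw [mem_filter] at ht
    obtain ⟨htT, ha, hb, hc, hd⟩ := ht
    obtain ⟨ht1, ht2, ht3, ht4, ht5⟩ := h2 t htT
    have hut : u ≠ t := fun h => ht1 (h ▸ hu)
    have hval : ∀ p, p ≠ u → p ≠ t → ((Equiv.swap u t).trans σ) p = σ p := by
      intro p h h'; simp [Equiv.swap_apply_of_ne_of_ne h h']
    have hvu : ((Equiv.swap u t).trans σ) u = σ t := by simp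
    have hvt : ((Equiv.swap u t).trans σ) t = σ u := by simp
    refine ih (U.erase u) (T.erase t) ((Equiv.swap u t).trans σ) ?_ ?_ ?_ ?_
    · rw [card_erase_of_mem hu]; omega
    · intro p hp hsp
      by_cases hpu : p = u
      · subst hpu
        rw [hvu, hval (s p) (hs p) (by rintro h; apply ht3; simpa [← h] using hu)]
        exact (hsym _ _ _).1 hb
      by_cases hspu : s p = u
      · have hpe : p = s.symm u := by rw [← hspu]; simp
        rw [hspu, hvu, hval p hpu (by rintro h; apply ht2; simpa [← h, hspu] using hu), hpe]
        exact ha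
      by_cases hpt : p = t
      · subst hpt
        rw [hvt, hval (s p) hspu (hs p)]; exact hd
      by_cases hspt : s p = t
      · have hpe : p = s.symm t := by rw [← hspt]; simp
        rw [hspt, hvt, hval p hpu hpt, hsym, hpe]; exact hc
      rw [hval p hpu hpt, hval _ hspu hspt]
      exact h1 p (fun h => hp (mem_erase.2 ⟨hpu, h⟩)) (fun h => hsp (mem_erase.2 ⟨hspu, h⟩))
    · intro t' ht'
      obtain ⟨a1, a2, a3, a4, a5⟩ := h2 t' (mem_of_mem_erase ht')
      exact ⟨fun h => a1 (mem_of_mem_erase h), fun h => a2 (mem_of_mem_erase h),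
        fun h => a3 (mem_of_mem_erase h), fun h => a4 (mem_of_mem_erase h),
        fun h => a5 (mem_of_mem_erase h)⟩
    · intro u' w a b
      have h5 := h3 u' w a b
      have h6 : (T.filter fun t => σ t ∈ Nb (s.symm u') a ∧ σ t ∈ Nb u' b ∧
          σ (s.symm t) ∈ Nb (s.symm t) w ∧ σ (s t) ∈ Nb t w).erase t ⊆
          ((T.erase t).filter fun t' => ((Equiv.swap u t).trans σ) t' ∈ Nb (s.symm u') a ∧
            ((Equiv.swap u t).trans σ) t' ∈ Nb u' b ∧
          ((Equiv.swap u t).trans σ) (s.symm t') ∈ Nb (s.symm t') w ∧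
          ((Equiv.swap u t).trans σ) (s t') ∈ Nb t' w) := by
        intro t' ht'
        rw [mem_erase, mem_filter] at ht'
        obtain ⟨hne, hT', q⟩ := ht'
        obtain ⟨a1, a2, a3, a4, a5⟩ := h2 t' hT'
        rw [mem_filter, mem_erase, hval t' (fun h => a1 (h ▸ hu)) hne,
          hval (s t') (fun h => a2 (h ▸ hu)) (fun h => a4 (h ▸ htT)),
          hval (s.symm t') (fun h => a3 (h ▸ hu)) (fun h => a5 (h ▸ htT))]
        exact ⟨⟨hne, hT'⟩, q⟩
      have h7 := card_le_card h6
      have h8 := pred_card_le_card_erase (s := T.filter fun t => σ t ∈ Nb (s.symm u') a ∧ σ t ∈ Nb u' b ∧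
          σ (s.symm t) ∈ Nb (s.symm t) w ∧ σ (s t) ∈ Nb t w) (a := t)
      omega

/-- Potential -/
noncomputable def pot {V ι : Type*} [DecidableEq V] [Fintype ι] (F : ι → Finset V) (lam : ℝ) (S : Finset V) : ℝ :=
  ∑ θ, Real.exp (-lam * ((#(F θ ∩ S) : ℝ) / (#S : ℝ)))

lemma exp_avg {W : Type*} [Fintype W] (y : W → ℝ) (r : ℝ) (hr : r ≤ 1)
    (hy : ∀ s, |y s| ≤ r) (h0 : ∑ s, y s = 0) :
    ∑ s, Real.exp (y s) ≤ Fintype.card W * Real.exp (r ^ 2) := by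
  have h : ∀ s, Real.exp (y s) ≤ 1 + y s + r ^ 2 := by
    intro s
    have h1 := Real.abs_exp_sub_one_sub_id_le ((hy s).trans hr)
    have h2 : y s ^ 2 ≤ r ^ 2 := by
      rw [← sq_abs (y s)]
      exact pow_le_pow_left₀ (abs_nonneg _) (hy s) 2
    have := (abs_le.1 h1).2
    linarith
  calc ∑ s, Real.exp (y s) ≤ ∑ s, (1 + y s + r ^ 2) := sum_le_sum fun s _ => h s
    _ = Fintype.card W * (r ^ 2 + 1) := by
      simp only [sum_add_distrib, h0, sum_const, card_univ, nsmul_eq_mul]; ring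
    _ ≤ _ := by
      gcongr
      exact Real.add_one_le_exp _

lemma block_step {V ι : Type*} [DecidableEq V] [Fintype ι] (Nb : ℕ → V → Finset V)
    (hsym : ∀ i u v, u ∈ Nb i v ↔ v ∈ Nb i u) (F : ι → Finset V)
    (S : Finset V) (L : ℕ) (lam ε : ℝ) (hlam : 0 ≤ lam) (hL : L < #S)
    (hmin : ∀ i v, #S + 2 * L ≤ 2 * #(Nb i v ∩ S))
    (hε : (L : ℝ) / ((#S : ℝ) - L) ≤ ε) (hle : lam * ε ≤ 1) (i0 : ℕ) :
    ∃ p : ℕ → V, Set.InjOn p (range L) ∧ (∀ j < L, p j ∈ S) ∧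
      (∀ j, j + 1 < L → p (j+1) ∈ Nb (i0 + j) (p j)) ∧
      pot F lam (S \ (range L).image p) ≤ Real.exp ((lam * ε) ^ 2) * pot F lam S := by
  classical
  have hcard : Fintype.card {x // x ∈ S} = #S := by simp
  obtain ⟨τ, h1, h2⟩ := trajectories (W := {x // x ∈ S})
    (fun i s => univ.filter fun x => x.1 ∈ Nb (i0 + i) s.1)
    (by intro i u v; simp [hsym _ u.1 v.1]) L
    (by
      intro i v
      rw [hcard]
      have : #(univ.filter fun x : {x // x ∈ S} => x.1 ∈ Nb (i0 + i) v.1) = #(Nb (i0+i) v.1 ∩ S) := by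
        rw [← card_map (Function.Embedding.subtype _)]
        congr 1
        ext x; simp
      rw [this]; exact hmin _ _) L le_rfl
  set Z : {x // x ∈ S} → Finset V := fun s => (range L).image fun j => (τ j s).1 with hZ
  have hinj : ∀ s, Set.InjOn (fun j => (τ j s).1) (range L) := by
    intro s i hi j hj h
    exact h2 s i (by simp at hi; omega) j (by simp at hj; omega) (Subtype.ext h)
  have hZS : ∀ s, Z s ⊆ S := by
    intro s x hx
    obtain ⟨j, _, rfl⟩ := mem_image.1 hx
    exact (τ j s).2
  have hZc : ∀ s, #(Z s) = L := by
    intro s; rw [hZ]; simp only; rw [card_image_of_injOn (hinj s)]; simp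
  have hM : (0:ℝ) < (#S : ℝ) := by exact_mod_cast (by omega : 0 < #S)
  have hML : (0:ℝ) < (#S : ℝ) - L := by
    have : (L:ℝ) < #S := by exact_mod_cast hL
    linarith
  have hsum : ∀ A : Finset V, ∑ s, #(A ∩ Z s) = L * #(A ∩ S) := by
    intro A
    have e1 : ∀ s, #(A ∩ Z s) = ∑ j ∈ range L, if (τ j s).1 ∈ A then 1 else 0 := by
      intro s
      rw [← card_filter, ← card_image_of_injOn (s := (range L).filter fun j => (τ j s).1 ∈ A)
        (f := fun j => (τ j s).1) ((hinj s).mono (by intro x hx; simp at hx ⊢; exact hx.1))]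
      congr 1
      ext x
      simp only [hZ, mem_inter, mem_image, mem_filter]
      constructor
      · rintro ⟨h, j, hj, rfl⟩; exact ⟨j, ⟨hj, h⟩, rfl⟩
      · rintro ⟨j, ⟨hj, h⟩, rfl⟩; exact ⟨h, j, hj, rfl⟩
    simp only [e1]
    rw [sum_comm]
    have e2 : ∀ j ∈ range L, (∑ s, if (τ j s).1 ∈ A then 1 else 0) = #(A ∩ S) := by
      intro j _
      rw [Equiv.sum_comp (τ j) (fun x => if x.1 ∈ A then 1 else 0), ← card_filter,
        ← card_map (Function.Embedding.subtype _)]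
      congr 1
      ext x; simp [and_comm]
    rw [sum_congr rfl e2]; simp
  have hθ : ∀ θ, ∑ s, Real.exp (-lam * ((#(F θ ∩ (S \ Z s)) : ℝ) / (#(S \ Z s) : ℝ))) ≤
      #S * Real.exp ((lam * ε) ^ 2) * Real.exp (-lam * ((#(F θ ∩ S) : ℝ) / (#S : ℝ))) := by
    intro θ
    set d : ℝ := (#(F θ ∩ S) : ℝ) with hd
    set z : {x // x ∈ S} → ℝ := fun s => (#(F θ ∩ Z s) : ℝ) with hz
    have c1 : ∀ s, (#(S \ Z s) : ℝ) = #S - L := by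
      intro s
      rw [card_sdiff_of_subset (hZS s), hZc, Nat.cast_sub hL.le]
    have c2 : ∀ s, (#(F θ ∩ (S \ Z s)) : ℝ) = d - z s := by
      intro s
      rw [← inter_sdiff_assoc, card_sdiff, eq_sub_iff_add_eq, hz, hd]
      have : Z s ∩ (F θ ∩ S) = F θ ∩ Z s := by
        ext x; simp only [mem_inter]
        constructor
        · rintro ⟨a, b, c⟩; exact ⟨b, a⟩
        · rintro ⟨a, b⟩; exact ⟨b, a, hZS s b⟩
      rw [this]
      have : #(F θ ∩ Z s) ≤ #(F θ ∩ S) := card_le_card (inter_subset_inter_left (hZS s))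
      simp only
      norm_cast
      omega
    have hzL : ∀ s, z s ≤ L := by
      intro s
      simp only [hz]
      have := card_le_card (inter_subset_right : F θ ∩ Z s ⊆ Z s)
      rw [hZc] at this
      exact_mod_cast this
    have hz0 : ∀ s, 0 ≤ z s := fun s => by positivity
    have hd0 : 0 ≤ d := by positivity
    have hdM : d ≤ #S := by
      simp only [hd]; exact_mod_cast card_le_card inter_subset_right
    have hzs : ∑ s, z s = L * d := by
      simp only [hz, hd]; exact_mod_cast hsum (F θ)
    set y : {x // x ∈ S} → ℝ := fun s => -lam * ((d * L - z s * #S) / (#S * (#S - L))) with hy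
    have hexp : ∀ s, Real.exp (-lam * ((#(F θ ∩ (S \ Z s)) : ℝ) / (#(S \ Z s) : ℝ))) =
        Real.exp (-lam * (d / #S)) * Real.exp (y s) := by
      intro s
      rw [← Real.exp_add, c1, c2, hy]
      congr 1
      field_simp
      ring
    simp only [hexp]
    rw [← mul_sum]
    have := exp_avg y (lam * ε) hle (by
      intro s
      simp only [hy]
      rw [abs_mul, abs_neg, abs_of_nonneg hlam]
      refine mul_le_mul_of_nonneg_left (le_trans ?_ hε) hlam
      rw [abs_div, abs_of_pos (mul_pos hM hML), div_le_div_iff₀ (mul_pos hM hML) hML]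
      have hL0 : (0:ℝ) ≤ L := by positivity
      have : |d * L - z s * #S| ≤ L * #S := by
        rw [abs_le]
        constructor
        · nlinarith [mul_nonneg hd0 hL0, mul_le_mul_of_nonneg_right (hzL s) hM.le]
        · nlinarith [mul_le_mul_of_nonneg_right hdM hL0, mul_nonneg (hz0 s) hM.le]
      nlinarith [mul_le_mul_of_nonneg_right this hML.le]) (by
      simp only [hy]
      rw [← mul_sum, ← sum_div, sum_sub_distrib, ← sum_mul, ← sum_mul, hzs]
      simp only [sum_const, card_univ, hcard, nsmul_eq_mul]
      have : (#S : ℝ) * d * L - L * d * #S = 0 := by ring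
      rw [this]; simp)
    rw [hcard] at this
    calc _ ≤ Real.exp (-lam * (d / #S)) * (#S * Real.exp ((lam * ε) ^ 2)) := by gcongr
      _ = _ := by ring
  have hne : (univ : Finset {x // x ∈ S}).Nonempty := by
    rw [← card_pos, card_univ, hcard]; omega
  obtain ⟨s, _, hs⟩ := exists_le_of_sum_le (s := (univ : Finset {x // x ∈ S}))
    (f := fun s => pot F lam (S \ Z s)) (g := fun _ => Real.exp ((lam * ε) ^ 2) * pot F lam S) hne (by
      simp only [pot]
      rw [sum_comm]
      calc _ ≤ ∑ θ, #S * Real.exp ((lam * ε) ^ 2) * Real.exp (-lam * ((#(F θ ∩ S) : ℝ) / (#S : ℝ))) :=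
            sum_le_sum fun θ _ => hθ θ
        _ = _ := by
          rw [← mul_sum]; simp [mul_assoc])
  refine ⟨fun j => (τ j s).1, hinj s, fun j _ => (τ j s).2, ?_, hs⟩
  intro j hj
  have := h1 j (by omega) s
  simpa using this

lemma blocks {V ι : Type*} [DecidableEq V] [Fintype ι] (Nb : ℕ → V → Finset V)
    (hsym : ∀ i u v, u ∈ Nb i v ↔ v ∈ Nb i u) (F : ι → Finset V)
    (hF : ∀ i v, ∃ θ, F θ = Nb i v)
    (V0 : Finset V) (L K : ℕ) (m lam g1 g2 : ℝ) (hlam : 0 ≤ lam) (hm : 0 < m)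
    (hKm : (K : ℝ) * L + m ≤ #V0)
    (hg1 : ∀ θ, g1 * #V0 ≤ #(F θ ∩ V0))
    (hg2 : (L : ℝ) ≤ (g2 - 1/2) * m)
    (hle : lam * (L / m) ≤ 1)
    (hpot : Fintype.card ι * Real.exp (-lam * g1) * Real.exp ((lam * (L / m)) ^ 2 * K)
      < Real.exp (-lam * g2)) (i0 : ℕ → ℕ) :
    ∀ t, t ≤ K → ∃ (p : ℕ → ℕ → V) (R : ℕ → Finset V), R 0 = V0 ∧
      (∀ k < t, Set.InjOn (p k) (range L) ∧ (∀ j < L, p k j ∈ R k) ∧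
        (∀ j, j + 1 < L → p k (j+1) ∈ Nb (i0 k + j) (p k j)) ∧
        R (k+1) = R k \ (range L).image (p k)) ∧
      (#(R t) : ℝ) = #V0 - t * L ∧
      pot F lam (R t) ≤ Real.exp ((lam * (L / m)) ^ 2 * t) * pot F lam V0 := by
  intro t
  induction t with
  | zero =>
    intro _
    have : V0.Nonempty := by
      rw [← card_pos]
      have : (0:ℝ) < #V0 := lt_of_lt_of_le (by positivity) hKm
      exact_mod_cast this
    obtain ⟨v, _⟩ := this
    exact ⟨fun _ _ => v, fun _ => V0, rfl, by simp, by simp, by simp⟩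
  | succ t ih =>
    intro ht
    obtain ⟨p, R, hR0, hR, hcard, hp⟩ := ih (by omega)
    have hL0 : (0:ℝ) ≤ L := by positivity
    have hV0 : (0:ℝ) < #V0 := lt_of_lt_of_le (by positivity) hKm
    have htK : ((t:ℝ) + 1) * L ≤ K * L := by
      gcongr; exact_mod_cast ht
    have hsize : m + L ≤ #(R t) := by rw [hcard]; linarith
    have hRpos : (0:ℝ) < #(R t) := by linarith
    have hpV : pot F lam V0 ≤ Fintype.card ι * Real.exp (-lam * g1) := by
      unfold pot
      rw [← card_univ, ← nsmul_eq_mul]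
      refine sum_le_card_nsmul _ _ _ fun θ _ => ?_
      apply Real.exp_le_exp.2
      rw [neg_mul, neg_mul, neg_le_neg_iff]
      refine mul_le_mul_of_nonneg_left ?_ hlam
      rw [le_div_iff₀ hV0]; exact hg1 θ
    have hpt : pot F lam (R t) < Real.exp (-lam * g2) := by
      refine lt_of_le_of_lt (hp.trans ?_) hpot
      rw [mul_comm]
      have : (t:ℝ) ≤ K := by exact_mod_cast (by omega : t ≤ K)
      gcongr
    have hdeg : ∀ θ, g2 * #(R t) ≤ #(F θ ∩ R t) := by
      intro θ
      by_contra hcon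
      push Not at hcon
      have h1 : Real.exp (-lam * ((#(F θ ∩ R t) : ℝ) / (#(R t) : ℝ))) ≤ pot F lam (R t) :=
        single_le_sum (f := fun θ => Real.exp (-lam * ((#(F θ ∩ R t) : ℝ) / (#(R t) : ℝ))))
          (fun _ _ => (Real.exp_pos _).le) (mem_univ θ)
      have h2 : Real.exp (-lam * g2) ≤ Real.exp (-lam * ((#(F θ ∩ R t) : ℝ) / (#(R t) : ℝ))) := by
        apply Real.exp_le_exp.2
        rw [neg_mul, neg_mul, neg_le_neg_iff]
        refine mul_le_mul_of_nonneg_left ?_ hlam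
        rw [div_le_iff₀ hRpos]; exact hcon.le
      linarith
    obtain ⟨q, q1, q2, q3, q4⟩ := block_step Nb hsym F (R t) L lam (L / m) hlam
      (by have : (L:ℝ) < #(R t) := by linarith
          exact_mod_cast this)
      (by
        intro i v
        obtain ⟨θ, hθ⟩ := hF i v
        have h1 := hdeg θ
        rw [hθ] at h1
        have h3 : 0 ≤ g2 - 1/2 := by
          by_contra h; push Not at h
          nlinarith
        have h2 : (#(R t) : ℝ) + 2 * L ≤ 2 * #(Nb i v ∩ R t) := by
          nlinarith
        exact_mod_cast h2)
      (by gcongr; linarith) hle (i0 t)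
    refine ⟨fun k => if k = t then q else p k, fun k => if k ≤ t then R k else R t \ (range L).image q,
      by simpa using hR0, ?_, ?_, ?_⟩
    · intro k hk
      by_cases hkt : k = t
      · subst hkt
        simp only [if_true, le_refl, show ¬ (k + 1 ≤ k) by omega, if_false]
        exact ⟨q1, q2, q3, trivial⟩
      · simp only [hkt, if_false, show k ≤ t by omega, show k + 1 ≤ t by omega, if_true]
        exact hR k (by omega)
    · simp only [show ¬ (t + 1 ≤ t) by omega, if_false]
      have hsub : (range L).image q ⊆ R t := by
        intro x hx
        obtain ⟨j, hj, rfl⟩ := mem_image.1 hx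
        exact q2 j (by simpa using hj)
      rw [cast_card_sdiff hsub, card_image_of_injOn q1, hcard, card_range]
      push_cast; ring
    · simp only [show ¬ (t + 1 ≤ t) by omega, if_false]
      refine q4.trans ?_
      push_cast
      rw [mul_add, mul_one, Real.exp_add]
      calc _ ≤ Real.exp ((lam * (L / m)) ^ 2) * (Real.exp ((lam * (L / m)) ^ 2 * t) * pot F lam V0) := by
            gcongr
        _ = _ := by ring

/-- one absorber is chosen -/
lemma absorber_step {V ι : Type*} [Fintype V] [DecidableEq V] [Fintype ι] [Nonempty V]
    (N1 N2 N3 N4 : V → Finset V)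
    (Used : Finset V) (b0 : V) (r : ℝ) (hr0 : 0 < r) (wt : ι → ℝ) (hwt : ∀ i, 0 ≤ wt i)
    (w : ι → V) (C : ι → Finset V)
    (hN1 : ∀ u v, r + #Used + 3 ≤ #(N1 u ∩ N2 v))
    (hN2 : ∀ u v, r + #Used + 3 ≤ #(N3 u ∩ N3 v))
    (hN3 : ∀ u v, r + #Used + 3 ≤ #(N4 u ∩ N4 v))
    (hC : ∀ i, r + #Used + 3 ≤ #(C i)) [Nonempty ι] :
    ∃ g a x b : V, (g ∉ Used ∧ a ∉ Used ∧ x ∉ Used ∧ b ∉ Used) ∧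
      (g ≠ a ∧ g ≠ x ∧ g ≠ b ∧ a ≠ x ∧ a ≠ b ∧ x ≠ b) ∧
      (g ∈ N1 b0 ∧ g ∈ N2 a ∧ a ∈ N3 x ∧ b ∈ N4 x) ∧
      ∑ i, wt i * (if x ∈ C i ∧ a ∈ N3 (w i) ∧ b ∈ N4 (w i) then Real.exp (-1) else 1) ≤
        Real.exp (-(r / Fintype.card V) ^ 4 / 2) * ∑ i, wt i := by
  classical
  set Adm : Finset (V × V × V × V) := univ.filter fun q =>
    (q.1 ∉ Used ∧ q.2.1 ∉ Used ∧ q.2.2.1 ∉ Used ∧ q.2.2.2 ∉ Used) ∧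
      (q.1 ≠ q.2.1 ∧ q.1 ≠ q.2.2.1 ∧ q.1 ≠ q.2.2.2 ∧ q.2.1 ≠ q.2.2.1 ∧ q.2.1 ≠ q.2.2.2 ∧ q.2.2.1 ≠ q.2.2.2) ∧
      (q.1 ∈ N1 b0 ∧ q.1 ∈ N2 q.2.1 ∧ q.2.1 ∈ N3 q.2.2.1 ∧ q.2.2.2 ∈ N4 q.2.2.1) with hAdm
  set good : ι → V × V × V × V → Prop := fun i q => 
    q.2.2.1 ∈ C i ∧ q.2.1 ∈ N3 (w i) ∧ q.2.2.2 ∈ N4 (w i) with hgood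
  have hn : (0:ℝ) < Fintype.card V := by exact_mod_cast Fintype.card_pos
  have cnt : ∀ (X E : Finset V), #E ≤ #Used + 3 → r + #Used + 3 ≤ #X → r ≤ #(X \ E) := by
    intro X E hE hX
    have h1 := le_card_sdiff E X
    have h2 : (#X : ℝ) ≤ #(X \ E) + #E := by exact_mod_cast (by omega : #X ≤ #(X \ E) + #E)
    have h3 : (#E : ℝ) ≤ #Used + 3 := by exact_mod_cast hE
    linarith
  have hgc : ∀ i, r ^ 4 ≤ #(Adm.filter (good i)) := by
    intro i
    set S1 : Finset V := C i \ Used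
    set S2 : V → Finset V := fun x => (N3 x ∩ N3 (w i)) \ (insert x Used)
    set S3 : V → V → Finset V := fun x a => (N4 x ∩ N4 (w i)) \ (insert a (insert x Used))
    set S4 : V → V → V → Finset V := fun x a b => (N1 b0 ∩ N2 a) \ (insert b (insert a (insert x Used)))
    have e1 : r ≤ #S1 := cnt _ _ (by omega) (hC i)
    have e2 : ∀ x, r ≤ #(S2 x) := fun x => cnt _ _ ((card_insert_le _ _).trans (by omega)) (hN2 _ _)
    have e3 : ∀ x a, r ≤ #(S3 x a) := fun x a => cnt _ _ ((card_insert_le _ _).trans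
      (by have := card_insert_le x Used; omega)) (hN3 _ _)
    have e4 : ∀ x a b, r ≤ #(S4 x a b) := fun x a b => cnt _ _ ((card_insert_le _ _).trans
      (by have := card_insert_le x Used; have := card_insert_le a (insert x Used); omega)) (hN1 _ _)
    set Y := (((S1.sigma S2).sigma fun y => S3 y.1 y.2).sigma fun y => S4 y.1.1 y.1.2 y.2)
    have hY : r ^ 4 ≤ #Y := by
      rw [card_sigma, sum_sigma, sum_sigma]
      push_cast
      calc r ^ 4 = r * r * r * r := by ring
        _ ≤ #S1 * r * r * r := by gcongr
        _ = ∑ x ∈ S1, r * r * r := by simp; ring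
        _ ≤ ∑ x ∈ S1, ∑ a ∈ S2 x, ∑ b ∈ S3 x a, (#(S4 x a b) : ℝ) := by
          gcongr with x hx
          calc r * r * r ≤ #(S2 x) * r * r := by gcongr; exact e2 x
            _ = ∑ a ∈ S2 x, r * r := by simp; ring
            _ ≤ _ := by
              gcongr with a ha
              calc r * r ≤ #(S3 x a) * r := by gcongr; exact e3 x a
                _ = ∑ b ∈ S3 x a, r := by simp
                _ ≤ _ := by
                  gcongr with b hb
                  exact e4 x a b
    refine hY.trans ?_
    norm_cast
    refine card_le_card_of_injOn (fun y => (y.2, y.1.1.2, y.1.1.1, y.1.2)) ?_ ?_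
    · rintro ⟨⟨⟨x, a⟩, b⟩, g⟩ hy
      simp only [Y, S1, S2, S3, S4, coe_sigma, Set.mem_sigma_iff, mem_coe, mem_sdiff, mem_inter, mem_insert, not_or] at hy
      simp only [mem_coe, mem_filter, hAdm, hgood, mem_univ, true_and]
      obtain ⟨⟨⟨⟨h1, h2⟩, ⟨h3, h3'⟩, h4, h5⟩, ⟨h6, h6'⟩, h7, h8, h9⟩, ⟨h10, h11⟩, h12, h13, h14, h15⟩ := hy
      exact ⟨⟨⟨h15, h5, h2, h9⟩, ⟨h13, h14, h12, h4, fun h => h7 h.symm, fun h => h8 h.symm⟩,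
        h10, h11, h3, h6⟩, h1, h3', h6'⟩
    · rintro ⟨⟨⟨x, a⟩, b⟩, g⟩ _ ⟨⟨⟨x', a'⟩, b'⟩, g'⟩ _ h
      simp only [Prod.mk.injEq] at h
      obtain ⟨rfl, rfl, rfl, rfl⟩ := h
      rfl
  have hAc : (#Adm : ℝ) ≤ (Fintype.card V : ℝ) ^ 4 := by
    have := card_le_univ Adm
    simp only [Fintype.card_prod] at this
    calc (#Adm : ℝ) ≤ ((Fintype.card V * (Fintype.card V * (Fintype.card V * Fintype.card V)) : ℕ) : ℝ) := by
          exact_mod_cast this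
      _ = _ := by push_cast; ring
  obtain ⟨i0⟩ := ‹Nonempty ι›
  have hne : Adm.Nonempty := by
    rw [← card_pos]
    have h1 := hgc i0
    have h2 : (#(Adm.filter (good i0)) : ℝ) ≤ #Adm := by exact_mod_cast card_filter_le _ _
    have : (0:ℝ) < #Adm := by
      have : 0 < r ^ 4 := by positivity
      linarith
    exact_mod_cast this
  set c := (r / Fintype.card V) ^ 4 with hc
  have hc0 : 0 ≤ c := by positivity
  have hexp1 : Real.exp (-1) ≤ 1/2 := by
    have := Real.exp_neg_one_lt_half
    linarith
  have hi : ∀ i, ∑ q ∈ Adm, (if good i q then Real.exp (-1) else 1) ≤ #Adm * Real.exp (-c/2) := by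
    intro i
    have h1 : ∀ q ∈ Adm, (if good i q then Real.exp (-1) else (1:ℝ)) ≤ 1 - (1/2) * (if good i q then 1 else 0) := by
      intro q _
      split_ifs <;> linarith
    have h2 : c * #Adm ≤ #(Adm.filter (good i)) := by
      refine le_trans ?_ (hgc i)
      rw [hc, div_pow, div_mul_eq_mul_div, div_le_iff₀ (by positivity)]
      gcongr
    calc _ ≤ ∑ q ∈ Adm, (1 - (1/2) * (if good i q then (1:ℝ) else 0)) := sum_le_sum h1
      _ = #Adm - (1/2) * #(Adm.filter (good i)) := by
        rw [sum_sub_distrib, ← mul_sum, sum_boole]; simp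
      _ ≤ #Adm * (-c/2 + 1) := by linarith
      _ ≤ _ := by gcongr; exact Real.add_one_le_exp _
  obtain ⟨q, hq, hle⟩ := exists_le_of_sum_le (s := Adm)
    (f := fun q => ∑ i, wt i * (if good i q then Real.exp (-1) else 1))
    (g := fun _ => Real.exp (-c/2) * ∑ i, wt i) hne (by
      rw [sum_comm]
      calc _ ≤ ∑ i, wt i * (#Adm * Real.exp (-c/2)) := by
            refine sum_le_sum fun i _ => ?_
            rw [← mul_sum]
            exact mul_le_mul_of_nonneg_left (hi i) (hwt i)
        _ = _ := by
          rw [← sum_mul]; simp; ring)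
  rw [hAdm, mem_filter] at hq
  obtain ⟨_, h1, h2, h3⟩ := hq
  exact ⟨q.1, q.2.1, q.2.2.1, q.2.2.2, h1, h2, h3, hle⟩

lemma absorbers {V ι : Type*} [Fintype V] [DecidableEq V] [Fintype ι] [Nonempty V] [Nonempty ι]
    (Nb : ℕ → V → Finset V) (hsym : ∀ i u v, u ∈ Nb i v ↔ v ∈ Nb i u)
    (N : ℕ) (r : ℝ) (hr0 : 0 < r)
    (w : ι → V) (C : ι → Finset V)
    (hN : ∀ i j u v, r + 4 * N + 3 ≤ #(Nb i u ∩ Nb j v))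
    (hC : ∀ i, r + 4 * N + 3 ≤ #(C i)) :
    ∀ t, t ≤ N → ∃ h : ℕ → V, Set.InjOn h (range (4 * t)) ∧
      (∀ p, p + 1 < 4 * t → h (p+1) ∈ Nb p (h p)) ∧
      ∑ i, Real.exp (-(#((range t).filter fun k => h (4*k+2) ∈ C i ∧ h (4*k+1) ∈ Nb (4*k+1) (w i) ∧
        h (4*k+3) ∈ Nb (4*k+2) (w i)) : ℝ)) ≤
        Real.exp (-(r / Fintype.card V) ^ 4 / 2 * t) * Fintype.card ι := by
  intro t
  induction t with
  | zero =>
    intro _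
    obtain ⟨v⟩ := ‹Nonempty V›
    exact ⟨fun _ => v, by simp, by simp, by simp⟩
  | succ t ih =>
    intro ht
    obtain ⟨h, h1, h2, h3⟩ := ih (by omega)
    have hU : #((range (4*t)).image h) = 4 * t := by rw [card_image_of_injOn h1]; simp
    have hU' : (#((range (4*t)).image h) : ℝ) ≤ 4 * N := by
      rw [hU]; exact_mod_cast (by omega : 4 * t ≤ 4 * N)
    obtain ⟨g, a, x, b, ⟨u1, u2, u3, u4⟩, ⟨d1, d2, d3, d4, d5, d6⟩, ⟨e1, e2, e3, e4⟩, hsum⟩ :=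
      absorber_step (ι := ι) (Nb (4*t-1)) (Nb (4*t)) (Nb (4*t+1)) (Nb (4*t+2)) ((range (4*t)).image h)
        (h (4*t-1)) r hr0
        (fun i => Real.exp (-(#((range t).filter fun k => h (4*k+2) ∈ C i ∧ h (4*k+1) ∈ Nb (4*k+1) (w i) ∧
        h (4*k+3) ∈ Nb (4*k+2) (w i)) : ℝ))) (fun i => (Real.exp_pos _).le) w C
        (fun u v => by linarith [hN (4*t-1) (4*t) u v])
        (fun u v => by linarith [hN (4*t+1) (4*t+1) u v])
        (fun u v => by linarith [hN (4*t+2) (4*t+2) u v])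
        (fun i => by linarith [hC i])
    set h' : ℕ → V := fun p => if p < 4*t then h p else if p = 4*t then g else if p = 4*t+1 then a else
      if p = 4*t+2 then x else b with hh'
    have v0 : ∀ p < 4*t, h' p = h p := by intro p hp; simp [hh', hp]
    have v1 : h' (4*t) = g := by simp [hh']
    have v2 : h' (4*t+1) = a := by simp [hh']
    have v3 : h' (4*t+2) = x := by simp [hh']
    have v4 : h' (4*t+3) = b := by simp [hh']
    have hnot : ∀ y, y ∉ (range (4*t)).image h → ∀ p < 4*t, h p ≠ y := by
      intro y hy p hp hpy
      exact hy (mem_image.2 ⟨p, by simpa using hp, hpy⟩)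
    have hcases : ∀ p < 4*(t+1), p < 4*t ∨ p = 4*t ∨ p = 4*t+1 ∨ p = 4*t+2 ∨ p = 4*t+3 := by
      intro p hp; omega
    refine ⟨h', ?_, ?_, ?_⟩
    · intro p hp q hq hpq
      simp only [coe_range, Set.mem_Iio] at hp hq
      rcases hcases p hp with hp | rfl | rfl | rfl | rfl <;> rcases hcases q hq with hq | rfl | rfl | rfl | rfl
      · rw [v0 p hp, v0 q hq] at hpq
        exact h1 (by simpa using hp) (by simpa using hq) hpq
      all_goals simp only [v1, v2, v3, v4] at hpq
      all_goals first
        | rfl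
        | (rw [v0 p hp] at hpq; exact absurd hpq (hnot _ (by assumption) p hp))
        | (rw [v0 q hq] at hpq; exact absurd hpq.symm (hnot _ (by assumption) q hq))
        | exact absurd hpq (by assumption)
        | exact absurd hpq.symm (by assumption)
    · intro p hp
      rcases hcases (p+1) hp with hp | hp | hp | hp | hp
      · rw [v0 _ hp, v0 p (by omega)]; exact h2 p hp
      · rw [hp, v1, v0 p (by omega)]
        obtain rfl : p = 4*t-1 := by omega
        exact e1
      · obtain rfl : p = 4*t := by omega
        rw [v1, v2, hsym]; exact e2
      · obtain rfl : p = 4*t+1 := by omega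
        rw [v2, v3, hsym]; exact e3
      · obtain rfl : p = 4*t+2 := by omega
        rw [v3, v4]; exact e4
    · have hterm : ∀ i, Real.exp (-(#((range (t+1)).filter fun k => h' (4*k+2) ∈ C i ∧
          h' (4*k+1) ∈ Nb (4*k+1) (w i) ∧ h' (4*k+3) ∈ Nb (4*k+2) (w i)) : ℝ)) =
          Real.exp (-(#((range t).filter fun k => h (4*k+2) ∈ C i ∧ h (4*k+1) ∈ Nb (4*k+1) (w i) ∧
        h (4*k+3) ∈ Nb (4*k+2) (w i)) : ℝ)) * 
          (if x ∈ C i ∧ a ∈ Nb (4*t+1) (w i) ∧ b ∈ Nb (4*t+2) (w i) then Real.exp (-1) else 1) := by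
        intro i
        have hf : ((range t).filter fun k => h' (4*k+2) ∈ C i ∧
          h' (4*k+1) ∈ Nb (4*k+1) (w i) ∧ h' (4*k+3) ∈ Nb (4*k+2) (w i)) = 
          ((range t).filter fun k => h (4*k+2) ∈ C i ∧ h (4*k+1) ∈ Nb (4*k+1) (w i) ∧
        h (4*k+3) ∈ Nb (4*k+2) (w i)) := by
          apply filter_congr
          intro k hk
          rw [mem_range] at hk
          rw [v0 _ (by omega), v0 _ (by omega), v0 _ (by omega)]
        rw [range_add_one, filter_insert, v2, v3, v4, hf]
        split_ifs
        · rw [card_insert_of_notMem (by simp), ← Real.exp_add]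
          push_cast
          congr 1; ring
        · simp
      simp only [hterm]
      refine hsum.trans ?_
      push_cast
      rw [mul_add, mul_one, Real.exp_add]
      calc _ ≤ Real.exp (-(r / Fintype.card V) ^ 4 / 2) *
            (Real.exp (-(r / Fintype.card V) ^ 4 / 2 * t) * Fintype.card ι) := by gcongr
        _ = _ := by ring

lemma assemble (n : ℕ) [NeZero n] (hn2 : 2 ≤ n) (Nb : ℕ → Fin n → Finset (Fin n))
    (hsym : ∀ i u v, u ∈ Nb i v ↔ v ∈ Nb i u) (N K L : ℕ)
    (hsize : 4 * N + K * (L + 1) + 1 ≤ n)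
    (h : ℕ → Fin n) (h1 : Set.InjOn h (range (4 * N)))
    (h2 : ∀ p, p + 1 < 4 * N → h (p+1) ∈ Nb p (h p))
    (h3 : ∀ (u' u w a b : Fin n), n - 4 * N - K * L ≤ #((range N).filter fun k =>
      h (4*k+2) ∈ Nb u'.val a ∩ Nb u.val b ∧ h (4*k+1) ∈ Nb (4*k+1) w ∧ h (4*k+3) ∈ Nb (4*k+2) w))
    (p : ℕ → ℕ → Fin n) (R : ℕ → Finset (Fin n)) (hR0 : R 0 = univ \ (range (4*N)).image h)
    (hR : ∀ k < K, Set.InjOn (p k) (range L) ∧ (∀ j < L, p k j ∈ R k) ∧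
        (∀ j, j + 1 < L → p k (j+1) ∈ Nb (4 * N + k * (L+1) + 1 + j) (p k j)) ∧
        R (k+1) = R k \ (range L).image (p k)) :
    ∃ σ : Equiv.Perm (Fin n), ∀ i : Fin n,
      σ ⟨(i.val + 1) % n, Nat.mod_lt _ i.pos⟩ ∈ Nb i.val (σ i) := by
  classical
  have hmono : ∀ k' ≤ K, ∀ k ≤ k', R k' ⊆ R k := by
    intro k'
    induction k' with
    | zero => intro _ k hk; obtain rfl : k = 0 := by omega
              exact Subset.rfl
    | succ k' ih =>
      intro hk' k hk
      rcases Nat.lt_or_ge k (k'+1) with hlt | hge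
      · rw [(hR k' (by omega)).2.2.2]
        exact sdiff_subset.trans (ih (by omega) k (by omega))
      · obtain rfl : k = k' + 1 := by omega
        exact Subset.rfl
  set f : ℕ → Fin n := fun q => if q < 4 * N then h q else p ((q - 4*N) / (L+1)) ((q-4*N) % (L+1) - 1) with hf
  set inQ : ℕ → Prop := fun q => q < 4 * N ∨ (4 * N ≤ q ∧ q - 4 * N < K * (L+1) ∧ (q - 4*N) % (L+1) ≠ 0) with hinQ
  have fh : ∀ q, q < 4 * N → f q = h q := by intro q hq; simp [hf, hq]
  have fp : ∀ k j, j < L → f (4 * N + k * (L+1) + 1 + j) = p k j := by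
    intro k j hj
    have e0 : 4 * N + k * (L+1) + 1 + j - 4 * N = (1 + j) + (L+1) * k := by
      rw [mul_comm k]; omega
    have e1 : (4 * N + k * (L+1) + 1 + j - 4 * N) / (L+1) = k := by
      rw [e0, Nat.add_mul_div_left _ _ (by omega), Nat.div_eq_of_lt (by omega)]; omega
    have e2 : (4 * N + k * (L+1) + 1 + j - 4 * N) % (L+1) = 1 + j := by
      rw [e0, Nat.add_mul_mod_self_left, Nat.mod_eq_of_lt (by omega)]
    simp only [hf, e1, e2, show ¬ (4 * N + k * (L+1) + 1 + j < 4 * N) by omega, if_false]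
    congr 1; omega
  have hrep : ∀ q, inQ q → q < 4 * N ∨ ∃ k j, k < K ∧ j < L ∧ q = 4 * N + k * (L+1) + 1 + j := by
    rintro q (hq | ⟨hq, hq1, hq2⟩)
    · exact Or.inl hq
    · right
      have e := Nat.div_add_mod (q - 4*N) (L+1)
      have e' := Nat.mod_lt (q - 4*N) (show L + 1 > 0 by omega)
      refine ⟨(q-4*N)/(L+1), (q-4*N)%(L+1) - 1, ?_, by omega, ?_⟩
      · exact Nat.div_lt_of_lt_mul (by rwa [mul_comm (L+1)])
      · rw [mul_comm] at e; omega
  have hinj : Set.InjOn (fun q : Fin n => f q.val) (univ.filter fun q : Fin n => inQ q.val) := by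
    have hpp : ∀ k j k' j', k < k' → k' < K → j < L → j' < L → p k j ≠ p k' j' := by
      intro k j k' j' hk hk' hj hj' he
      have a1 := (hR k' hk').2.1 j' hj'
      have a2 := hmono k' hk'.le (k+1) hk a1
      rw [(hR k (by omega)).2.2.2, mem_sdiff, ← he] at a2
      exact a2.2 (mem_image.2 ⟨j, by simpa using hj, rfl⟩)
    have hph : ∀ q k j, q < 4 * N → k < K → j < L → h q ≠ p k j := by
      intro q k j hq hk hj he
      have a1 := hmono k hk.le 0 (by omega) ((hR k hk).2.1 j hj)
      rw [hR0, mem_sdiff, ← he] at a1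
      exact a1.2 (mem_image.2 ⟨q, by simpa using hq, rfl⟩)
    intro x hx y hy hxy
    simp only [coe_filter, mem_univ, true_and, Set.mem_ofPred_eq] at hx hy
    apply Fin.ext
    simp only at hxy
    rcases hrep _ hx with hx | ⟨k, j, hk, hj, hx⟩ <;> rcases hrep _ hy with hy | ⟨k', j', hk', hj', hy⟩
    · rw [fh _ hx, fh _ hy] at hxy
      exact h1 (by simpa using hx) (by simpa using hy) hxy
    · rw [fh _ hx, hy, fp _ _ hj'] at hxy
      exact absurd hxy (hph _ _ _ hx hk' hj')
    · rw [fh _ hy, hx, fp _ _ hj] at hxy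
      exact absurd hxy.symm (hph _ _ _ hy hk hj)
    · rw [hx, hy, fp _ _ hj, fp _ _ hj'] at hxy
      rcases lt_trichotomy k k' with hlt | rfl | hlt
      · exact absurd hxy (hpp _ _ _ _ hlt hk' hj hj')
      · have := (hR k hk).1 (by simpa using hj) (by simpa using hj') hxy
        omega
      · exact absurd hxy.symm (hpp _ _ _ _ hlt hk hj' hj)
  obtain ⟨g, hg⟩ := exists_equiv_extend_of_card_eq (α := Fin n) (t := (univ : Finset (Fin n))) (by simp)
    (s := univ.filter fun q : Fin n => inQ q.val) (f := fun q : Fin n => f q.val) (subset_univ _) hinj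
  set σ0 : Fin n ≃ Fin n := g.trans (Equiv.subtypeUnivEquiv mem_univ) with hσ0
  have hσ : ∀ q : Fin n, inQ q.val → σ0 q = f q.val := by
    intro q hq
    exact hg q (by simpa using hq)
  set s : Equiv.Perm (Fin n) := Equiv.addRight 1 with hs
  have hone : (1 : Fin n).val = 1 := by
    rw [Fin.val_one']; exact Nat.mod_eq_of_lt hn2
  have hsv : ∀ q : Fin n, (s q).val = (q.val + 1) % n := by
    intro q; simp [hs, Fin.val_add]
  have hsv' : ∀ q : Fin n, q.val + 1 < n → (s q).val = q.val + 1 := by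
    intro q hq; rw [hsv, Nat.mod_eq_of_lt hq]
  have hsm : ∀ q : Fin n, 0 < q.val → (s.symm q).val = q.val - 1 := by
    intro q hq
    have : s ⟨q.val - 1, by omega⟩ = q := by
      apply Fin.ext
      rw [hsv' _ (by simp; omega)]; simp; omega
    have : s.symm q = ⟨q.val - 1, by omega⟩ := by rw [Equiv.symm_apply_eq]; exact this.symm
    rw [this]
  have hUc : #(univ.filter fun q : Fin n => ¬ inQ q.val) ≤ n - 4 * N - K * L := by
    have : ((univ.filter fun q : Fin n => ¬ inQ q.val).map Fin.valEmbedding) ⊆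
        ((range K).image fun k => 4 * N + k * (L+1)) ∪ Ico (4 * N + K * (L+1)) n := by
      intro q hq
      simp only [mem_map, mem_filter, mem_univ, true_and, Fin.valEmbedding_apply] at hq
      obtain ⟨q, hq, rfl⟩ := hq
      simp only [hinQ, not_or, not_and, not_not] at hq
      obtain ⟨q1, q2⟩ := hq
      by_cases hlt : q.val - 4 * N < K * (L+1)
      · have q3 := q2 (by omega) hlt
        apply mem_union_left
        refine mem_image.2 ⟨(q.val-4*N)/(L+1), ?_, ?_⟩
        · rw [mem_range]; exact Nat.div_lt_of_lt_mul (by rwa [mul_comm (L+1)])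
        · rw [Nat.div_mul_cancel (Nat.dvd_of_mod_eq_zero q3)]; omega
      · apply mem_union_right
        rw [mem_Ico]
        exact ⟨by omega, q.2⟩
    have h5 := card_le_card this
    have h6 := card_union_le ((range K).image fun k => 4 * N + k * (L+1)) (Ico (4 * N + K * (L+1)) n)
    have h7 : #((range K).image fun k => 4 * N + k * (L+1)) ≤ K := by
      simpa using card_image_le (s := range K) (f := fun k => 4 * N + k * (L+1))
    rw [card_map] at h5
    rw [Nat.card_Ico] at h6
    have : K * (L+1) = K * L + K := by ring
    omega
  obtain ⟨σ, hfin⟩ := absorb s (by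
      intro q hq
      have := congrArg Fin.val hq
      rw [hsv] at this
      rcases Nat.lt_or_ge (q.val + 1) n with hlt | hge
      · rw [Nat.mod_eq_of_lt hlt] at this; omega
      · have : q.val + 1 = n := by omega
        simp_all)
    (fun q : Fin n => Nb q.val) (fun i => hsym i.val) _
    (univ.filter fun q : Fin n => ¬ inQ q.val)
    (univ.filter fun q : Fin n => q.val < 4 * N ∧ q.val % 4 = 2) σ0 rfl
    (by
      intro q hq hsq
      simp only [mem_filter, mem_univ, true_and, not_not] at hq hsq
      have hq1 : q.val + 1 < n := by
        rcases hq with hq | ⟨_, hq, _⟩ <;> omega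
      rw [hσ _ hq, hσ _ hsq, hsv' _ hq1]
      rw [hsv' _ hq1] at hsq
      rcases hrep _ hq with hx | ⟨k, j, hk, hj, hx⟩
      · rcases hsq with hsq | ⟨hsq1, hsq2, hsq3⟩
        · rw [fh _ hx, fh _ hsq]; exact h2 _ hsq
        · exact absurd (by rw [show q.val + 1 - 4 * N = 0 by omega]; simp) hsq3
      · have hj1 : j + 1 < L := by
          by_contra hcon
          obtain rfl : L = j + 1 := by omega
          rcases hsq with hsq | ⟨hsq1, hsq2, hsq3⟩
          · omega
          · apply hsq3
            rw [show q.val + 1 - 4 * N = (j+1+1) * (k + 1) by 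
              rw [hx, mul_comm k, mul_add]; omega]
            simp
        rw [hx, fp _ _ hj, show 4 * N + k * (L+1) + 1 + j + 1 = 4 * N + k * (L+1) + 1 + (j + 1) by ring,
          fp _ _ hj1]
        exact (hR k hk).2.2.1 j hj1)
    (by
      intro t ht
      simp only [mem_filter, mem_univ, true_and] at ht
      simp only [mem_filter, mem_univ, true_and, not_not]
      rw [hsv' _ (by omega), hsm _ (by omega)]
      exact ⟨Or.inl ht.1, Or.inl (by omega), Or.inl (by omega), by omega, by omega⟩)
    (by
      intro u w a b
      refine hUc.trans ((h3 (s.symm u) u w a b).trans ?_)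
      have hval : ∀ k < N, (Fin.ofNat n (4*k+2)).val = 4*k+2 := by
        intro k hk
        simp only [Fin.val_ofNat]
        exact Nat.mod_eq_of_lt (by omega)
      refine card_le_card_of_injOn (fun k => Fin.ofNat n (4*k+2)) ?_ ?_
      · intro k hk
        simp only [coe_filter, mem_range, Set.mem_ofPred_eq, mem_inter] at hk
        obtain ⟨hk, ⟨c1, c2⟩, c3, c4⟩ := hk
        have e := hval k hk
        simp only [coe_filter, mem_filter, mem_univ, true_and, Set.mem_ofPred_eq]
        have es : (s (Fin.ofNat n (4*k+2))).val = 4*k+3 := by rw [hsv' _ (by omega), e]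
        have em : (s.symm (Fin.ofNat n (4*k+2))).val = 4*k+1 := by rw [hsm _ (by omega), e]; omega
        rw [hσ _ (Or.inl (by omega)), hσ (s _) (Or.inl (by omega)), hσ (s.symm _) (Or.inl (by omega)), e, es, em,
          fh _ (by omega), fh _ (by omega), fh _ (by omega)]
        exact ⟨⟨by omega, by omega⟩, c1, c2, c3, c4⟩
      · intro k hk k' hk' hkk
        simp only [coe_filter, mem_range, Set.mem_ofPred_eq] at hk hk'
        have := congrArg Fin.val hkk
        simp only at this
        rw [hval k hk.1, hval k' hk'.1] at this
        omega)
  refine ⟨σ, fun i => ?_⟩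
  have : (⟨(i.val + 1) % n, Nat.mod_lt _ i.pos⟩ : Fin n) = s i := Fin.ext (hsv i).symm
  rw [this]
  exact hfin i

lemma large_n (α : ℝ) (hα : 0 < α) (β κ : ℝ) (hβ : 0 < β) (hκ : 0 < κ) (L : ℕ) :
    ∃ n₀ : ℕ, ∀ n : ℕ, n₀ ≤ n → 2 ≤ n ∧ 32 ≤ α * n ∧ 5 * Real.log n ≤ β * n ∧ (L : ℝ) + 1 ≤ β * n ∧
      (L : ℝ) ≤ α / 2 * (κ * n) ∧ L ≤ κ * √n ∧
      2 * Real.log n + L ^ 2 / κ ^ 2 < √n * (α / 4) := by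
  have ht : Filter.Tendsto (fun n : ℕ => √(n : ℝ)) Filter.atTop Filter.atTop :=
    Real.tendsto_sqrt_atTop.comp tendsto_natCast_atTop_atTop
  have hlog : ∀ᶠ y : ℝ in Filter.atTop, Real.log y ≤ α / 32 * y := by
    have := Real.isLittleO_log_id_atTop.bound (show 0 < α / 32 by positivity)
    filter_upwards [this, Filter.eventually_ge_atTop 0] with y hy h0
    simp only [id, Real.norm_eq_abs, abs_of_nonneg h0] at hy
    exact (le_abs_self _).trans hy
  have hev : ∀ᶠ y : ℝ in Filter.atTop, Real.log y ≤ α / 32 * y ∧ 2 ≤ y ∧ 32 / α ≤ y ∧ 10 / β ≤ y ∧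
      (L + 1) / β ≤ y ∧ L / (α / 2 * κ) ≤ y ∧ L / κ ≤ y ∧ (L ^ 2 / κ ^ 2) / (α / 8) < y := by
    filter_upwards [hlog, Filter.eventually_ge_atTop 2, Filter.eventually_ge_atTop (32 / α),
      Filter.eventually_ge_atTop (10 / β), Filter.eventually_ge_atTop ((L + 1) / β),
      Filter.eventually_ge_atTop (L / (α / 2 * κ)), Filter.eventually_ge_atTop (L / κ),
      Filter.eventually_gt_atTop ((L ^ 2 / κ ^ 2) / (α / 8))] with y a b c d e f g h
    exact ⟨a, b, c, d, e, f, g, h⟩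
  obtain ⟨n₀, hn₀⟩ := Filter.eventually_atTop.1 (ht.eventually hev)
  refine ⟨n₀, fun n hn => ?_⟩
  obtain ⟨e1, e2, e3, e4, e5, e6, e7, e8⟩ := hn₀ n hn
  set y := √(n : ℝ) with hy
  have hyn : (n : ℝ) = y ^ 2 := (Real.sq_sqrt (by positivity)).symm
  have hy0 : 0 < y := by linarith
  have hlogn : Real.log n = 2 * Real.log y := by rw [hyn, Real.log_pow]; norm_num
  have hly : Real.log y ≤ y := (Real.log_le_sub_one_of_pos hy0).trans (by linarith)
  rw [div_le_iff₀ (by positivity)] at e3 e4 e5 e6 e7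
  rw [div_lt_iff₀ (by positivity)] at e8
  have hyy : y ≤ y ^ 2 := by nlinarith
  refine ⟨?_, ?_, ?_, ?_, ?_, ?_, ?_⟩
  · have : (2:ℝ) ≤ n := by rw [hyn]; nlinarith
    exact_mod_cast this
  · rw [hyn]; nlinarith
  · rw [hlogn, hyn]; nlinarith
  · rw [hyn]; nlinarith
  · rw [hyn]; nlinarith [mul_le_mul_of_nonneg_left hyy (show 0 ≤ α / 2 * κ by positivity)]
  · linarith
  · rw [hlogn]; nlinarith

set_option maxHeartbeats 2000000 in
/-- Main theorem for neighbourhood systems. -/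
lemma main_nb (α : ℝ) (hα : 0 < α) :
    ∃ n₀ : ℕ, ∀ n : ℕ, n₀ ≤ n → ∀ Nb : ℕ → Fin n → Finset (Fin n),
    (∀ i u v, u ∈ Nb i v ↔ v ∈ Nb i u) → (∀ i, Nb i = Nb (i % n)) →
    (∀ i v, (1/2 + α) * n ≤ #(Nb i v)) →
    ∃ σ : Equiv.Perm (Fin n), ∀ i : Fin n,
      σ ⟨(i.val + 1) % n, Nat.mod_lt _ i.pos⟩ ∈ Nb i.val (σ i) := by
  set β : ℝ := α ^ 5 / 192 with hβd
  have hβ : 0 < β := by positivity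
  set L : ℕ := ⌈1 / β⌉₊ with hL
  have hLβ : 1 ≤ β * (L + 1) := by
    have := Nat.le_ceil (1 / β)
    rw [div_le_iff₀ hβ] at this
    rw [← hL] at this
    nlinarith
  set κ : ℝ := 1 / (4 * (L + 1)) with hκd
  have hκ : 0 < κ := by positivity
  have hκL : κ * (L + 1) = 1/4 := by rw [hκd]; field_simp
  clear_value L κ
  obtain ⟨n₀, hn₀⟩ := large_n α hα β κ hβ hκ L
  refine ⟨n₀, fun n hn Nb hsym hper hdeg => ?_⟩
  obtain ⟨E1, E2, E3, E4, E5, E6, E7⟩ := hn₀ n hn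
  have : NeZero n := ⟨by omega⟩
  have hn0 : (0:ℝ) < n := by exact_mod_cast (by omega : 0 < n)
  have hα2 : α ≤ 1/2 := by
    have h1 := hdeg 0 0
    have h2 : (#(Nb 0 0) : ℝ) ≤ n := by
      have := card_le_univ (Nb 0 0)
      rw [Fintype.card_fin] at this
      exact_mod_cast this
    nlinarith
  set N : ℕ := ⌊α * n / 16⌋₊ with hN
  have hN1 : (N : ℝ) ≤ α * n / 16 := Nat.floor_le (by positivity)
  have hN2 : α * n / 32 ≤ N := by
    have := Nat.lt_floor_add_one (α * n / 16)
    rw [← hN] at this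
    linarith
  clear_value N
  have hcap : ∀ i j u v, 2 * α * n ≤ #(Nb i u ∩ Nb j v) := by
    intro i j u v
    have h1 := hdeg i u
    have h2 := hdeg j v
    have h3 := card_union_add_card_inter (Nb i u) (Nb j v)
    have h4 := card_le_univ (Nb i u ∪ Nb j v)
    rw [Fintype.card_fin] at h4
    have h5 : (#(Nb i u) : ℝ) + #(Nb j v) ≤ n + #(Nb i u ∩ Nb j v) := by
      exact_mod_cast (by omega)
    linarith
  have hbnd : α * n + 4 * N + 3 ≤ 2 * α * n := by linarith
  -- absorbers
  obtain ⟨h, h1, h2, h3⟩ := absorbers (ι := Fin n × Fin n × Fin n × Fin n × Fin n) Nb hsym N (α * n)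
    (by positivity) (fun θ => θ.1) (fun θ => Nb θ.2.1.val θ.2.2.1 ∩ Nb θ.2.2.2.1.val θ.2.2.2.2)
    (fun i j u v => hbnd.trans (hcap i j u v)) (fun θ => hbnd.trans (hcap _ _ _ _)) N le_rfl
  have h4N : 4 * N + 1 ≤ n := by
    have : (4:ℝ) * N + 1 ≤ n := by nlinarith
    exact_mod_cast this
  set K : ℕ := (n - 4 * N - 1) / (L + 1) with hK
  have hK1 : K * (L + 1) ≤ n - 4 * N - 1 := Nat.div_mul_le_self _ _
  have hK2 : n - 4 * N - 1 < (K + 1) * (L + 1) := by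
    rw [mul_comm (K+1)]; exact Nat.lt_mul_div_succ _ (by omega)
  clear_value K
  have hsize : 4 * N + K * (L + 1) + 1 ≤ n := by omega
  have hKL : K * (L + 1) = K * L + K := by ring
  have hKL2 : (K + 1) * (L + 1) = K * L + K + L + 1 := by ring
  have hKr1 : (4:ℝ) * N + K * (L + 1) + 1 ≤ n := by exact_mod_cast hsize
  have hKr2 : (n:ℝ) - 4 * N ≤ (K + 1) * (L + 1) := by
    have : (n:ℝ) ≤ (K + 1) * (L + 1) + 4 * N := by
      exact_mod_cast (by omega : n ≤ (K + 1) * (L + 1) + 4 * N)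
    linarith
  have hL0 : (0:ℝ) ≤ L := by positivity
  have hK0 : (0:ℝ) ≤ K := by positivity
  have hN0 : (0:ℝ) ≤ N := by positivity
  have hKβ : (K:ℝ) ≤ β * n := by
    have a1 : (K:ℝ) * (L+1) ≤ n := by linarith
    nlinarith
  have hcount : ∀ (u' u w a b : Fin n), n - 4 * N - K * L ≤ #((range N).filter fun k =>
      h (4*k+2) ∈ Nb u'.val a ∩ Nb u.val b ∧ h (4*k+1) ∈ Nb (4*k+1) w ∧ h (4*k+3) ∈ Nb (4*k+2) w) := by
    intro u' u w a b
    have s1 := (single_le_sum (f := fun θ : Fin n × Fin n × Fin n × Fin n × Fin n =>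
      Real.exp (-(#((range N).filter fun k => h (4*k+2) ∈ Nb θ.2.1.val θ.2.2.1 ∩ Nb θ.2.2.2.1.val θ.2.2.2.2
        ∧ h (4*k+1) ∈ Nb (4*k+1) θ.1 ∧
        h (4*k+3) ∈ Nb (4*k+2) θ.1) : ℝ)))
          (fun _ _ => (Real.exp_pos _).le) (mem_univ (w, u', a, u, b))).trans h3
    simp only at s1
    set c := #((range N).filter fun k =>
      h (4*k+2) ∈ Nb u'.val a ∩ Nb u.val b ∧ h (4*k+1) ∈ Nb (4*k+1) w ∧ h (4*k+3) ∈ Nb (4*k+2) w)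
    have s2 : ((Fintype.card (Fin n × Fin n × Fin n × Fin n × Fin n) : ℕ) : ℝ) = Real.exp (5 * Real.log n) := by
      rw [show 5 * Real.log n = Real.log ((n:ℝ) ^ 5) by rw [Real.log_pow]; norm_num,
        Real.exp_log (by positivity)]
      simp only [Fintype.card_prod, Fintype.card_fin]
      push_cast; ring
    rw [s2, ← Real.exp_add, Real.exp_le_exp, Fintype.card_fin, mul_div_assoc, div_self hn0.ne', mul_one] at s1
    have s3 : 3 * β * n ≤ α ^ 4 / 2 * N := by
      have : α ^ 4 / 2 * (α * n / 32) ≤ α ^ 4 / 2 * N := by gcongr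
      rw [hβd]; nlinarith
    have s4 : 2 * β * n ≤ c := by
      have : -α ^ 4 / 2 * (N:ℝ) = -(α ^ 4 / 2 * N) := by ring
      rw [this] at s1
      linarith
    have s5 : ((n - 4 * N - K * L : ℕ) : ℝ) ≤ K + (L + 1) := by
      exact_mod_cast (by omega : n - 4 * N - K * L ≤ K + (L + 1))
    have s6 : ((n - 4 * N - K * L : ℕ) : ℝ) ≤ c := by linarith
    exact_mod_cast s6
  -- blocks
  set V0 : Finset (Fin n) := univ \ (range (4 * N)).image h with hV0
  have hVc : (#V0 : ℝ) = n - 4 * N := by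
    rw [hV0, cast_card_sdiff (subset_univ _), card_image_of_injOn h1]
    simp
  obtain ⟨p, R, hR0, hR, _, _⟩ := blocks (ι := Fin n × Fin n) Nb hsym (fun θ => Nb θ.1.val θ.2)
    (by
      intro i v
      refine ⟨(⟨i % n, Nat.mod_lt _ (by omega)⟩, v), ?_⟩
      rw [hper i])
    V0 L K (κ * n) (√n) (1/2 + 3 * α / 4) (1/2 + α / 2) (by positivity) (by positivity)
    (by
      rw [hVc]
      have a1 : (K:ℝ) * L + (K + 1) ≤ n - 4 * N := by linarith
      have a2 : κ * n ≤ K + 1 := by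
        have a3 : (1/2 : ℝ) * n ≤ (K + 1) * (L + 1) := by nlinarith
        have a4 : κ * ((1/2 : ℝ) * n) ≤ κ * ((K + 1) * (L + 1)) := by gcongr
        have a5 : κ * ((K + 1) * (L + 1)) = (K + 1) * (1/4 : ℝ) := by rw [← hκL]; ring
        rw [a5] at a4
        nlinarith
      linarith)
    (by
      rintro ⟨i, v⟩
      simp only
      rw [hVc]
      have a1 : #(Nb i.val v) ≤ #(Nb i.val v ∩ V0) + 4 * N := by
        have b1 : Nb i.val v ⊆ (Nb i.val v ∩ V0) ∪ (range (4*N)).image h := by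
          intro x hx
          by_cases hx' : x ∈ (range (4*N)).image h
          · exact mem_union_right _ hx'
          · exact mem_union_left _ (mem_inter.2 ⟨hx, mem_sdiff.2 ⟨mem_univ _, hx'⟩⟩)
        have b2 := (card_le_card b1).trans (card_union_le _ _)
        rw [card_image_of_injOn h1, card_range] at b2
        exact b2
      have a2 : (#(Nb i.val v) : ℝ) ≤ #(Nb i.val v ∩ V0) + 4 * N := by exact_mod_cast a1
      have a3 := hdeg i.val v
      nlinarith)
    (by linarith)
    (by
      have hs : 0 < √(n:ℝ) := Real.sqrt_pos.2 hn0
      rw [mul_div_assoc', div_le_one (by positivity)]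
      calc √(n:ℝ) * L ≤ √n * (κ * √n) := by gcongr
        _ = κ * (√n * √n) := by ring
        _ = κ * n := by rw [Real.mul_self_sqrt hn0.le])
    (by
      have s2 : ((Fintype.card (Fin n × Fin n) : ℕ) : ℝ) = Real.exp (2 * Real.log n) := by
        rw [show 2 * Real.log n = Real.log ((n:ℝ) ^ 2) by rw [Real.log_pow]; norm_num,
          Real.exp_log (by positivity)]
        simp only [Fintype.card_prod, Fintype.card_fin]
        push_cast; ring
      rw [s2, ← Real.exp_add, ← Real.exp_add, Real.exp_lt_exp]
      have s3 : (√(n:ℝ) * (L / (κ * n))) ^ 2 * K ≤ L ^ 2 / κ ^ 2 := by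
        have : (√(n:ℝ) * (L / (κ * n))) ^ 2 = L ^ 2 / κ ^ 2 / n := by
          rw [mul_pow, Real.sq_sqrt hn0.le]; field_simp
        rw [this, div_mul_eq_mul_div, div_le_iff₀ hn0]
        gcongr
        nlinarith
      nlinarith)
    (fun k => 4 * N + k * (L + 1) + 1) K le_rfl
  exact assemble n E1 Nb hsym N K L hsize h h1 h2 hcount p R hR0 hR


/-- Theorem 1.2 (every Hamilton cycle pattern): for every `α > 0` and `n` sufficiently
large, any collection `G₁,…,G_m` of graphs on `{1,…,n}`, each with minimum degree at
least `(1/2+α)n`, contains, for every colour pattern `χ : {1,…,n} → {1,…,m}`, a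
Hamilton cycle `e₁…e_n` with `e_i ∈ G_{χ(i)}` for all `i`. A Hamilton cycle is encoded
by a bijective ordering `σ` of the vertices, the `i`-th edge joining `σ(i)` and
`σ(i+1)` (indices cyclic). -/
theorem stmt_15 (α : ℝ) (hα : 0 < α) :
    ∃ n₀ : ℕ, ∀ n : ℕ, n₀ ≤ n →
    ∀ (m : ℕ) (G : Fin m → SimpleGraph (Fin n)),
    (∀ (j : Fin m) (v : Fin n), (1/2 + α) * n ≤ ((G j).neighborSet v).ncard) →
    ∀ χ : Fin n → Fin m,
    ∃ σ : Equiv.Perm (Fin n), ∀ i : Fin n,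
      (G (χ i)).Adj (σ i) (σ ⟨(i.val + 1) % n, Nat.mod_lt _ i.pos⟩) := by

  classical
  obtain ⟨n₀, hn₀⟩ := main_nb α hα
  refine ⟨n₀ + 1, fun n hn m G hG χ => ?_⟩
  have hpos : 0 < n := by omega
  obtain ⟨σ, hσ⟩ := hn₀ n (by omega)
    (fun i v => Finset.univ.filter fun u => (G (χ ⟨i % n, Nat.mod_lt _ hpos⟩)).Adj v u)
    (by intro i u v; simp [SimpleGraph.adj_comm])
    (by intro i; simp)
    (by
      intro i v
      refine (hG (χ ⟨i % n, Nat.mod_lt _ hpos⟩) v).trans (le_of_eq ?_)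
      rw [Set.ncard_eq_toFinset_card']
      congr 2
      ext u; simp)
  refine ⟨σ, fun i => ?_⟩
  have := hσ i
  simp only [Finset.mem_filter, Finset.mem_univ, true_and, Nat.mod_eq_of_lt i.2] at this
  exact this
end

section
/- Let 0 < 1/n ≪ γ ≪ β ≪ α ≤ 1. Then there exists a ≤ 500βn such that the following holds with t := a + βn + 1. Let G₁, …, G_t be graphs on a common vertex set V = {1,…,n}, each with minimum degree at least (1/2 + α)n. Let Z ⊆ V with |Z| = (β + γ)n + 2 and let z₁, z₂ ∈ Z. Then there exists a set A ⊆ V \ Z of size a such that for every Z' ⊆ Z \ {z₁, z₂} with |Z'| = βn, there is a z₁,z₂-path P = e₁…e_t whose internal vertices are exactly A ∪ Z' and such that e_i is an edge of G_i for all i ∈ {1,…,t}. -/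
section AbsHelpers

open Finset Classical

lemma abs_sdr {ι V : Type*} [Fintype ι] (S : ι → Finset V)
    (h : ∀ i, Fintype.card ι ≤ (S i).card) :
    ∃ f : ι → V, Function.Injective f ∧ ∀ i, f i ∈ S i := by
  refine (Finset.all_card_le_biUnion_card_iff_exists_injective S).1 ?_
  intro s
  rcases s.eq_empty_or_nonempty with rfl | ⟨i, hi⟩
  · simp
  · calc s.card ≤ Fintype.card ι := Finset.card_le_univ s
      _ ≤ (S i).card := h i
      _ ≤ _ := Finset.card_le_card (Finset.subset_biUnion_of_mem S hi)

lemma abs_card_prod {A B : Type*} [Fintype A] [Fintype B] (Q : A × B → Prop) [DecidablePred Q] (S : Finset A)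
    (d : ℕ) (h : ∀ a ∈ S, d ≤ (univ.filter fun b => Q (a, b)).card) :
    S.card * d ≤ (univ.filter Q).card := by
  have h1 : (S.sigma fun a => univ.filter fun b => Q (a, b)).card ≤ (univ.filter Q).card := by
    refine Finset.card_le_card_of_injOn (fun z => (z.1, z.2)) ?_ ?_
    · rintro ⟨a, b⟩ hz
      simp at hz ⊢
      exact hz.2
    · rintro ⟨a, b⟩ _ ⟨a', b'⟩ _ hh
      simp at hh
      obtain ⟨rfl, rfl⟩ := hh
      rfl
  refine le_trans ?_ h1
  rw [Finset.card_sigma, ← smul_eq_mul]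
  exact Finset.card_nsmul_le_sum _ _ _ h

/-- The vertices of a triple. -/
noncomputable def absSupp {V : Type*} (T : V × V × V) : Finset V := {T.1, T.2.1, T.2.2}

lemma abs_supp_card_le {V : Type*} (T : V × V × V) : (absSupp T).card ≤ 3 :=
  Finset.card_le_three

lemma abs_stage2 {V P : Type*} [Fintype V] [Nonempty V] [Fintype P] [Nonempty P]
    (good : ℕ → P → V × V × V → Prop) (U : Finset V) (δ : ℝ) (hδ0 : 0 < δ) (q : ℕ)
    (h : ∀ W : Finset V, W.card ≤ U.card + 3 * q → ∀ j p,
      δ * Fintype.card (V × V × V) ≤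
        (univ.filter fun T => good j p T ∧ Disjoint (absSupp T) W ∧ (absSupp T).card = 3).card) :
    ∀ r ≤ q, ∃ T : ℕ → V × V × V,
      (∀ j < r, (absSupp (T j)).card = 3 ∧ Disjoint (absSupp (T j)) U ∧
        (∀ i < j, Disjoint (absSupp (T i)) (absSupp (T j))) ∧ ∃ p, good j p (T j)) ∧
      ∑ p, (1 / 2 : ℝ) ^ ((range r).filter fun j => good j p (T j)).card
        ≤ Fintype.card P * (1 - δ / 2) ^ r := by
  intro r
  induction r with
  | zero =>
    intro _
    obtain ⟨v⟩ := ‹Nonempty V›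
    exact ⟨fun _ => (v, v, v), by simp, by simp⟩
  | succ r ih =>
    intro hr
    obtain ⟨T, hT, hpot⟩ := ih (by omega)
    set w : P → ℝ := fun p => (1 / 2 : ℝ) ^ ((range r).filter fun j => good j p (T j)).card with hw
    have hwpos : ∀ p, 0 < w p := fun p => by positivity
    set W : Finset V := U ∪ (range r).biUnion (fun j => absSupp (T j)) with hW
    have hWc : W.card ≤ U.card + 3 * q := by
      have h1 : ((range r).biUnion (fun j => absSupp (T j))).card ≤ r * 3 := by
        have := Finset.card_biUnion_le_card_mul (range r) (fun j => absSupp (T j)) 3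
          (fun j _ => abs_supp_card_le _)
        simpa using this
      have := Finset.card_union_le U ((range r).biUnion (fun j => absSupp (T j)))
      rw [hW]
      omega
    set g : P → V × V × V → Prop :=
      fun p t => good r p t ∧ Disjoint (absSupp t) W ∧ (absSupp t).card = 3 with hg
    -- averaging
    have hex : ∃ t : V × V × V, δ * ∑ p, w p ≤ ∑ p, if g p t then w p else 0 := by
      by_contra hcon
      push Not at hcon
      have h1 : ∑ t : V × V × V, ∑ p, (if g p t then w p else 0)
          < ∑ t : V × V × V, δ * ∑ p, w p :=
        Finset.sum_lt_sum_of_nonempty univ_nonempty (fun t _ => hcon t)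
      rw [Finset.sum_comm] at h1
      have h2 : ∀ p, ∑ t : V × V × V, (if g p t then w p else 0)
          = ((univ.filter fun t => g p t).card : ℝ) * w p := by
        intro p
        rw [← Finset.sum_filter, Finset.sum_const, nsmul_eq_mul]
      simp only [h2] at h1
      have h3 : ∑ p, (δ * Fintype.card (V × V × V)) * w p
          ≤ ∑ p, ((univ.filter fun t => g p t).card : ℝ) * w p :=
        Finset.sum_le_sum fun p _ => mul_le_mul_of_nonneg_right (h W hWc r p) (hwpos p).le
      rw [← Finset.mul_sum] at h3
      rw [Finset.sum_const, nsmul_eq_mul, Finset.card_univ] at h1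
      have h4 : δ * (Fintype.card (V × V × V) : ℝ) * ∑ p, w p
        = (Fintype.card (V × V × V) : ℝ) * (δ * ∑ p, w p) := by ring
      linarith
    obtain ⟨t, ht⟩ := hex
    have hsum : 0 < ∑ p, w p := Finset.sum_pos (fun p _ => hwpos p) univ_nonempty
    have hgt : ∃ p, g p t := by
      by_contra hcon
      push Not at hcon
      simp only [hcon, if_false, Finset.sum_const_zero] at ht
      have := mul_pos hδ0 hsum
      linarith
    obtain ⟨p0, hp0⟩ := hgt
    have hdis : Disjoint (absSupp t) W := hp0.2.1
    refine ⟨Function.update T r t, ?_, ?_⟩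
    · intro j hj
      rcases Nat.lt_succ_iff_lt_or_eq.1 hj with hj | rfl
      · rw [Function.update_of_ne hj.ne]
        refine ⟨(hT j hj).1, (hT j hj).2.1, ?_, (hT j hj).2.2.2⟩
        intro i hi
        rw [Function.update_of_ne (by omega)]
        exact (hT j hj).2.2.1 i hi
      · rw [Function.update_self]
        refine ⟨hp0.2.2, hdis.mono_right subset_union_left, ?_, p0, hp0.1⟩
        intro i hi
        rw [Function.update_of_ne (by omega)]
        refine (hdis.mono_right ?_).symm
        exact (Finset.subset_biUnion_of_mem (fun j => absSupp (T j)) (mem_range.2 hi)).trans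
          subset_union_right
    · have key : ∀ p, (1 / 2 : ℝ) ^ ((range (r + 1)).filter
          fun j => good j p (Function.update T r t j)).card
          ≤ w p - (1 / 2) * (if g p t then w p else 0) := by
        intro p
        have e1 : ((range r).filter fun j => good j p (Function.update T r t j))
            = (range r).filter fun j => good j p (T j) := by
          apply Finset.filter_congr
          intro j hj
          rw [Function.update_of_ne (mem_range.1 hj).ne]
        rw [Finset.range_add_one, Finset.filter_insert, e1, Function.update_self]
        by_cases hgp : good r p t
        · rw [if_pos hgp, Finset.card_insert_of_notMem (by simp), pow_succ]
          have := hwpos p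
          split_ifs <;> simp only [hw] at * <;> linarith
        · have : ¬ g p t := fun hh => hgp hh.1
          rw [if_neg hgp, if_neg this]
          simp [hw]
      calc _ ≤ ∑ p, (w p - (1 / 2) * (if g p t then w p else 0)) :=
            Finset.sum_le_sum fun p _ => key p
        _ = ∑ p, w p - (1 / 2) * ∑ p, (if g p t then w p else 0) := by
            rw [Finset.sum_sub_distrib, Finset.mul_sum]
        _ ≤ (1 - δ / 2) * ∑ p, w p := by linarith
        _ ≤ (1 - δ / 2) * (Fintype.card P * (1 - δ / 2) ^ r) := by
            refine mul_le_mul_of_nonneg_left hpot ?_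
            have h5 : ∑ p, (if g p t then w p else 0) ≤ ∑ p, w p :=
              Finset.sum_le_sum fun p _ => by
                split_ifs
                · exact le_rfl
                · exact (hwpos p).le
            have : δ * ∑ p, w p ≤ 1 * ∑ p, w p := by linarith
            have := le_of_mul_le_mul_right this hsum
            linarith
        _ = _ := by ring

lemma abs_mem_supp {V : Type*} (T : V × V × V) (v : V) :
    v ∈ absSupp T ↔ v = T.1 ∨ v = T.2.1 ∨ v = T.2.2 := by
  simp [absSupp]

lemma abs_count {V : Type*} [Fintype V] (D : ℕ) (A B1 B2 : V → Prop) (H1 H2 : V → V → Prop)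
    (W : Finset V) (hW : W.card + 2 ≤ D) (Q : V × V × V → Prop)
    (hA : 2 * D ≤ (univ.filter fun b => A b).card)
    (hx : ∀ b, 2 * D ≤ (univ.filter fun x => H1 b x ∧ B1 x).card)
    (hy : ∀ b, 2 * D ≤ (univ.filter fun y => H2 b y ∧ B2 y).card)
    (hQ : ∀ b x y, A b → H1 b x → B1 x → H2 b y → B2 y → Q (b, x, y)) :
    D ^ 3 ≤ (univ.filter fun T => Q T ∧ Disjoint (absSupp T) W ∧ (absSupp T).card = 3).card := by
  have hsd : ∀ (S F : Finset V), 2 * D ≤ S.card → F.card ≤ D → D ≤ (S \ F).card := by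
    intro S F h1 h2
    have := Finset.le_card_sdiff F S
    omega
  have e : D ^ 3 = D * (D * D) := by ring
  rw [e]
  have hb := hsd _ W hA (by omega)
  refine le_trans (Nat.mul_le_mul_right _ hb) (abs_card_prod _ _ _ ?_)
  intro b hb
  simp only [mem_sdiff, mem_filter, mem_univ, true_and] at hb
  have hxc := hsd _ (insert b W) (hx b) (by have := Finset.card_insert_le b W; omega)
  refine le_trans (Nat.mul_le_mul_right _ hxc) (abs_card_prod _ _ _ ?_)
  intro x hx
  simp only [mem_sdiff, mem_filter, mem_univ, true_and, mem_insert, not_or] at hx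
  have hyc := hsd _ (insert x (insert b W)) (hy b) (by
    have := Finset.card_insert_le b W
    have := Finset.card_insert_le x (insert b W)
    omega)
  refine le_trans hyc (Finset.card_le_card ?_)
  intro y hy
  simp only [mem_sdiff, mem_filter, mem_univ, true_and, mem_insert, not_or] at hy ⊢
  refine ⟨hQ b x y hb.1 hx.1.1 hx.1.2 hy.1.1 hy.1.2, ?_, ?_⟩
  · rw [Finset.disjoint_left]
    intro v hv
    rw [abs_mem_supp] at hv
    rcases hv with rfl | rfl | rfl
    · exact hb.2
    · exact hx.2.2
    · exact hy.2.2.2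
  · exact Finset.card_eq_three.2 ⟨b, x, y, fun h => hx.2.1 h.symm, fun h => hy.2.2.1 h.symm,
      fun h => hy.2.1 h.symm, rfl⟩

/-- The path assembled from connectors, slot ends and slot contents. -/
def absPath {V : Type*} (m : ℕ) (z₁ z₂ : V) (c x f y : ℕ → V) (i : ℕ) : V :=
  if i = 0 then z₁ else if i = 8 * m + 2 then z₂ else
    if (i - 1) % 4 = 0 then c ((i - 1) / 4) else
    if (i - 1) % 4 = 1 then x ((i - 1) / 4) else
    if (i - 1) % 4 = 2 then f ((i - 1) / 4) else y ((i - 1) / 4)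

section
variable {V : Type*} (m : ℕ) (z₁ z₂ : V) (c x f y : ℕ → V)

lemma absPath_zero : absPath m z₁ z₂ c x f y 0 = z₁ := by simp [absPath]

lemma absPath_last : absPath m z₁ z₂ c x f y (8 * m + 2) = z₂ := by simp [absPath]

lemma absPath_c (s : ℕ) : absPath m z₁ z₂ c x f y (4 * s + 1) = c s := by
  have h1 : ¬ (4 * s + 1 = 8 * m + 2) := by omega
  have h2 : (4 * s + 1 - 1) % 4 = 0 := by omega
  have h3 : (4 * s + 1 - 1) / 4 = s := by omega
  rw [absPath, if_neg (by omega), if_neg h1, if_pos h2, h3]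

lemma absPath_x (s : ℕ) (hs : s < 2 * m) : absPath m z₁ z₂ c x f y (4 * s + 2) = x s := by
  have h3 : (4 * s + 2 - 1) / 4 = s := by omega
  rw [absPath, if_neg (by omega), if_neg (by omega), if_neg (by omega), if_pos (by omega), h3]

lemma absPath_f (s : ℕ) : absPath m z₁ z₂ c x f y (4 * s + 3) = f s := by
  have h3 : (4 * s + 3 - 1) / 4 = s := by omega
  rw [absPath, if_neg (by omega), if_neg (by omega), if_neg (by omega), if_neg (by omega),
    if_pos (by omega), h3]

lemma absPath_y (s : ℕ) : absPath m z₁ z₂ c x f y (4 * s + 4) = y s := by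
  have h3 : (4 * s + 4 - 1) / 4 = s := by omega
  rw [absPath, if_neg (by omega), if_neg (by omega), if_neg (by omega), if_neg (by omega),
    if_neg (by omega), h3]

lemma absPath_adj (G : ℕ → SimpleGraph V)
    (hc1 : ∀ s ≤ 2 * m, (G (4 * s)).Adj (if s = 0 then z₁ else y (s - 1)) (c s))
    (hc2 : ∀ s ≤ 2 * m, (G (4 * s + 1)).Adj (if s = 2 * m then z₂ else x s) (c s))
    (hf1 : ∀ s < 2 * m, (G (4 * s + 2)).Adj (x s) (f s))
    (hf2 : ∀ s < 2 * m, (G (4 * s + 3)).Adj (f s) (y s)) :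
    ∀ i < 8 * m + 2, (G i).Adj (absPath m z₁ z₂ c x f y i) (absPath m z₁ z₂ c x f y (i + 1)) := by
  intro i hi
  obtain ⟨s, r, hr, rfl⟩ : ∃ s r, r < 4 ∧ i = 4 * s + r := ⟨i / 4, i % 4, by omega, by omega⟩
  have hr' : r = 0 ∨ r = 1 ∨ r = 2 ∨ r = 3 := by omega
  rcases hr' with rfl | rfl | rfl | rfl
  · rw [absPath_c]
    have := hc1 s (by omega)
    rcases Nat.eq_zero_or_pos s with rfl | hs
    · simpa [absPath_zero] using this
    · obtain ⟨s', rfl⟩ : ∃ s', s = s' + 1 := ⟨s - 1, by omega⟩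
      have e : 4 * (s' + 1) + 0 = 4 * s' + 4 := by ring
      rw [e, absPath_y]
      rw [if_neg (by omega), show 4 * (s' + 1) = 4 * s' + 4 by ring] at this
      exact this
  · rw [absPath_c]
    have := hc2 s (by omega)
    by_cases hs : s = 2 * m
    · subst hs
      have e : 4 * (2 * m) + 1 + 1 = 8 * m + 2 := by ring
      rw [e, absPath_last]
      simpa using this.symm
    · rw [if_neg hs] at this
      rw [show 4 * s + 1 + 1 = 4 * s + 2 by ring, absPath_x _ _ _ _ _ _ _ _ (by omega)]
      exact this.symm
  · rw [absPath_x _ _ _ _ _ _ _ _ (by omega), show 4 * s + 2 + 1 = 4 * s + 3 by ring, absPath_f]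
    exact hf1 s (by omega)
  · rw [absPath_f, show 4 * s + 3 + 1 = 4 * s + 4 by ring, absPath_y]
    exact hf2 s (by omega)

end

/-- Filling the slots for a given target set. -/
lemma abs_fill {V : Type*} (m k : ℕ) (w : Fin m → V) (hw : Function.Injective w)
    (b : ℕ → V) (ok : ℕ → V → Fin m → Prop)
    (hok : ∀ u i, k ≤ ((range m).filter fun j => ok j u i).card)
    (Z' : Finset V) (hZ' : Z'.card = m) (hk : (Z'.filter fun v => v ∉ Set.range w).card ≤ k) :
    ∃ f : ℕ → V,
      (∀ i : Fin m, f i = w i ∨ ∃ j < m, ∃ u, ok j u i ∧ f i = b j) ∧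
      (∀ j < m, f (m + j) = b j ∨ ∃ i u, ok j u i ∧ f (m + j) = u) ∧
      (∀ v ∈ Z', ∃ s < 2 * m, f s = v) ∧ (∀ j < m, ∃ s < 2 * m, f s = b j) := by
  set S1 := Z'.filter fun v => v ∉ Set.range w with hS1
  let ι := {i : Fin m // w i ∉ Z'}
  have hcard : Fintype.card ι = Fintype.card S1 := by
    have h1 : (univ.filter fun i : Fin m => w i ∈ Z').card
        = (Z'.filter fun v => v ∈ Set.range w).card := by
      rw [← Finset.card_image_of_injective _ hw]
      congr 1
      ext v
      simp only [mem_image, mem_filter, mem_univ, true_and, Set.mem_range]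
      constructor
      · rintro ⟨i, hi, rfl⟩
        exact ⟨hi, i, rfl⟩
      · rintro ⟨hv, i, rfl⟩
        exact ⟨i, hv, rfl⟩
    have h2 := Finset.card_filter_add_card_filter_not (s := Z') (fun v => v ∈ Set.range w)
    have h3 := Finset.card_filter_add_card_filter_not (s := (univ : Finset (Fin m)))
      (fun i => w i ∈ Z')
    have h4 : Fintype.card ι = (univ.filter fun i : Fin m => w i ∉ Z').card :=
      Fintype.card_subtype _
    rw [Fintype.card_coe, h4, hS1]
    simp only [Finset.card_univ, Fintype.card_fin] at h3
    omega
  let σ : ι ≃ S1 := Fintype.equivOfCardEq hcard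
  obtain ⟨g, hgi, hg⟩ := abs_sdr
    (fun i : ι => (range m).filter fun j => ok j (σ i : V) i.1) (by
      intro i
      refine le_trans ?_ (hok _ _)
      rw [hcard, Fintype.card_coe]
      exact hk)
  simp only [mem_filter, mem_range] at hg
  let f : ℕ → V := fun s =>
    if h : s < m then
      (if h' : w ⟨s, h⟩ ∉ Z' then b (g ⟨⟨s, h⟩, h'⟩) else w ⟨s, h⟩)
    else if h : ∃ i, g i = s - m then (σ h.choose : V) else b (s - m)
  have f1 : ∀ i : Fin m, w i ∈ Z' → f i = w i := by
    intro i hi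
    simp [f, hi]
  have f2 : ∀ i : ι, f i.1 = b (g i) := by
    rintro ⟨i, hi⟩
    simp [f, hi]
  have f3 : ∀ i : ι, f (m + g i) = σ i := by
    intro i
    have hex : ∃ i', g i' = m + g i - m := ⟨i, by omega⟩
    have : hex.choose = i := hgi (by rw [hex.choose_spec]; omega)
    simp only [f]
    rw [dif_neg (by omega), dif_pos hex, this]
  have f4 : ∀ j, (∀ i, g i ≠ j) → f (m + j) = b j := by
    intro j hj
    simp only [f]
    rw [dif_neg (by omega), dif_neg]
    · simp
    · rintro ⟨i, hi⟩
      exact hj i (by omega)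
  refine ⟨f, ?_, ?_, ?_, ?_⟩
  · intro i
    by_cases hi : w i ∈ Z'
    · exact Or.inl (f1 i hi)
    · exact Or.inr ⟨g ⟨i, hi⟩, (hg _).1, _, (hg ⟨i, hi⟩).2, f2 ⟨i, hi⟩⟩
  · intro j hj
    by_cases h : ∃ i, g i = j
    · obtain ⟨i, rfl⟩ := h
      exact Or.inr ⟨i.1, σ i, (hg i).2, f3 i⟩
    · push Not at h
      exact Or.inl (f4 j h)
  · intro v hv
    by_cases h : v ∈ Set.range w
    · obtain ⟨i, rfl⟩ := h
      exact ⟨i, by omega, f1 i hv⟩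
    · have hv1 : v ∈ S1 := by simp only [hS1, mem_filter]; exact ⟨hv, h⟩
      refine ⟨m + g (σ.symm ⟨v, hv1⟩), ?_, ?_⟩
      · have := (hg (σ.symm ⟨v, hv1⟩)).1
        omega
      · rw [f3]; simp
  · intro j hj
    by_cases h : ∃ i, g i = j
    · obtain ⟨i, rfl⟩ := h
      exact ⟨i.1, by omega, f2 i⟩
    · push Not at h
      exact ⟨m + j, by omega, f4 j h⟩

lemma abs_core {V : Type*} [Fintype V] [DecidableEq V] (G : ℕ → SimpleGraph V) (D m k : ℕ)
    (hm : 1 ≤ m)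
    (hdeg : ∀ i j u v, 2 * D ≤ (univ.filter fun x => (G i).Adj u x ∧ (G j).Adj v x).card)
    (hD : 20 * m + k + 20 ≤ D)
    (hpot : (Fintype.card V * m : ℝ) * (1 - ((D : ℝ) / Fintype.card V) ^ 3 / 2) ^ m < (1 / 2) ^ k)
    (Z : Finset V) (hZ : Z.card = m + k + 2) (z₁ z₂ : V) (hz1 : z₁ ∈ Z) (hz2 : z₂ ∈ Z)
    (hz : z₁ ≠ z₂) :
    ∃ A : Finset V, A.card = 7 * m + 1 ∧ Disjoint A Z ∧
      ∀ Z' : Finset V, Z' ⊆ Z \ {z₁, z₂} → Z'.card = m →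
      ∃ P : ℕ → V, P 0 = z₁ ∧ P (8 * m + 2) = z₂ ∧
        (∀ i < 8 * m + 2, (G i).Adj (P i) (P (i + 1))) ∧
        ∀ v ∈ A ∪ Z', ∃ i, 1 ≤ i ∧ i < 8 * m + 2 ∧ P i = v := by
  have : Nonempty V := ⟨z₁⟩
  have : Nonempty (Fin m) := ⟨⟨0, hm⟩⟩
  have hNpos : 0 < Fintype.card V := Fintype.card_pos
  have hsub : ({z₁, z₂} : Finset V) ⊆ Z := by
    intro v hv
    simp only [mem_insert, mem_singleton] at hv
    rcases hv with rfl | rfl <;> assumption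
  have hZc : (Z \ {z₁, z₂}).card = m + k := by
    rw [Finset.card_sdiff_of_subset hsub, Finset.card_pair hz]
    omega
  obtain ⟨Z0, hZ0, hZ0c⟩ := Finset.exists_subset_card_eq (s := Z \ {z₁, z₂}) (n := m) (by omega)
  let e : Fin m ≃ Z0 := (Fintype.equivFinOfCardEq (by simpa using hZ0c)).symm
  let w : Fin m → V := fun i => (e i : V)
  have hw : Function.Injective w := Subtype.val_injective.comp e.injective
  have hwr : ∀ v, v ∈ Set.range w ↔ v ∈ Z0 := by
    intro v
    constructor
    · rintro ⟨i, rfl⟩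
      exact (e i).2
    · intro hv
      exact ⟨e.symm ⟨v, hv⟩, by simp [w]⟩
  have hsd : ∀ (i j : ℕ) (u v : V) (F : Finset V), F.card ≤ D →
      D ≤ ((univ.filter fun x => (G i).Adj u x ∧ (G j).Adj v x) \ F).card := by
    intro i j u v F h2
    have := Finset.le_card_sdiff F (univ.filter fun x => (G i).Adj u x ∧ (G j).Adj v x)
    have := hdeg i j u v
    omega
  -- stage 1: slots for the vertices of `Z0`
  obtain ⟨s1, hs1i, hs1⟩ := abs_sdr (ι := Fin m ⊕ Fin m) (fun s => Sum.elim
    (fun i : Fin m => (univ.filter fun x =>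
      (G (4 * i + 2)).Adj (w i) x ∧ (G (4 * i + 2)).Adj (w i) x) \ Z)
    (fun i : Fin m => (univ.filter fun x =>
      (G (4 * i + 3)).Adj (w i) x ∧ (G (4 * i + 3)).Adj (w i) x) \ Z) s) (by
      intro s
      have hc : Fintype.card (Fin m ⊕ Fin m) ≤ D := by simp; omega
      rcases s with i | i
      · exact hc.trans (hsd _ _ _ _ _ (by omega))
      · exact hc.trans (hsd _ _ _ _ _ (by omega)))
  set A1 : Finset V := univ.image s1 with hA1
  have hA1c : A1.card = 2 * m := by
    rw [hA1, Finset.card_image_of_injective _ hs1i]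
    simp
    omega
  have hA1Z : Disjoint A1 Z := by
    rw [Finset.disjoint_left]
    intro v hv
    simp only [hA1, mem_image, mem_univ, true_and] at hv
    obtain ⟨s, rfl⟩ := hv
    have := hs1 s
    rcases s with i | i
    · simp only [Sum.elim_inl, mem_sdiff] at this
      exact this.2
    · simp only [Sum.elim_inr, mem_sdiff] at this
      exact this.2
  have hx1 : ∀ i : Fin m, (G (4 * i + 2)).Adj (w i) (s1 (Sum.inl i)) := by
    intro i
    have := hs1 (Sum.inl i)
    simp only [Sum.elim_inl, mem_sdiff, mem_filter] at this
    exact this.1.2.1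
  have hy1 : ∀ i : Fin m, (G (4 * i + 3)).Adj (w i) (s1 (Sum.inr i)) := by
    intro i
    have := hs1 (Sum.inr i)
    simp only [Sum.elim_inr, mem_sdiff, mem_filter] at this
    exact this.1.2.1
  -- stage 2: gadgets
  obtain ⟨good, hgood⟩ : ∃ good : ℕ → V × Fin m → V × V × V → Prop, ∀ j p T, good j p T ↔
    ((G (4 * p.2 + 2)).Adj (s1 (Sum.inl p.2)) T.1 ∧ (G (4 * p.2 + 3)).Adj (s1 (Sum.inr p.2)) T.1) ∧
    ((G (4 * (m + j) + 2)).Adj T.1 T.2.1 ∧ (G (4 * (m + j) + 2)).Adj p.1 T.2.1) ∧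
    ((G (4 * (m + j) + 3)).Adj T.1 T.2.2 ∧ (G (4 * (m + j) + 3)).Adj p.1 T.2.2) :=
    ⟨_, fun j p T => Iff.rfl⟩
  have hUc : (Z ∪ A1).card ≤ 3 * m + k + 2 := by
    have := Finset.card_union_le Z A1
    omega
  obtain ⟨T, hT, hTpot⟩ := abs_stage2 good (Z ∪ A1) (((D : ℝ) / Fintype.card V) ^ 3)
    (by
      have : 0 < D := by omega
      positivity) m (by
      intro W hW j p
      have hcnt := abs_count D
        (fun b => (G (4 * p.2 + 2)).Adj (s1 (Sum.inl p.2)) b ∧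
          (G (4 * p.2 + 3)).Adj (s1 (Sum.inr p.2)) b)
        (fun x => (G (4 * (m + j) + 2)).Adj p.1 x)
        (fun x => (G (4 * (m + j) + 3)).Adj p.1 x)
        (fun b x => (G (4 * (m + j) + 2)).Adj b x)
        (fun b x => (G (4 * (m + j) + 3)).Adj b x) W (by omega) (good j p)
        (by convert hdeg (4 * p.2 + 2) (4 * p.2 + 3) (s1 (Sum.inl p.2)) (s1 (Sum.inr p.2)))
        (fun b => by convert hdeg (4 * (m + j) + 2) (4 * (m + j) + 2) b p.1)
        (fun b => by convert hdeg (4 * (m + j) + 3) (4 * (m + j) + 3) b p.1)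
        (fun b x y h1 h2 h3 h4 h5 => (hgood _ _ _).2 ⟨h1, ⟨h2, h3⟩, ⟨h4, h5⟩⟩)
      have he : ((D : ℝ) / Fintype.card V) ^ 3 * Fintype.card (V × V × V) = ((D ^ 3 : ℕ) : ℝ) := by
        have : (Fintype.card V : ℝ) ≠ 0 := by exact_mod_cast hNpos.ne'
        simp only [Fintype.card_prod]
        push_cast
        field_simp
      rw [he]
      exact_mod_cast hcnt) m le_rfl
  have hcov : ∀ u i, k ≤ ((range m).filter fun j => good j (u, i) (T j)).card := by
    intro u i
    by_contra hcon
    push Not at hcon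
    have h1 : (1 / 2 : ℝ) ^ ((range m).filter fun j => good j (u, i) (T j)).card ≤
        ∑ p, (1 / 2 : ℝ) ^ ((range m).filter fun j => good j p (T j)).card :=
      Finset.single_le_sum
        (f := fun p => (1 / 2 : ℝ) ^ ((range m).filter fun j => good j p (T j)).card)
        (fun p _ => by positivity) (mem_univ (u, i))
    have h2 : (1 / 2 : ℝ) ^ k ≤ (1 / 2 : ℝ) ^ ((range m).filter fun j => good j (u, i) (T j)).card :=
      pow_le_pow_of_le_one (by norm_num) (by norm_num) hcon.le
    have h3 : (Fintype.card (V × Fin m) : ℝ) = Fintype.card V * m := by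
      simp
    rw [h3] at hTpot
    linarith
  set A2 : Finset V := (range m).biUnion (fun j => absSupp (T j)) with hA2
  have hA2c : A2.card = 3 * m := by
    rw [hA2, Finset.card_biUnion]
    · rw [Finset.sum_congr rfl (fun j hj => (hT j (mem_range.1 hj)).1)]
      simp
      omega
    · intro i hi j hj hij
      simp only [coe_range, Set.mem_Iio] at hi hj
      rcases lt_or_gt_of_ne hij with h | h
      · exact (hT j hj).2.2.1 i h
      · exact ((hT i hi).2.2.1 j h).symm
  have hA2U : Disjoint A2 (Z ∪ A1) := by
    rw [hA2, Finset.disjoint_biUnion_left]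
    intro j hj
    exact (hT j (mem_range.1 hj)).2.1
  -- slot ends
  let x : ℕ → V := fun s => if h : s < m then s1 (Sum.inl ⟨s, h⟩) else (T (s - m)).2.1
  let y : ℕ → V := fun s => if h : s < m then s1 (Sum.inr ⟨s, h⟩) else (T (s - m)).2.2
  have hxl : ∀ i : Fin m, x i = s1 (Sum.inl i) := fun i => by simp [x]
  have hyl : ∀ i : Fin m, y i = s1 (Sum.inr i) := fun i => by simp [y]
  have hxr : ∀ j, x (m + j) = (T j).2.1 := fun j => by simp [x]
  have hyr : ∀ j, y (m + j) = (T j).2.2 := fun j => by simp [y]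
  -- stage 3: connectors
  have hWc : (Z ∪ A1 ∪ A2).card ≤ 6 * m + k + 2 := by
    have := Finset.card_union_le (Z ∪ A1) A2
    omega
  obtain ⟨c0, hc0i, hc0⟩ := abs_sdr (ι := Fin (2 * m + 1)) (fun s =>
    (univ.filter fun v => (G (4 * s)).Adj (if s.val = 0 then z₁ else y (s - 1)) v ∧
      (G (4 * s + 1)).Adj (if s.val = 2 * m then z₂ else x s) v) \ (Z ∪ A1 ∪ A2)) (by
      intro s
      have hc : Fintype.card (Fin (2 * m + 1)) ≤ D := by simp; omega
      exact hc.trans (hsd _ _ _ _ _ (by omega)))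
  simp only [mem_sdiff, mem_filter, mem_univ, true_and] at hc0
  set A3 : Finset V := univ.image c0 with hA3
  have hA3c : A3.card = 2 * m + 1 := by
    rw [hA3, Finset.card_image_of_injective _ hc0i]
    simp
  have hA3U : Disjoint A3 (Z ∪ A1 ∪ A2) := by
    rw [Finset.disjoint_left]
    intro v hv
    simp only [hA3, mem_image, mem_univ, true_and] at hv
    obtain ⟨s, rfl⟩ := hv
    exact (hc0 s).2
  let c : ℕ → V := fun s => if h : s < 2 * m + 1 then c0 ⟨s, h⟩ else z₁
  have hc : ∀ s (h : s < 2 * m + 1), c s = c0 ⟨s, h⟩ := fun s h => dif_pos h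
  have d12 : Disjoint A1 A2 := (hA2U.mono_right subset_union_right).symm
  have d123 : Disjoint (A1 ∪ A2) A3 := by
    refine (hA3U.mono_right ?_).symm
    rw [Finset.union_assoc]
    exact subset_union_right
  refine ⟨A1 ∪ A2 ∪ A3, ?_, ?_, ?_⟩
  · rw [Finset.card_union_of_disjoint d123, Finset.card_union_of_disjoint d12]
    omega
  · rw [Finset.disjoint_union_left, Finset.disjoint_union_left]
    refine ⟨⟨hA1Z, hA2U.mono_right subset_union_left⟩, hA3U.mono_right ?_⟩
    rw [Finset.union_assoc]
    exact subset_union_left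
  intro Z' hZ' hZ'c
  obtain ⟨f, hf1, hf2, hf3, hf4⟩ := abs_fill m k w hw (fun j => (T j).1)
    (fun j u i => good j (u, i) (T j)) hcov Z' hZ'c (by
      have h1 : (Z'.filter fun v => v ∉ Set.range w) ⊆ (Z \ {z₁, z₂}) \ Z0 := by
        intro v hv
        rw [mem_filter, hwr] at hv
        exact mem_sdiff.2 ⟨hZ' hv.1, hv.2⟩
      have h2 := Finset.card_le_card h1
      rw [Finset.card_sdiff_of_subset hZ0, hZc, hZ0c, Nat.add_sub_cancel_left] at h2
      convert h2)
  refine ⟨absPath m z₁ z₂ c x f y, absPath_zero .., absPath_last .., ?_, ?_⟩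
  · apply absPath_adj
    · intro s hs
      rw [hc s (by omega)]
      exact (hc0 ⟨s, by omega⟩).1.1
    · intro s hs
      rw [hc s (by omega)]
      exact (hc0 ⟨s, by omega⟩).1.2
    · intro s hs
      rcases lt_or_ge s m with h | h
      · have e1 := hxl ⟨s, h⟩
        simp only at e1
        rw [e1]
        rcases hf1 ⟨s, h⟩ with h2 | ⟨j, hj, u, hg, h2⟩
        · simp only at h2
          rw [h2]
          exact (hx1 ⟨s, h⟩).symm
        · simp only at h2
          rw [h2]
          exact ((hgood _ _ _).1 hg).1.1
      · obtain ⟨j, rfl⟩ := Nat.exists_eq_add_of_le h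
        rw [hxr]
        rcases hf2 j (by omega) with h2 | ⟨i, u, hg, h2⟩
        · rw [h2]
          obtain ⟨p, hp⟩ := (hT j (by omega)).2.2.2
          exact ((hgood _ _ _).1 hp).2.1.1.symm
        · rw [h2]
          exact ((hgood _ _ _).1 hg).2.1.2.symm
    · intro s hs
      rcases lt_or_ge s m with h | h
      · have e1 := hyl ⟨s, h⟩
        simp only at e1
        rw [e1]
        rcases hf1 ⟨s, h⟩ with h2 | ⟨j, hj, u, hg, h2⟩
        · simp only at h2
          rw [h2]
          exact hy1 ⟨s, h⟩
        · simp only at h2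
          rw [h2]
          exact ((hgood _ _ _).1 hg).1.2.symm
      · obtain ⟨j, rfl⟩ := Nat.exists_eq_add_of_le h
        rw [hyr]
        rcases hf2 j (by omega) with h2 | ⟨i, u, hg, h2⟩
        · rw [h2]
          obtain ⟨p, hp⟩ := (hT j (by omega)).2.2.2
          exact ((hgood _ _ _).1 hp).2.2.1
        · rw [h2]
          exact ((hgood _ _ _).1 hg).2.2.2
  · have px : ∀ s < 2 * m, ∃ i, 1 ≤ i ∧ i < 8 * m + 2 ∧ absPath m z₁ z₂ c x f y i = x s :=
      fun s hs => ⟨4 * s + 2, by omega, by omega, absPath_x _ _ _ _ _ _ _ _ hs⟩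
    have py : ∀ s < 2 * m, ∃ i, 1 ≤ i ∧ i < 8 * m + 2 ∧ absPath m z₁ z₂ c x f y i = y s :=
      fun s hs => ⟨4 * s + 4, by omega, by omega, absPath_y ..⟩
    have pf : ∀ s < 2 * m, ∃ i, 1 ≤ i ∧ i < 8 * m + 2 ∧ absPath m z₁ z₂ c x f y i = f s :=
      fun s hs => ⟨4 * s + 3, by omega, by omega, absPath_f ..⟩
    intro v hv
    simp only [mem_union] at hv
    rcases hv with ((hv | hv) | hv) | hv
    · simp only [hA1, mem_image, mem_univ, true_and] at hv
      obtain ⟨s, rfl⟩ := hv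
      rcases s with i | i
      · rw [← hxl]
        exact px i (by omega)
      · rw [← hyl]
        exact py i (by omega)
    · simp only [hA2, mem_biUnion, mem_range] at hv
      obtain ⟨j, hj, hv⟩ := hv
      rw [abs_mem_supp] at hv
      rcases hv with rfl | rfl | rfl
      · obtain ⟨s, hs, h⟩ := hf4 j hj
        rw [← h]
        exact pf s hs
      · rw [← hxr]
        exact px _ (by omega)
      · rw [← hyr]
        exact py _ (by omega)
    · simp only [hA3, mem_image, mem_univ, true_and] at hv
      obtain ⟨s, rfl⟩ := hv
      refine ⟨4 * s + 1, by omega, by omega, ?_⟩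
      rw [absPath_c, hc s s.2]
    · obtain ⟨s, hs, rfl⟩ := hf3 v hv
      exact pf s hs

end AbsHelpers

lemma abs_pot (α β γ : ℝ) (hα : 0 < α) (hα1 : α ≤ 1) (hβ : 0 < β)
    (hγ : γ ≤ α ^ 3 * β / 64) (n m k D : ℕ)
    (hn1 : 54 / (3 * α ^ 3 * β / 64) ^ 3 < n) (hn0 : 0 < n)
    (hm : β * n - 1 ≤ m) (hmn : m ≤ n) (hk : (k : ℝ) ≤ γ * n + 1) (hD : α * n / 2 ≤ D)
    (hDn : D ≤ n) :
    ((n : ℝ) * m) * (1 - ((D : ℝ) / n) ^ 3 / 2) ^ m < (1 / 2) ^ k := by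
  set κ : ℝ := 3 * α ^ 3 * β / 64 with hκ
  have hκ0 : 0 < κ := by positivity
  have hnR : (0 : ℝ) < n := by exact_mod_cast hn0
  set q : ℝ := (D : ℝ) / n with hq
  have hq1 : q ≤ 1 := by
    rw [hq, div_le_one hnR]; exact_mod_cast hDn
  have hq0 : α / 2 ≤ q := by
    rw [hq, le_div_iff₀ hnR]; linarith
  have hqp : (α / 2) ^ 3 ≤ q ^ 3 := pow_le_pow_left₀ (by positivity) hq0 3
  have hqp1 : q ^ 3 ≤ 1 := pow_le_one₀ (by linarith) hq1
  have hα3 : α ^ 3 ≤ 1 := pow_le_one₀ hα.le hα1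
  have hα30 : 0 < α ^ 3 := by positivity
  have h1 : (1 - q ^ 3 / 2) ^ m ≤ Real.exp (-(α ^ 3 / 16) * m) := by
    have : 1 - q ^ 3 / 2 ≤ Real.exp (-(α ^ 3 / 16)) := by
      have := Real.one_sub_le_exp_neg (α ^ 3 / 16)
      have e : (α / 2) ^ 3 = α ^ 3 / 8 := by ring
      rw [e] at hqp
      linarith
    calc (1 - q ^ 3 / 2) ^ m ≤ (Real.exp (-(α ^ 3 / 16))) ^ m :=
          pow_le_pow_left₀ (by linarith) this m
      _ = _ := by rw [← Real.exp_nat_mul]; ring_nf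
  have h2 : Real.exp (-(γ * n + 1)) ≤ (1 / 2 : ℝ) ^ k := by
    have : Real.exp (-1) ≤ 1 / 2 := by
      rw [Real.exp_neg, one_div]
      apply inv_anti₀ (by norm_num)
      have := Real.add_one_le_exp (1 : ℝ)
      linarith
    calc Real.exp (-(γ * n + 1)) ≤ Real.exp (-(k : ℝ)) := Real.exp_le_exp.2 (by linarith)
      _ = (Real.exp (-1)) ^ k := by rw [← Real.exp_nat_mul]; ring_nf
      _ ≤ _ := pow_le_pow_left₀ (Real.exp_pos _).le this k
  have h3 : (n : ℝ) * m ≤ (n : ℝ) ^ 2 := by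
    have : (m : ℝ) ≤ n := by exact_mod_cast hmn
    nlinarith
  have h4 : 9 * (n : ℝ) ^ 2 < Real.exp (κ * n) := by
    have h5 := Real.pow_div_factorial_le_exp (κ * n) (by positivity) 3
    have h6 : (Nat.factorial 3 : ℝ) = 6 := by norm_num [Nat.factorial]
    rw [h6] at h5
    rw [div_lt_iff₀ (by positivity)] at hn1
    have : (n : ℝ) ^ 2 * 54 < (n : ℝ) ^ 2 * (n * κ ^ 3) :=
      mul_lt_mul_of_pos_left hn1 (by positivity)
    have e : (κ * n) ^ 3 = (n : ℝ) ^ 2 * (n * κ ^ 3) := by ring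
    rw [e] at h5
    linarith
  have h7 : Real.exp 2 ≤ 9 := by
    have := Real.exp_one_lt_d9
    have e : Real.exp 2 = Real.exp 1 * Real.exp 1 := by rw [← Real.exp_add]; norm_num
    have := Real.exp_pos 1
    rw [e]
    nlinarith
  have h8 : (n : ℝ) ^ 2 < Real.exp (κ * n - 2) := by
    rw [Real.exp_sub, lt_div_iff₀ (Real.exp_pos _)]
    have : (0 : ℝ) < (n : ℝ) ^ 2 := by positivity
    nlinarith
  have h9 : κ * n - 2 + -(α ^ 3 / 16) * m ≤ -(γ * n + 1) := by
    have a1 : α ^ 3 / 16 * (β * n - 1) ≤ α ^ 3 / 16 * m :=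
      mul_le_mul_of_nonneg_left hm (by positivity)
    have a2 : γ * n ≤ α ^ 3 * β / 64 * n := mul_le_mul_of_nonneg_right hγ hnR.le
    have a3 : κ * n = 3 * (α ^ 3 * β / 64 * n) := by rw [hκ]; ring
    have a4 : α ^ 3 / 16 * (β * n - 1) = 4 * (α ^ 3 * β / 64 * n) - α ^ 3 / 16 := by ring
    linarith
  have hnn : 0 ≤ (1 - q ^ 3 / 2) ^ m := pow_nonneg (by linarith) m
  calc ((n : ℝ) * m) * (1 - q ^ 3 / 2) ^ m
      ≤ (n : ℝ) ^ 2 * (1 - q ^ 3 / 2) ^ m := mul_le_mul_of_nonneg_right h3 hnn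
    _ ≤ (n : ℝ) ^ 2 * Real.exp (-(α ^ 3 / 16) * m) :=
        mul_le_mul_of_nonneg_left h1 (by positivity)
    _ < Real.exp (κ * n - 2) * Real.exp (-(α ^ 3 / 16) * m) :=
        mul_lt_mul_of_pos_right h8 (Real.exp_pos _)
    _ = Real.exp (κ * n - 2 + -(α ^ 3 / 16) * m) := (Real.exp_add _ _).symm
    _ ≤ Real.exp (-(γ * n + 1)) := Real.exp_le_exp.2 h9
    _ ≤ _ := h2

open Classical in
lemma abs_common (n : ℕ) (α : ℝ) (hα : 0 < α) (H K : SimpleGraph (Fin n)) (u v : Fin n)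
    (hu : (1 / 2 + α) * n ≤ (H.neighborSet u).ncard)
    (hv : (1 / 2 + α) * n ≤ (K.neighborSet v).ncard) :
    2 * ⌊α * n⌋₊ ≤ (Finset.univ.filter fun x => H.Adj u x ∧ K.Adj v x).card := by
  have e1 : ∀ (F : SimpleGraph (Fin n)) (u : Fin n),
      (F.neighborSet u).ncard = (Finset.univ.filter fun x => F.Adj u x).card := by
    intro F u
    rw [← Set.ncard_coe_finset]
    congr 1
    ext x
    simp
  rw [e1] at hu hv
  rw [Finset.filter_and]
  have h1 := Finset.card_inter_add_card_union (Finset.univ.filter fun x => H.Adj u x)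
    (Finset.univ.filter fun x => K.Adj v x)
  have h2 := Finset.card_le_univ ((Finset.univ.filter fun x => H.Adj u x) ∪
    (Finset.univ.filter fun x => K.Adj v x))
  rw [Fintype.card_fin] at h2
  have h3 : (⌊α * n⌋₊ : ℝ) ≤ α * n := Nat.floor_le (by positivity)
  have h1' := congrArg (fun x : ℕ => (x : ℝ)) h1
  have h2' : ((_ : ℕ) : ℝ) ≤ n := Nat.cast_le.2 h2
  push_cast at h1'
  rw [← Nat.cast_le (α := ℝ)]
  push_cast
  linarith

/-- Lemma 3.1 (absorbing path): for `0 < 1/n ≪ γ ≪ β ≪ α ≤ 1` there is `a ≤ 500βn`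
such that, with `t := a + ⌊βn⌋ + 1`, for any graphs `G₁,…,G_t` on `{1,…,n}` with
minimum degree at least `(1/2+α)n`, any set `Z` of size `⌊(β+γ)n⌋ + 2` and distinct
`z₁, z₂ ∈ Z`, there is a set `A ⊆ V \ Z` of size `a` such that for every
`Z' ⊆ Z \ {z₁,z₂}` of size `⌊βn⌋` there is a `z₁,z₂`-path `e₁…e_t` whose internal
vertices are exactly `A ∪ Z'` and with `e_i ∈ G_i` for all `i`. -/
theorem stmt_17 (α : ℝ) (hα : 0 < α) (hα1 : α ≤ 1) :
    ∃ β₀ : ℝ, 0 < β₀ ∧ ∀ β : ℝ, 0 < β → β ≤ β₀ →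
    ∃ γ₀ : ℝ, 0 < γ₀ ∧ ∀ γ : ℝ, 0 < γ → γ ≤ γ₀ →
    ∃ n₀ : ℕ, ∀ n : ℕ, n₀ ≤ n →
    ∃ a : ℕ, (a : ℝ) ≤ 500 * β * n ∧
    ∀ G : Fin (a + ⌊β * n⌋₊ + 1) → SimpleGraph (Fin n),
    (∀ (i : Fin (a + ⌊β * n⌋₊ + 1)) (v : Fin n),
      (1/2 + α) * n ≤ ((G i).neighborSet v).ncard) →
    ∀ Z : Finset (Fin n), Z.card = ⌊(β + γ) * n⌋₊ + 2 →
    ∀ z₁ z₂ : Fin n, z₁ ∈ Z → z₂ ∈ Z → z₁ ≠ z₂ →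
    ∃ A : Finset (Fin n), A.card = a ∧ Disjoint A Z ∧
      ∀ Z' : Finset (Fin n), Z' ⊆ Z \ {z₁, z₂} → Z'.card = ⌊β * n⌋₊ →
      ∃ p : Fin (a + ⌊β * n⌋₊ + 2) → Fin n, Function.Injective p ∧
        p 0 = z₁ ∧ p (Fin.last (a + ⌊β * n⌋₊ + 1)) = z₂ ∧
        (p '' {i | i ≠ 0 ∧ i ≠ Fin.last (a + ⌊β * n⌋₊ + 1)}) = ↑A ∪ ↑Z' ∧
        ∀ i : Fin (a + ⌊β * n⌋₊ + 1), (G i).Adj (p i.castSucc) (p i.succ) := by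
  refine ⟨α / 100, by positivity, fun β hβ hβ0 => ⟨α ^ 3 * β / 64, by positivity, ?_⟩⟩
  intro γ hγ hγ0
  refine ⟨⌈2 / β + 54 / (3 * α ^ 3 * β / 64) ^ 3 + 100 / α⌉₊ + 1, ?_⟩
  intro n hn
  have hnR : 2 / β + 54 / (3 * α ^ 3 * β / 64) ^ 3 + 100 / α < n := by
    have h1 := Nat.le_ceil (2 / β + 54 / (3 * α ^ 3 * β / 64) ^ 3 + 100 / α)
    have h2 : ((⌈2 / β + 54 / (3 * α ^ 3 * β / 64) ^ 3 + 100 / α⌉₊ + 1 : ℕ) : ℝ) ≤ n :=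
      Nat.cast_le.2 hn
    push_cast at h2
    linarith
  have p1 : 0 < 2 / β := by positivity
  have p2 : 0 < 54 / (3 * α ^ 3 * β / 64) ^ 3 := by positivity
  have p3 : 0 < 100 / α := by positivity
  have hn0R : (0 : ℝ) < n := by linarith
  have hn0 : 0 < n := by exact_mod_cast hn0R
  have hβn : 2 < β * n := by
    have : 2 / β < n := by linarith
    rw [div_lt_iff₀ hβ] at this
    linarith
  have hαn : 100 < α * n := by
    have : 100 / α < n := by linarith
    rw [div_lt_iff₀ hα] at this
    linarith
  have hα3 : α ^ 3 ≤ 1 := pow_le_one₀ hα.le hα1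
  have hγβ : γ ≤ β := by
    have : α ^ 3 * β ≤ 1 * β := mul_le_mul_of_nonneg_right hα3 hβ.le
    linarith
  have hβαn : β * n ≤ α / 100 * n := mul_le_mul_of_nonneg_right hβ0 hn0R.le
  have hγβn : γ * n ≤ β * n := mul_le_mul_of_nonneg_right hγβ hn0R.le
  have hγn0 : 0 ≤ γ * n := by positivity
  have hαn1 : α * n ≤ 1 * n := mul_le_mul_of_nonneg_right hα1 hn0R.le
  have hmle : (⌊β * n⌋₊ : ℝ) ≤ β * n := Nat.floor_le (by positivity)
  have hmlt : β * n < ⌊β * n⌋₊ + 1 := Nat.lt_floor_add_one _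
  have hmkle : (⌊(β + γ) * n⌋₊ : ℝ) ≤ (β + γ) * n := Nat.floor_le (by positivity)
  have hmk : ⌊β * n⌋₊ ≤ ⌊(β + γ) * n⌋₊ := Nat.floor_le_floor (by linarith)
  obtain ⟨k, hk⟩ := Nat.exists_eq_add_of_le hmk
  rw [hk] at hmkle ⊢
  set m := ⌊β * n⌋₊ with hm
  push_cast at hmkle
  have hm1 : 1 ≤ m := by
    have : (1 : ℝ) ≤ m := by linarith
    exact_mod_cast this
  refine ⟨7 * m + 1, ?_, ?_⟩
  · push_cast
    linarith
  intro G hG Z hZ z₁ z₂ hz1 hz2 hz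
  set D := ⌊α * n⌋₊ with hDdef
  have hDle : (D : ℝ) ≤ α * n := Nat.floor_le (by positivity)
  have hDlt : α * n < D + 1 := Nat.lt_floor_add_one _
  let G' : ℕ → SimpleGraph (Fin n) := fun i => if h : i < 7 * m + 1 + m + 1 then G ⟨i, h⟩ else G 0
  have hG' : ∀ i v, (1 / 2 + α) * n ≤ ((G' i).neighborSet v).ncard := by
    intro i v
    simp only [G']
    split_ifs
    · exact hG _ v
    · exact hG _ v
  have hkle : (k : ℝ) ≤ γ * n + 1 := by linarith
  have hDn : D ≤ n := by
    have : (D : ℝ) ≤ n := by linarith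
    exact_mod_cast this
  have hmn : m ≤ n := by
    have : (m : ℝ) ≤ n := by linarith
    exact_mod_cast this
  obtain ⟨A, hAc, hAZ, hA⟩ := abs_core G' D m k hm1
    (fun i j u v => abs_common n α hα _ _ u v (hG' i u) (hG' j v))
    (by
      have : (20 * m + k + 20 : ℝ) ≤ D := by linarith
      exact_mod_cast this)
    (by
      rw [Fintype.card_fin]
      exact abs_pot α β γ hα hα1 hβ hγ0 n m k D (by linarith) hn0 (by linarith) hmn hkle
        (by linarith) hDn)
    Z hZ z₁ z₂ hz1 hz2 hz
  refine ⟨A, hAc, hAZ, ?_⟩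
  intro Z' hZ' hZ'c
  obtain ⟨P, hP0, hPl, hPadj, hPs⟩ := hA Z' hZ' hZ'c
  have hdis : Disjoint A Z' := hAZ.mono_right (hZ'.trans Finset.sdiff_subset)
  have hz1' : z₁ ∉ A ∪ Z' := by
    rw [Finset.mem_union, not_or]
    refine ⟨fun h => (Finset.disjoint_left.1 hAZ h) hz1, fun h => ?_⟩
    have := hZ' h
    simp at this
  have hz2' : z₂ ∉ A ∪ Z' := by
    rw [Finset.mem_union, not_or]
    refine ⟨fun h => (Finset.disjoint_left.1 hAZ h) hz2, fun h => ?_⟩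
    have := hZ' h
    simp at this
  set I : Finset ℕ := Finset.Ico 1 (8 * m + 2) with hI
  have hIc : I.card = 8 * m + 1 := by simp [hI]
  have hsub : A ∪ Z' ⊆ I.image P := by
    intro v hv
    obtain ⟨i, h1, h2, h3⟩ := hPs v hv
    exact Finset.mem_image.2 ⟨i, by simp [hI]; omega, h3⟩
  have hAZc : (A ∪ Z').card = 8 * m + 1 := by
    rw [Finset.card_union_of_disjoint hdis, hAc, hZ'c]
    omega
  have himg : A ∪ Z' = I.image P :=
    Finset.eq_of_subset_of_card_le hsub (by
      rw [hAZc, ← hIc]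
      exact Finset.card_image_le)
  have hinj : Set.InjOn P I := by
    rw [← Finset.card_image_iff, ← himg, hAZc, hIc]
  have hmemI : ∀ i ∈ I, P i ∈ A ∪ Z' := fun i hi => by
    rw [himg]
    exact Finset.mem_image_of_mem P hi
  have hcl : ∀ i : Fin (7 * m + 1 + m + 2), i.val = 0 ∨ i.val = 8 * m + 2 ∨ i.val ∈ I := by
    intro i
    have := i.2
    simp only [hI, Finset.mem_Ico]
    omega
  refine ⟨fun i => P i.val, ?_, ?_, ?_, ?_, ?_⟩
  · intro i j hij
    simp only at hij
    apply Fin.ext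
    rcases hcl i with hi | hi | hi <;> rcases hcl j with hj | hj | hj
    · omega
    · rw [hi, hj, hP0, hPl] at hij
      exact absurd hij hz
    · rw [hi, hP0] at hij
      exact absurd (hij ▸ hmemI _ hj) hz1'
    · rw [hi, hj, hP0, hPl] at hij
      exact absurd hij.symm hz
    · omega
    · rw [hi, hPl] at hij
      exact absurd (hij ▸ hmemI _ hj) hz2'
    · rw [hj, hP0] at hij
      exact absurd (hij ▸ hmemI _ hi) hz1'
    · rw [hj, hPl] at hij
      exact absurd (hij ▸ hmemI _ hi) hz2'
    · exact hinj hi hj hij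
  · exact hP0
  · have : (Fin.last (7 * m + 1 + m + 1)).val = 8 * m + 2 := by
      rw [Fin.val_last]
      omega
    simp only [this]
    exact hPl
  · rw [← Finset.coe_union]
    ext v
    simp only [Set.mem_image, Set.mem_ofPred_eq, Finset.mem_coe]
    constructor
    · rintro ⟨i, ⟨h1, h2⟩, rfl⟩
      apply hmemI
      have h1' : i.val ≠ 0 := fun h => h1 (Fin.ext h)
      have h2' : i.val ≠ 7 * m + 1 + m + 1 := fun h => h2 (Fin.ext h)
      have := i.2
      simp only [hI, Finset.mem_Ico]
      omega
    · intro hv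
      obtain ⟨i, h1, h2, h3⟩ := hPs v hv
      refine ⟨⟨i, by omega⟩, ⟨?_, ?_⟩, h3⟩
      · intro h
        have := congrArg Fin.val h
        simp at this
        omega
      · intro h
        have := congrArg Fin.val h
        simp at this
        omega
  · intro i
    have := hPadj i.val (by have := i.2; omega)
    simp only [G', dif_pos i.2] at this
    exact this
end
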